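/- Let n and m be positive integers. If every connected link projection with exactly n, n+1, or n+2 crossings has m or more pairwise independent regions, then every connected link projection with n or more crossings has m or more pairwise independent regions. -/

import Mathlib

/-!
Formalization framework for knot/link projections on the 2-sphere,
their regions, independent region sets, warping degree, and the
maximal independent region number, following Ohya–Shimizu,
"Lower bounds for the warping degree of a knot projection".
-/

noncomputable section
open Set

local instance : Fact ((0:ℝ) < 1) := ⟨zero_lt_one⟩

/-- The 2-sphere, realized as the unit sphere in ℝ³. -/
abbrev Sphere2 : Type := Metric.sphere (0 : EuclideanSpace ℝ (Fin 3)) 1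

/-- The parameter circle ℝ/ℤ. -/
abbrev Param : Type := AddCircle (1 : ℝ)

/-- The time (in `[0,1)`) needed to reach the point `t` when travelling from the
point `b` along the circle in the positive direction. -/
def timeFrom (b t : Param) : ℝ := ((AddCircle.equivIco 1 0) (t - b) : ℝ)

/-- A knot projection: a closed curve on the 2-sphere whose only
multiple points are finitely many transverse double points (crossings),
with at least one crossing.  (Each fibre of the parametrization is finite, of
cardinality at most two; the double points form a finite nonempty set.) -/
structure KnotProjection where
  /-- the parametrizing closed curve -/
  f : C(Param, Sphere2)
  fibers_finite : ∀ p : Sphere2, (f ⁻¹' {p} : Set Param).Finite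
  fibers_le_two : ∀ p : Sphere2, Nat.card (f ⁻¹' {p} : Set Param) ≤ 2
  crossings_finite : {p : Sphere2 | Nat.card (f ⁻¹' {p} : Set Param) = 2}.Finite
  exists_crossing : ∃ p : Sphere2, Nat.card (f ⁻¹' {p} : Set Param) = 2

namespace KnotProjection

/-- The image of the projection on the sphere. -/
def image (P : KnotProjection) : Set Sphere2 := Set.range P.f

/-- The crossings: the double points of the projection. -/
def crossings (P : KnotProjection) : Set Sphere2 :=
  {p : Sphere2 | Nat.card (P.f ⁻¹' {p} : Set Param) = 2}

/-- The crossing number `c(P)`. -/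
def crossingNumber (P : KnotProjection) : ℕ := Nat.card P.crossings

/-- A region: a connected component of the complement of the projection. -/
def IsRegion (P : KnotProjection) (R : Set Sphere2) : Prop :=
  ∃ x : Sphere2, x ∉ P.image ∧ R = connectedComponentIn P.imageᶜ x

/-- A region `R` is incident to a crossing `p` when `p` lies on the boundary of `R`. -/
def Incident (P : KnotProjection) (R : Set Sphere2) (p : Sphere2) : Prop :=
  P.IsRegion R ∧ p ∈ P.crossings ∧ p ∈ frontier R

/-- Two regions are independent when they share no crossing on their boundaries. -/
def IndepPair (P : KnotProjection) (R S : Set Sphere2) : Prop :=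
  ∀ p ∈ P.crossings, ¬(p ∈ frontier R ∧ p ∈ frontier S)

/-- A finite family of pairwise independent regions. -/
def IndepRegions (P : KnotProjection) (S : Finset (Set Sphere2)) : Prop :=
  (∀ R ∈ S, P.IsRegion R) ∧ (S : Set (Set Sphere2)).Pairwise P.IndepPair

/-- An independent region set for `P^c`: a finite family of pairwise independent
regions, none of which is incident to the base crossing `c`. -/
def IndepRegionsFor (P : KnotProjection) (c : Sphere2) (S : Finset (Set Sphere2)) : Prop :=
  P.IndepRegions S ∧ ∀ R ∈ S, c ∉ frontier R

/-- `IR(P^c)`: the maximal cardinality of an independent region set for `P^c`. -/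
def IRat (P : KnotProjection) (c : Sphere2) : ℕ :=
  sSup {m : ℕ | ∃ S : Finset (Set Sphere2), P.IndepRegionsFor c S ∧ m = S.card}

/-- `IR(P)`: the maximal independent region number of `P`. -/
def IR (P : KnotProjection) : ℕ :=
  sSup {m : ℕ | ∃ c ∈ P.crossings, m = P.IRat c}

/-- A crossing is reducible when two of the four local regions around it
coincide, i.e. when fewer than four regions are incident to it. -/
def Reducible (P : KnotProjection) (c : Sphere2) : Prop :=
  c ∈ P.crossings ∧ Nat.card {R : Set Sphere2 | P.IsRegion R ∧ c ∈ frontier R} < 4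

/-- A knot projection is reduced when it has no reducible crossing. -/
def Reduced (P : KnotProjection) : Prop := ∀ c : Sphere2, ¬ P.Reducible c

/-- Auxiliary: preimages under the reversal `t ↦ -t` have the same cardinality. -/
theorem card_neg_preimage (s : Set Param) :
    Nat.card ((Neg.neg : Param → Param) ⁻¹' s) = Nat.card s := by
  have h : (Neg.neg : Param → Param) ⁻¹' s = Neg.neg '' s := by
    ext t
    simp only [Set.mem_preimage, Set.mem_image]
    constructor
    · intro h; exact ⟨-t, h, neg_neg t⟩
    · rintro ⟨u, hu, rfl⟩; rwa [neg_neg]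
  rw [h, Nat.card_image_of_injective neg_injective]

/-- The same knot projection with the reversed orientation. -/
def reverse (P : KnotProjection) : KnotProjection where
  f := P.f.comp ⟨fun t => -t, continuous_neg⟩
  fibers_finite := by
    intro p
    have : (P.f.comp ⟨fun t => -t, continuous_neg⟩) ⁻¹' {p}
        = (Neg.neg : Param → Param) ⁻¹' (P.f ⁻¹' {p}) := rfl
    rw [this]
    exact (P.fibers_finite p).preimage (neg_injective.injOn)
  fibers_le_two := by
    intro p
    have : (P.f.comp ⟨fun t => -t, continuous_neg⟩) ⁻¹' {p}
        = (Neg.neg : Param → Param) ⁻¹' (P.f ⁻¹' {p}) := rfl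
    rw [this, card_neg_preimage]
    exact P.fibers_le_two p
  crossings_finite := by
    have : {p : Sphere2 |
        Nat.card ((P.f.comp ⟨fun t => -t, continuous_neg⟩) ⁻¹' {p} : Set Param) = 2}
        = {p : Sphere2 | Nat.card (P.f ⁻¹' {p} : Set Param) = 2} := by
      ext p
      have h : (P.f.comp ⟨fun t => -t, continuous_neg⟩) ⁻¹' {p}
          = (Neg.neg : Param → Param) ⁻¹' (P.f ⁻¹' {p}) := rfl
      simp only [Set.mem_setOf_eq, h, card_neg_preimage]
    rw [this]
    exact P.crossings_finite
  exists_crossing := by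
    obtain ⟨p, hp⟩ := P.exists_crossing
    refine ⟨p, ?_⟩
    have h : (P.f.comp ⟨fun t => -t, continuous_neg⟩) ⁻¹' {p}
        = (Neg.neg : Param → Param) ⁻¹' (P.f ⁻¹' {p}) := rfl
    rw [h, card_neg_preimage]
    exact hp

end KnotProjection

/-- A knot diagram: a knot projection together with over/under information; at
each crossing, `over` designates the parameter of the over-passage. -/
structure KnotDiagram extends KnotProjection where
  /-- the parameter at which the strand passes over the given crossing -/
  overParam : Sphere2 → Param
  over_mem : ∀ p ∈ toKnotProjection.crossings, toKnotProjection.f (overParam p) = p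

namespace KnotDiagram

/-- A passage through a crossing at parameter `t` is an over-passage when `t`
is the designated over-parameter of the crossing below. -/
def IsOverPass (D : KnotDiagram) (t : Param) : Prop :=
  t = D.overParam (D.toKnotProjection.f t)

/-- A diagram is alternating when, travelling along the diagram, consecutive
crossing passages are alternately over- and under-passages. -/
def Alternating (D : KnotDiagram) : Prop :=
  ∀ t₁ t₂ : Param,
    D.toKnotProjection.f t₁ ∈ D.toKnotProjection.crossings →
    D.toKnotProjection.f t₂ ∈ D.toKnotProjection.crossings →
    t₁ ≠ t₂ →
    (∀ s : Param, D.toKnotProjection.f s ∈ D.toKnotProjection.crossings →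
      s ≠ t₁ → s ≠ t₂ → timeFrom t₁ t₂ ≤ timeFrom t₁ s) →
    (D.IsOverPass t₁ ↔ ¬ D.IsOverPass t₂)

/-- A base point: a point of the diagram avoiding the crossings (given by its
parameter `b`). -/
def IsBasePoint (D : KnotDiagram) (b : Param) : Prop :=
  D.toKnotProjection.f b ∉ D.toKnotProjection.crossings

/-- A crossing `p` is a warping crossing point of `D_b` when, travelling from
`b`, one meets `p` first as an under-crossing, i.e. its under-passage occurs
strictly before its over-passage. -/
def IsWarping (D : KnotDiagram) (b : Param) (p : Sphere2) : Prop :=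
  p ∈ D.toKnotProjection.crossings ∧
  ∃ t : Param, D.toKnotProjection.f t = p ∧ t ≠ D.overParam p ∧
    timeFrom b t < timeFrom b (D.overParam p)

/-- The warping degree `d(D_b)` of the based diagram `D_b`. -/
def wdAt (D : KnotDiagram) (b : Param) : ℕ :=
  Nat.card {p : Sphere2 | D.IsWarping b p}

/-- The warping degree `d(D)` of the diagram: the minimum of `d(D_b)` over all
base points `b`. -/
def warpingDegree (D : KnotDiagram) : ℕ :=
  sInf {m : ℕ | ∃ b : Param, D.IsBasePoint b ∧ m = D.wdAt b}

end KnotDiagram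

/-- The warping degree `d(P)` of an (unoriented) knot projection: the minimal
warping degree of all oriented alternating diagrams obtained from `P` by
choosing an orientation and over/under information at every crossing. -/
def KnotProjection.warpingDegree (P : KnotProjection) : ℕ :=
  sInf {m : ℕ | ∃ D : KnotDiagram,
    (D.toKnotProjection = P ∨ D.toKnotProjection = P.reverse) ∧
    D.Alternating ∧ m = D.warpingDegree}

/-- A link projection: a closed curve with finitely many components on the
2-sphere whose only multiple points are finitely many double points. -/
structure LinkProjection where
  /-- the number of circle components -/
  comps : ℕ
  comps_pos : 0 < comps
  /-- the parametrizing curves -/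
  f : C(Fin comps × Param, Sphere2)
  fibers_finite : ∀ p : Sphere2, (f ⁻¹' {p} : Set (Fin comps × Param)).Finite
  fibers_le_two : ∀ p : Sphere2, Nat.card (f ⁻¹' {p} : Set (Fin comps × Param)) ≤ 2
  crossings_finite :
    {p : Sphere2 | Nat.card (f ⁻¹' {p} : Set (Fin comps × Param)) = 2}.Finite

namespace LinkProjection

/-- The image of the link projection on the sphere. -/
def image (L : LinkProjection) : Set Sphere2 := Set.range L.f

/-- The crossings: the double points of the projection. -/
def crossings (L : LinkProjection) : Set Sphere2 :=
  {p : Sphere2 | Nat.card (L.f ⁻¹' {p} : Set (Fin L.comps × Param)) = 2}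

/-- The crossing number of the link projection. -/
def crossingNumber (L : LinkProjection) : ℕ := Nat.card L.crossings

/-- A link projection is connected when its image is connected. -/
def Connected (L : LinkProjection) : Prop := IsConnected L.image

/-- A region: a connected component of the complement of the projection. -/
def IsRegion (L : LinkProjection) (R : Set Sphere2) : Prop :=
  ∃ x : Sphere2, x ∉ L.image ∧ R = connectedComponentIn L.imageᶜ x

/-- Two regions are independent when they share no crossing on their boundaries. -/
def IndepPair (L : LinkProjection) (R S : Set Sphere2) : Prop :=
  ∀ p ∈ L.crossings, ¬(p ∈ frontier R ∧ p ∈ frontier S)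

/-- A finite family of pairwise independent regions. -/
def IndepRegions (L : LinkProjection) (S : Finset (Set Sphere2)) : Prop :=
  (∀ R ∈ S, L.IsRegion R) ∧ (S : Set (Set Sphere2)).Pairwise L.IndepPair

/-- `L` has at least `m` pairwise independent regions. -/
def HasIndepRegions (L : LinkProjection) (m : ℕ) : Prop :=
  ∃ S : Finset (Set Sphere2), L.IndepRegions S ∧ m ≤ S.card

end LinkProjection


/-! ### Continuous logarithms -/

theorem lk_exists_log {E : Type*} [NormedAddCommGroup E] [NormedSpace ℝ E] (f : E → ℂ)
    (hf : Continuous f) (h0 : ∀ x, f x ≠ 0) :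
    ∃ g : E → ℂ, Continuous g ∧ ∀ x, Complex.exp (g x) = f x := by
  obtain ⟨F, ⟨_, hF⟩, _⟩ := Complex.isCoveringMap_exp.existsUnique_continuousMap_lifts
    (A := E) (⟨fun x => ⟨f x, h0 x⟩, by fun_prop⟩) 0 (Complex.log (f 0))
    (by ext; simp [Complex.exp_log (h0 0)])
  refine ⟨F, F.continuous, fun x => ?_⟩
  have := congr_fun hF x
  exact congrArg Subtype.val this

/-- clamp to the unit interval -/
def lkClamp (t : ℝ) : ℝ := max 0 (min 1 t)

theorem lkClamp_cont : Continuous lkClamp := by unfold lkClamp; fun_prop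
theorem lkClamp_mem (t : ℝ) : lkClamp t ∈ Icc (0 : ℝ) 1 := by
  unfold lkClamp; constructor <;> simp
theorem lkClamp_eq {t : ℝ} (h : t ∈ Icc (0 : ℝ) 1) : lkClamp t = t := by
  unfold lkClamp; rw [min_eq_right h.2, max_eq_right h.1]

theorem lk_exists_log_Icc (f : ℝ → ℂ) (hf : ContinuousOn f (Icc 0 1))
    (h0 : ∀ t ∈ Icc (0 : ℝ) 1, f t ≠ 0) :
    ∃ g : ℝ → ℂ, Continuous g ∧ ∀ t ∈ Icc (0 : ℝ) 1, Complex.exp (g t) = f t := by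
  obtain ⟨g, hg, h⟩ := lk_exists_log (fun t => f (lkClamp t))
    (hf.comp_continuous lkClamp_cont lkClamp_mem) (fun t => h0 _ (lkClamp_mem t))
  exact ⟨g, hg, fun t ht => by rw [h, lkClamp_eq ht]⟩

/-- locally constant functions on preconnected sets are constant -/
theorem lk_locconst {X Y : Type*} [TopologicalSpace X] {S : Set X} (hS : IsPreconnected S)
    (F : X → Y) (hF : ∀ x ∈ S, ∃ U ∈ nhds x, ∀ y ∈ U ∩ S, F y = F x) {a b : X} (ha : a ∈ S)
    (hb : b ∈ S) : F a = F b := by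
  have : PreconnectedSpace S := Subtype.preconnectedSpace hS
  have hl : IsLocallyConstant (fun x : S => F x) := by
    rw [IsLocallyConstant.iff_eventually_eq]
    rintro ⟨x, hx⟩
    obtain ⟨U, hU, h⟩ := hF x hx
    have : Subtype.val ⁻¹' U ∈ nhds (⟨x, hx⟩ : S) := continuous_subtype_val.continuousAt hU
    filter_upwards [this] with y hy
    exact h _ ⟨hy, y.2⟩
  exact hl.apply_eq_of_preconnectedSpace ⟨a, ha⟩ ⟨b, hb⟩

/-- a continuous function whose exponential is one on a preconnected set is constant -/
theorem lk_exp_const {X : Type*} [TopologicalSpace X] {S : Set X} (hS : IsPreconnected S)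
    (g : X → ℂ) (hg : ContinuousOn g S) (h : ∀ x ∈ S, Complex.exp (g x) = 1) {a b : X}
    (ha : a ∈ S) (hb : b ∈ S) : g a = g b := by
  apply lk_locconst hS g _ ha hb
  intro x hx
  have hc := hg x hx
  have : g ⁻¹' (Metric.ball (g x) 1) ∈ nhdsWithin x S := hc (Metric.ball_mem_nhds _ one_pos)
  obtain ⟨U, hU, hUS⟩ := mem_nhdsWithin_iff_exists_mem_nhds_inter.1 this
  refine ⟨U, hU, fun y hy => ?_⟩
  have hd : dist (g y) (g x) < 1 := hUS hy
  have he : Complex.exp (g y) = Complex.exp (g x) := by rw [h y hy.2, h x hx]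
  obtain ⟨n, hn⟩ := Complex.exp_eq_exp_iff_exists_int.1 he
  rw [hn] at hd ⊢
  rw [dist_eq_norm, add_sub_cancel_left, norm_mul] at hd
  simp only [Complex.norm_intCast, norm_mul, Complex.norm_ofNat, Complex.norm_real,
    Complex.norm_I, mul_one, Real.norm_eq_abs, abs_of_pos Real.pi_pos] at hd
  have hn0 : n = 0 := by
    by_contra hne
    have : (1 : ℝ) ≤ |(n : ℝ)| := by exact_mod_cast Int.one_le_abs hne
    nlinarith [Real.pi_gt_three]
  simp [hn0]

/-- `f` has a continuous logarithm on `X` -/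
def LkHasLog (f : ℂ → ℂ) (X : Set ℂ) : Prop :=
  ∃ g : ℂ → ℂ, ContinuousOn g X ∧ ∀ x ∈ X, Complex.exp (g x) = f x

theorem LkHasLog.mono {f : ℂ → ℂ} {X Y : Set ℂ} (h : LkHasLog f Y) (hXY : X ⊆ Y) : LkHasLog f X := by
  obtain ⟨g, hg, h⟩ := h
  exact ⟨g, hg.mono hXY, fun x hx => h x (hXY hx)⟩

theorem LkHasLog.congr {f f' : ℂ → ℂ} {X : Set ℂ} (h : LkHasLog f X) (hXY : ∀ x ∈ X, f x = f' x) :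
    LkHasLog f' X := by
  obtain ⟨g, hg, h⟩ := h
  exact ⟨g, hg, fun x hx => (h x hx).trans (hXY x hx)⟩

theorem LkHasLog.mul {f f' : ℂ → ℂ} {X : Set ℂ} (h : LkHasLog f X) (h' : LkHasLog f' X) :
    LkHasLog (fun x => f x * f' x) X := by
  obtain ⟨g, hg, h⟩ := h
  obtain ⟨g', hg', h'⟩ := h'
  exact ⟨fun x => g x + g' x, hg.add hg', fun x hx => by rw [Complex.exp_add, h x hx, h' x hx]⟩

/-- no logarithm of a nonzero power of `z - a` on a large circle -/
theorem lk_no_log_circle (a : ℂ) (R : ℝ) (hR : 0 < R) (n : ℤ) (hn : n ≠ 0) (L : ℂ → ℂ)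
    (hL : Continuous L) (h : ∀ z, ‖z - a‖ = R → Complex.exp (L z) = (z - a) ^ n) : False := by
  have key := lk_exp_const (S := (univ : Set ℝ)) isPreconnected_univ
    (fun t : ℝ => L (a + R * Complex.exp (t * Complex.I)) - n * (t * Complex.I)
      - n * Complex.log R)
    (by fun_prop) ?_ (mem_univ 0) (mem_univ (2 * Real.pi))
  · have e1 : Complex.exp (((2 * Real.pi : ℝ) : ℂ) * Complex.I) = 1 := by
      push_cast; exact Complex.exp_two_pi_mul_I
    simp only [e1] at key
    simp at key
    have hpi : (Real.pi : ℂ) ≠ 0 := by exact_mod_cast Real.pi_ne_zero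
    have hn' : (n : ℂ) ≠ 0 := by exact_mod_cast hn
    have h3 : (n : ℂ) * (2 * Real.pi * Complex.I) = 0 := by linear_combination key
    simp [hn, hpi, Complex.I_ne_zero] at h3
  · intro t _
    have hR' : (R : ℂ) ≠ 0 := by exact_mod_cast hR.ne'
    rw [Complex.exp_sub, Complex.exp_sub, h]
    · rw [add_sub_cancel_left, mul_zpow, Complex.exp_int_mul, Complex.exp_int_mul,
        Complex.exp_log hR']
      have := zpow_ne_zero n hR'
      have := zpow_ne_zero n (Complex.exp_ne_zero (t * Complex.I))
      field_simp
    · rw [add_sub_cancel_left, norm_mul, Complex.norm_exp_ofReal_mul_I]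
      simp [abs_of_pos hR]

/-- Borsuk: the key extension argument. -/
theorem lk_borsuk {U : Set ℂ} (hU : IsOpen U) (hb : Bornology.IsBounded U) {a : ℂ} (ha : a ∈ U)
    {n : ℤ} (hn : n ≠ 0) (φ : ℂ → ℂ) (hφ : ContinuousOn φ (closure U))
    (hφ0 : ∀ z ∈ closure U, φ z ≠ 0)
    (h : LkHasLog (fun z => (z - a) ^ n * φ z) (frontier U)) : False := by
  classical
  obtain ⟨g, hg, h⟩ := h
  obtain ⟨G, hG⟩ := ContinuousMap.exists_restrict_eq (Y := ℂ) (isClosed_frontier (s := U))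
    ⟨(frontier U).domRestrict g, hg.domRestrict⟩
  have hGg : ∀ z ∈ frontier U, G z = g z := fun z hz => DFunLike.congr_fun hG ⟨z, hz⟩
  let Φ : ℂ → ℂ := fun z => if z ∈ U then Complex.exp (G z) / φ z else (z - a) ^ n
  have hne : ∀ z ∉ U, z - a ≠ 0 := fun z hz h => hz (by rw [sub_eq_zero.1 h]; exact ha)
  have hΦ : Continuous Φ := by
    apply continuous_if
    · intro z hz
      rw [show {x | x ∈ U} = U from rfl] at hz
      rw [hGg z hz, h z hz, mul_div_cancel_right₀ _ (hφ0 z (frontier_subset_closure hz))]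
    · exact (by fun_prop : ContinuousOn (fun z => Complex.exp (G z)) _).div hφ hφ0
    · apply ContinuousOn.mono (s := Uᶜ)
      · exact ContinuousOn.zpow₀ (by fun_prop) _ (fun z hz => Or.inl (hne z hz))
      · rw [show {x | x ∉ U} = Uᶜ from rfl, hU.isClosed_compl.closure_eq]
  have hΦ0 : ∀ z, Φ z ≠ 0 := by
    intro z
    by_cases hz : z ∈ U
    · simp only [Φ, hz, if_true]
      exact div_ne_zero (Complex.exp_ne_zero _) (hφ0 z (subset_closure hz))
    · simp only [Φ, hz, if_false]
      exact zpow_ne_zero _ (hne z hz)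
  obtain ⟨L, hL, hLe⟩ := lk_exists_log Φ hΦ hΦ0
  obtain ⟨R, hR⟩ := hb.subset_ball a
  refine lk_no_log_circle a (max R 1) (by positivity) n hn L hL fun z hz => ?_
  rw [hLe]
  have : z ∉ U := fun hzU => by
    have := hR hzU
    rw [Metric.mem_ball, dist_eq_norm, hz] at this
    exact absurd (le_max_left R 1) (not_le.2 this)
  simp [Φ, this]

/-! ### Components of complements -/

theorem lk_comp_frontier {Z : Type*} [TopologicalSpace Z] [LocallyConnectedSpace Z]
    {X : Set Z} (hX : IsClosed X) (a : Z) : frontier (connectedComponentIn Xᶜ a) ⊆ X := by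
  intro z hz
  by_contra hzX
  have hop : IsOpen (connectedComponentIn Xᶜ z) := hX.isOpen_compl.connectedComponentIn
  have hop' : IsOpen (connectedComponentIn Xᶜ a) := hX.isOpen_compl.connectedComponentIn
  have hz1 : z ∈ connectedComponentIn Xᶜ z := mem_connectedComponentIn hzX
  rw [frontier, hop'.interior_eq] at hz
  obtain ⟨w, hw1, hw2⟩ := mem_closure_iff.1 hz.1 _ hop hz1
  have h1 := connectedComponentIn_eq hw1
  have h2 := connectedComponentIn_eq hw2
  exact hz.2 (by rw [h2, ← h1]; exact hz1)

theorem lk_compl_ball_preconn (R : ℝ) (hR : 0 < R) :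
    IsPreconnected (Metric.closedBall (0 : ℂ) R)ᶜ := by
  have : (Metric.closedBall (0 : ℂ) R)ᶜ =
      (fun p : ℝ × ℝ => (p.1 : ℂ) * Complex.exp (p.2 * Complex.I)) '' (Ioi R ×ˢ univ) := by
    ext z
    simp only [mem_compl_iff, Metric.mem_closedBall, dist_zero_right, not_le, mem_image, Prod.exists,
      mem_prod, mem_Ioi, mem_univ, and_true]
    constructor
    · intro hz
      exact ⟨‖z‖, z.arg, hz, Complex.norm_mul_exp_arg_mul_I z⟩
    · rintro ⟨r, t, hr, rfl⟩
      rw [norm_mul, Complex.norm_exp_ofReal_mul_I, mul_one, Complex.norm_real, Real.norm_eq_abs,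
        abs_of_pos (hR.trans hr)]
      exact hr
  rw [this]
  exact ((isPreconnected_Ioi.prod isPreconnected_univ).image _ (by fun_prop))

/-- two points in different components: one of the components is bounded -/
theorem lk_one_bounded {X : Set ℂ} (hX : IsCompact X) {a b : ℂ}
    (hab : b ∉ connectedComponentIn Xᶜ a) :
    Bornology.IsBounded (connectedComponentIn Xᶜ a) ∨
    Bornology.IsBounded (connectedComponentIn Xᶜ b) := by
  by_contra hcon
  push Not at hcon
  obtain ⟨h1, h2⟩ := hcon
  obtain ⟨R0, hR0⟩ := hX.isBounded.subset_closedBall 0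
  obtain ⟨R, hR0R, hR⟩ : ∃ R, R0 ≤ R ∧ 0 < R := ⟨max R0 1, le_max_left _ _, by positivity⟩
  have hXR : X ⊆ Metric.closedBall 0 R := hR0.trans (Metric.closedBall_subset_closedBall hR0R)
  have hsub : (Metric.closedBall (0 : ℂ) R)ᶜ ⊆ Xᶜ := compl_subset_compl.2 hXR
  have key : ∀ c, ¬ Bornology.IsBounded (connectedComponentIn Xᶜ c) →
      (Metric.closedBall (0 : ℂ) R)ᶜ ⊆ connectedComponentIn Xᶜ c := by
    intro c hc
    have : ∃ w ∈ connectedComponentIn Xᶜ c, w ∉ Metric.closedBall (0 : ℂ) R := by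
      by_contra hh
      push Not at hh
      exact hc (Metric.isBounded_closedBall.subset hh)
    obtain ⟨w, hw, hwR⟩ := this
    rw [connectedComponentIn_eq hw]
    exact (lk_compl_ball_preconn R hR).subset_connectedComponentIn hwR hsub
  have hw : ((R + 1 : ℝ) : ℂ) ∈ (Metric.closedBall (0 : ℂ) R)ᶜ := by
    simp only [mem_compl_iff, Metric.mem_closedBall, dist_zero_right, Complex.norm_real,
      Real.norm_eq_abs, not_le]
    rw [abs_of_pos (by linarith)]; linarith
  have ha := connectedComponentIn_eq (key a h1 hw)
  have hb := connectedComponentIn_eq (key b h2 hw)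
  have hbX : b ∈ Xᶜ := by
    by_contra hbX
    rw [connectedComponentIn_eq_empty hbX] at h2
    exact h2 Bornology.isBounded_empty
  rw [ha, ← hb] at hab
  exact hab (mem_connectedComponentIn hbX)

theorem lk_not_mem_closure {X : Set ℂ} (hX : IsClosed X) {a b : ℂ} (hb : b ∉ X)
    (hab : b ∉ connectedComponentIn Xᶜ a) : b ∉ closure (connectedComponentIn Xᶜ a) := by
  intro h
  have hf : b ∈ frontier (connectedComponentIn Xᶜ a) :=
    ⟨h, fun hi => hab (interior_subset hi)⟩
  exact hb (lk_comp_frontier hX a hf)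

/-- the independence statement for up to three points -/
theorem lk_sep_core {X : Set ℂ} (hX : IsCompact X) {a b c : ℂ} (ha : a ∉ X) (hb : b ∉ X)
    (hc : c ∉ X) (hab : b ∉ connectedComponentIn Xᶜ a) (hac : c ∉ connectedComponentIn Xᶜ a)
    (hbd : Bornology.IsBounded (connectedComponentIn Xᶜ a)) {n k l : ℤ} (hn : n ≠ 0)
    (h : LkHasLog (fun z => (z - a) ^ n * ((z - b) ^ k * (z - c) ^ l)) X) : False := by
  refine lk_borsuk hX.isClosed.isOpen_compl.connectedComponentIn hbd
    (mem_connectedComponentIn ha) hn (fun z => (z - b) ^ k * (z - c) ^ l) ?_ ?_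
    (h.mono (lk_comp_frontier hX.isClosed a))
  · have h1 : ∀ z ∈ closure (connectedComponentIn Xᶜ a), z - b ≠ 0 := fun z hz h0 =>
      lk_not_mem_closure hX.isClosed hb hab (by rwa [← sub_eq_zero.1 h0])
    have h2 : ∀ z ∈ closure (connectedComponentIn Xᶜ a), z - c ≠ 0 := fun z hz h0 =>
      lk_not_mem_closure hX.isClosed hc hac (by rwa [← sub_eq_zero.1 h0])
    exact (ContinuousOn.zpow₀ (by fun_prop) _ (fun z hz => Or.inl (h1 z hz))).mul
      (ContinuousOn.zpow₀ (by fun_prop) _ (fun z hz => Or.inl (h2 z hz)))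
  · intro z hz
    have h1 : z - b ≠ 0 := fun h0 =>
      lk_not_mem_closure hX.isClosed hb hab (by rwa [← sub_eq_zero.1 h0])
    have h2 : z - c ≠ 0 := fun h0 =>
      lk_not_mem_closure hX.isClosed hc hac (by rwa [← sub_eq_zero.1 h0])
    exact mul_ne_zero (zpow_ne_zero _ h1) (zpow_ne_zero _ h2)

theorem lk_comp_symm {Z : Type*} [TopologicalSpace Z] {S : Set Z} {a b : Z} (ha : a ∈ S)
    (h : b ∈ connectedComponentIn S a) : a ∈ connectedComponentIn S b := by
  rw [← connectedComponentIn_eq h]; exact mem_connectedComponentIn ha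

/-- Eilenberg: a logarithm of `(z-a)/(z-b)` forces the same component -/
theorem lk_same_comp {X : Set ℂ} (hX : IsCompact X) {a b : ℂ} (ha : a ∉ X) (hb : b ∉ X)
    (h : LkHasLog (fun z => (z - a) * (z - b)⁻¹) X) : b ∈ connectedComponentIn Xᶜ a := by
  by_contra hab
  have hba : a ∉ connectedComponentIn Xᶜ b := fun hh => hab (lk_comp_symm hb hh)
  rcases lk_one_bounded hX hab with hB | hB
  · exact lk_sep_core hX (n := 1) (k := -1) (l := 0) ha hb hb hab hab hB one_ne_zero
      (h.congr fun z _ => by simp)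
  · exact lk_sep_core hX (n := -1) (k := 1) (l := 0) hb ha ha hba hba hB (by norm_num)
      (h.congr fun z _ => by simp [mul_comm])

theorem lk_sep3 {X : Set ℂ} (hX : IsCompact X) {a b c : ℂ} (ha : a ∉ X) (hb : b ∉ X)
    (hc : c ∉ X) (hab : b ∉ connectedComponentIn Xᶜ a) (hac : c ∉ connectedComponentIn Xᶜ a)
    (hbc : c ∉ connectedComponentIn Xᶜ b) {n k l : ℤ} (hs : n + k + l = 0)
    (h0 : ¬ (k = 0 ∧ l = 0))
    (h : LkHasLog (fun z => (z - a) ^ n * ((z - b) ^ k * (z - c) ^ l)) X) : False := by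
  have hba : a ∉ connectedComponentIn Xᶜ b := fun hh => hab (lk_comp_symm hb hh)
  have hca : a ∉ connectedComponentIn Xᶜ c := fun hh => hac (lk_comp_symm hc hh)
  have hcb : b ∉ connectedComponentIn Xᶜ c := fun hh => hbc (lk_comp_symm hc hh)
  have A : ∀ hB : Bornology.IsBounded (connectedComponentIn Xᶜ a), n ≠ 0 → False :=
    fun hB hn => lk_sep_core hX ha hb hc hab hac hB hn h
  have B : ∀ hB : Bornology.IsBounded (connectedComponentIn Xᶜ b), k ≠ 0 → False :=
    fun hB hn => lk_sep_core hX (k := n) (l := l) hb ha hc hba hbc hB hn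
      (h.congr fun z _ => by ring)
  have C : ∀ hB : Bornology.IsBounded (connectedComponentIn Xᶜ c), l ≠ 0 → False :=
    fun hB hn => lk_sep_core hX (k := n) (l := k) hc ha hb hca hcb hB hn
      (h.congr fun z _ => by ring)
  have h1 := lk_one_bounded hX hab
  have h2 := lk_one_bounded hX hac
  have h3 := lk_one_bounded hX hbc
  have A' : n ≠ 0 → ¬ Bornology.IsBounded (connectedComponentIn Xᶜ a) := fun hn hB => A hB hn
  have B' : k ≠ 0 → ¬ Bornology.IsBounded (connectedComponentIn Xᶜ b) := fun hn hB => B hB hn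
  have C' : l ≠ 0 → ¬ Bornology.IsBounded (connectedComponentIn Xᶜ c) := fun hn hB => C hB hn
  by_cases hn : n = 0
  · have hk : k ≠ 0 := by omega
    have hl : l ≠ 0 := by omega
    exact h3.elim (B' hk) (C' hl)
  · by_cases hk : k = 0
    · have hl : l ≠ 0 := by omega
      exact h2.elim (A' hn) (C' hl)
    · have hBk := B' hk
      exact h1.elim (A' hn) hBk

/-- logarithm of `(z-a)/(z-b)` for close points -/
theorem lk_close_ball {a b z : ℂ} (h : ‖a - b‖ < ‖z - a‖) :
    (z - b) / (z - a) ∈ Complex.slitPlane := by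
  apply Complex.mem_slitPlane_of_norm_lt_one (z := (a - b) / (z - a)) |> fun h' => ?_
  · have hz : z - a ≠ 0 := fun h0 => by
      rw [h0, norm_zero] at h; exact absurd h (not_lt.2 (norm_nonneg _))
    have e : (z - b) / (z - a) = 1 + (a - b) / (z - a) := by field_simp; ring
    rw [e]; apply h'
    rw [norm_div, div_lt_one (norm_pos_iff.2 hz)]; exact h

theorem lk_infdist {X : Set ℂ} (hX : IsClosed X) {a : ℂ} (ha : a ∉ X) :
    ∃ ε > 0, ∀ b, ‖a - b‖ < ε → ∀ z ∈ X, ‖a - b‖ < ‖z - a‖ := by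
  obtain ⟨ε, hε, h⟩ := Metric.isOpen_iff.1 hX.isOpen_compl a ha
  refine ⟨ε, hε, fun b hb z hz => hb.trans_le ?_⟩
  by_contra hlt
  exact h (by rw [Metric.mem_ball, dist_eq_norm]; exact not_le.1 hlt) hz

theorem lk_log_close {X : Set ℂ} (hX : IsClosed X) {a : ℂ} (ha : a ∉ X) :
    ∃ U ∈ nhds a, ∀ b ∈ U, LkHasLog (fun z => (z - b) * (z - a)⁻¹) X ∧
      LkHasLog (fun z => (z - a) * (z - b)⁻¹) X := by
  obtain ⟨ε, hε, h⟩ := lk_infdist hX ha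
  refine ⟨Metric.ball a ε, Metric.ball_mem_nhds _ hε, fun b hb => ?_⟩
  rw [Metric.mem_ball, dist_comm, dist_eq_norm] at hb
  have hs : ∀ z ∈ X, (z - b) / (z - a) ∈ Complex.slitPlane := fun z hz =>
    lk_close_ball (h b hb z hz)
  have hza : ∀ z ∈ X, z - a ≠ 0 := fun z hz h0 => ha (by rwa [← sub_eq_zero.1 h0])
  have hc : ContinuousOn (fun z => Complex.log ((z - b) / (z - a))) X :=
    ContinuousOn.clog (ContinuousOn.div (by fun_prop) (by fun_prop) hza) hs
  constructor
  · exact ⟨_, hc, fun z hz => by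
      rw [Complex.exp_log (Complex.slitPlane_ne_zero (hs z hz)), div_eq_mul_inv]⟩
  · exact ⟨fun z => -Complex.log ((z - b) / (z - a)), hc.neg, fun z hz => by
      rw [Complex.exp_neg, Complex.exp_log (Complex.slitPlane_ne_zero (hs z hz))]
      rw [inv_div, div_eq_mul_inv]⟩

/-- easy direction of Eilenberg's criterion -/
theorem lk_log_of_conn {X S : Set ℂ} (hX : IsClosed X) (hS : IsPreconnected S) (hSX : S ⊆ Xᶜ)
    {a b : ℂ} (ha : a ∈ S) (hb : b ∈ S) : LkHasLog (fun z => (z - a) * (z - b)⁻¹) X := by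
  have := lk_locconst hS (fun b => LkHasLog (fun z => (z - a) * (z - b)⁻¹) X) ?_ ha hb
  · rw [← this]
    refine ⟨fun _ => 0, continuousOn_const, fun z hz => ?_⟩
    have hza : z - a ≠ 0 := fun h0 => hSX ha (by rwa [← sub_eq_zero.1 h0])
    simp [hza]
  · intro x hx
    obtain ⟨U, hU, h⟩ := lk_log_close hX (hSX hx)
    refine ⟨U, hU, fun y hy => propext ⟨fun hl => ?_, fun hl => ?_⟩⟩
    · refine (hl.mul (h y hy.1).1).congr fun z hz => ?_
      have hzy : z - y ≠ 0 := fun h0 => hSX hy.2 (by rwa [← sub_eq_zero.1 h0])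
      field_simp
    · refine (hl.mul (h y hy.1).2).congr fun z hz => ?_
      have hzy : z - x ≠ 0 := fun h0 => hSX hx (by rwa [← sub_eq_zero.1 h0])
      field_simp

/-- logarithms on arcs -/
theorem lk_log_arc {γ : ℝ → ℂ} {u v : ℝ} (hγ : ContinuousOn γ (Icc u v)) (hi : InjOn γ (Icc u v))
    {f : ℂ → ℂ}
    (hf : ContinuousOn f (γ '' Icc u v)) (h0 : ∀ z ∈ γ '' Icc u v, f z ≠ 0) :
    LkHasLog f (γ '' Icc u v) := by
  classical
  rcases lt_or_ge v u with huv | huv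
  · rw [Icc_eq_empty (not_le.2 huv), image_empty]
    exact ⟨0, continuousOn_empty _, by simp⟩
  let pr : ℝ → Icc u v := projIcc u v huv
  obtain ⟨g, hg, hge⟩ := lk_exists_log (fun t : ℝ => f (γ (pr t))) (by
      have h1 : Continuous (fun t : ℝ => γ (pr t)) :=
        hγ.comp_continuous (by fun_prop) (fun t => (pr t).2)
      exact hf.comp_continuous h1 (fun t => mem_image_of_mem _ (pr t).2))
      (fun t => h0 _ (mem_image_of_mem _ (pr t).2))
  let e : Icc u v → ℂ := (Icc u v).domRestrict γ
  have hec : Continuous e := hγ.domRestrict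
  have hei : Function.Injective e := injOn_iff_injective.1 hi
  have hemb := (hec.isClosedEmbedding hei).isEmbedding
  let H := hemb.toHomeomorph
  let G : ℂ → ℂ := fun z => if hz : z ∈ range e then g (H.symm ⟨z, hz⟩) else 0
  have hr : range e = γ '' Icc u v := by simp [e, range_domRestrict]
  refine ⟨G, ?_, ?_⟩
  · rw [← hr, continuousOn_iff_continuous_domRestrict]
    have : (range e).domRestrict G = fun z => g (H.symm z) := by
      ext z
      simp only [domRestrict_apply, G]
      rw [dif_pos z.2]
    rw [this]
    fun_prop
  · rintro z ⟨t, ht, rfl⟩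
    have hz : γ t ∈ range e := ⟨⟨t, ht⟩, rfl⟩
    have hH : H.symm ⟨γ t, hz⟩ = ⟨t, ht⟩ := by
      rw [Homeomorph.symm_apply_eq]; rfl
    simp only [G, dif_pos hz, hH, hge, pr, projIcc_of_mem huv ht]

/-- gluing two logarithms -/
theorem lk_glue {X Y : Set ℂ} (hX : IsClosed X) (hY : IsClosed Y) {f : ℂ → ℂ} {g h : ℂ → ℂ}
    (hg : ContinuousOn g X) (hge : ∀ x ∈ X, Complex.exp (g x) = f x)
    (hh : ContinuousOn h Y) (hhe : ∀ x ∈ Y, Complex.exp (h x) = f x) (c : ℂ)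
    (hc : Complex.exp c = 1)
    (hXY : ∀ x ∈ X ∩ Y, g x = h x + c) : LkHasLog f (X ∪ Y) := by
  classical
  let G : ℂ → ℂ := fun z => if z ∈ X then g z else h z + c
  have e1 : EqOn G g X := fun z hz => by simp [G, hz]
  have e2 : EqOn G (fun z => h z + c) Y := fun z hz => by
    by_cases hzX : z ∈ X
    · simp [G, hzX, hXY z ⟨hzX, hz⟩]
    · simp [G, hzX]
  refine ⟨G, ?_, ?_⟩
  · exact (hg.congr e1).union_of_isClosed ((hh.add continuousOn_const).congr e2) hX hY
  · rintro z (hz | hz)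
    · rw [e1 hz, hge z hz]
    · rw [e2 hz, Complex.exp_add, hhe z hz, hc, mul_one]

theorem lk_glue_point {X Y : Set ℂ} (hX : IsClosed X) (hY : IsClosed Y) {f : ℂ → ℂ}
    (h1 : LkHasLog f X) (h2 : LkHasLog f Y) (p : ℂ) (hXY : X ∩ Y ⊆ {p}) : LkHasLog f (X ∪ Y) := by
  obtain ⟨g, hg, hge⟩ := h1
  obtain ⟨h, hh, hhe⟩ := h2
  by_cases hp : p ∈ X ∩ Y
  · refine lk_glue hX hY hg hge hh hhe (g p - h p) ?_ ?_
    · rw [Complex.exp_sub, hge p hp.1, ← hhe p hp.2, div_self (Complex.exp_ne_zero _)]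
    · intro x hx
      rw [hXY hx]; ring
  · refine lk_glue hX hY hg hge hh hhe 0 (by simp) ?_
    intro x hx
    exact absurd (hXY hx ▸ hx) hp


/-! ### Increments of logarithms and winding numbers -/

open Classical in
/-- the increment of a continuous logarithm of `g - a` along `[0,1]` -/
def lkInc (g : ℝ → ℂ) (a : ℂ) : ℂ :=
  if h : ∃ L : ℝ → ℂ, ContinuousOn L (Icc 0 1) ∧ ∀ t ∈ Icc (0:ℝ) 1, Complex.exp (L t) = g t - a
  then h.choose 1 - h.choose 0 else 0

theorem lk_inc_eq {g : ℝ → ℂ} {a : ℂ} (L : ℝ → ℂ) (hL : ContinuousOn L (Icc 0 1))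
    (h : ∀ t ∈ Icc (0:ℝ) 1, Complex.exp (L t) = g t - a) : lkInc g a = L 1 - L 0 := by
  have hex : ∃ L : ℝ → ℂ, ContinuousOn L (Icc 0 1) ∧
    ∀ t ∈ Icc (0:ℝ) 1, Complex.exp (L t) = g t - a := ⟨L, hL, h⟩
  rw [lkInc, dif_pos hex]
  obtain ⟨h1, h2⟩ := hex.choose_spec
  have := lk_exp_const (isPreconnected_Icc (a := (0:ℝ)) (b := 1))
    (fun t => hex.choose t - L t) (h1.sub hL) (fun t ht => by
      rw [Complex.exp_sub, h2 t ht, ← h t ht, div_self (Complex.exp_ne_zero _)])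
      (left_mem_Icc.2 zero_le_one) (right_mem_Icc.2 zero_le_one)
  linear_combination -this

theorem lk_inc_shift {g : ℝ → ℂ} (hg : Continuous g) {a b : ℂ} (ha : ∀ t ∈ Icc (0:ℝ) 1, g t ≠ a)
    (h : ∀ t ∈ Icc (0:ℝ) 1, (g t - b) / (g t - a) ∈ Complex.slitPlane) :
    lkInc g b = lkInc g a + (Complex.log ((g 1 - b) / (g 1 - a)) -
      Complex.log ((g 0 - b) / (g 0 - a))) := by
  obtain ⟨L, hL, hLe⟩ := lk_exists_log_Icc (fun t => g t - a) (by fun_prop)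
    (fun t ht => sub_ne_zero.2 (ha t ht))
  rw [lk_inc_eq L hL.continuousOn hLe,
    lk_inc_eq (fun t => L t + Complex.log ((g t - b) / (g t - a))) ?_ ?_]
  · ring
  · exact hL.continuousOn.add (ContinuousOn.clog (ContinuousOn.div (by fun_prop) (by fun_prop)
      (fun t ht => sub_ne_zero.2 (ha t ht))) h)
  · intro t ht
    have := sub_ne_zero.2 (ha t ht)
    rw [Complex.exp_add, hLe t ht, Complex.exp_log (Complex.slitPlane_ne_zero (h t ht))]
    field_simp

theorem lk_inc_far {g : ℝ → ℂ} (hg : Continuous g) {w : ℂ}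
    (h : ∀ t ∈ Icc (0:ℝ) 1, ‖g t‖ < ‖w‖) :
    lkInc g w = Complex.log (1 - g 1 / w) - Complex.log (1 - g 0 / w) := by
  have hw : w ≠ 0 := by
    rintro rfl
    have := h 0 (by simp)
    rw [norm_zero] at this
    exact absurd this (not_lt.2 (norm_nonneg _))
  have hs : ∀ t ∈ Icc (0:ℝ) 1, 1 - g t / w ∈ Complex.slitPlane := by
    intro t ht
    rw [sub_eq_add_neg]
    apply Complex.mem_slitPlane_of_norm_lt_one
    rw [norm_neg, norm_div, div_lt_one (norm_pos_iff.2 hw)]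
    exact h t ht
  rw [lk_inc_eq (fun t => Complex.log (1 - g t / w) + Complex.log (-w))]
  · ring
  · exact (ContinuousOn.clog (by fun_prop) hs).add continuousOn_const
  · intro t ht
    rw [Complex.exp_add, Complex.exp_log (Complex.slitPlane_ne_zero (hs t ht)),
      Complex.exp_log (neg_ne_zero.2 hw)]
    field_simp
    ring

/-- eventually slit plane -/
theorem lk_ev_slit {X : Set ℂ} (hX : IsClosed X) {a : ℂ} (ha : a ∉ X) :
    ∀ᶠ b in nhds a, ∀ z ∈ X, (z - b) / (z - a) ∈ Complex.slitPlane := by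
  obtain ⟨ε, hε, h⟩ := lk_infdist hX ha
  filter_upwards [Metric.ball_mem_nhds a hε] with b hb z hz
  rw [Metric.mem_ball, dist_comm, dist_eq_norm] at hb
  exact lk_close_ball (h b hb z hz)

/-- sums of increments with boundary condition -/
theorem lk_wind_shift {E : Type*} (s : Finset E) (γ : E → ℝ → ℂ) (hγ : ∀ e, Continuous (γ e))
    (c : E → ℂ) {a : ℂ} (ha : ∀ e ∈ s, ∀ t ∈ Icc (0:ℝ) 1, γ e t ≠ a) :
    ∀ᶠ b in nhds a, ∑ e ∈ s, c e * lkInc (γ e) b = ∑ e ∈ s, c e * lkInc (γ e) a +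
      ∑ e ∈ s, c e * (Complex.log ((γ e 1 - b) / (γ e 1 - a)) -
        Complex.log ((γ e 0 - b) / (γ e 0 - a))) := by
  have h1 : ∀ e ∈ s, ∀ᶠ b in nhds a, ∀ z ∈ γ e '' Icc 0 1, (z - b) / (z - a) ∈ Complex.slitPlane :=
    fun e he => lk_ev_slit (isCompact_Icc.image (hγ e)).isClosed (by
      rintro ⟨t, ht, h⟩; exact ha e he t ht h)
  rw [← Finset.eventually_all] at h1
  filter_upwards [h1] with b hb
  rw [← Finset.sum_add_distrib]
  refine Finset.sum_congr rfl fun e he => ?_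
  rw [lk_inc_shift (hγ e) (ha e he) (fun t ht => hb e he _ (mem_image_of_mem _ ht))]
  ring

theorem lk_wind_const {E : Type*} (s : Finset E) (γ : E → ℝ → ℂ) (hγ : ∀ e, Continuous (γ e))
    (c : E → ℂ) (hc : ∀ l : ℂ → ℂ, ∑ e ∈ s, c e * (l (γ e 1) - l (γ e 0)) = 0)
    {a : ℂ} (ha : ∀ e ∈ s, ∀ t ∈ Icc (0:ℝ) 1, γ e t ≠ a) :
    ∀ᶠ b in nhds a, ∑ e ∈ s, c e * lkInc (γ e) b = ∑ e ∈ s, c e * lkInc (γ e) a := by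
  filter_upwards [lk_wind_shift s γ hγ c ha] with b hb
  rw [hb, hc (fun z => Complex.log ((z - b) / (z - a))), add_zero]

/-- comparing with a continuous logarithm of a ratio along a curve -/
theorem lk_D_shift {D w : ℝ → ℂ} (hD : Continuous D) (hw : Continuous w) {p q : ℂ}
    (hp : ∀ s, w s ≠ p) (hq : ∀ s, w s ≠ q)
    (h : ∀ s, Complex.exp (D s) = (q - w s) / (p - w s)) (s : ℝ) :
    ∀ᶠ r in nhds s, D r = D s + (Complex.log ((q - w r) / (q - w s)) -
      Complex.log ((p - w r) / (p - w s))) := by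
  have h1 : ∀ᶠ b in nhds (w s), ∀ z ∈ ({p, q} : Set ℂ), (z - b) / (z - w s) ∈ Complex.slitPlane :=
    lk_ev_slit (by simp) (by simp [hp, hq])
  have h2 := hw.continuousAt.eventually h1
  obtain ⟨ε, hε, h3⟩ := Metric.eventually_nhds_iff_ball.1 h2
  have hp' : ∀ r, p - w r ≠ 0 := fun r => sub_ne_zero.2 (hp r).symm
  have hq' : ∀ r, q - w r ≠ 0 := fun r => sub_ne_zero.2 (hq r).symm
  filter_upwards [Metric.ball_mem_nhds s hε] with r hr
  have := lk_exp_const (convex_ball s ε).isPreconnected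
    (fun r => D r - (D s + (Complex.log ((q - w r) / (q - w s)) -
      Complex.log ((p - w r) / (p - w s))))) ?_ ?_ hr (Metric.mem_ball_self hε)
  · simp only [div_self (hp' s), div_self (hq' s), Complex.log_one] at this
    linear_combination this
  · refine hD.continuousOn.sub (continuousOn_const.add (ContinuousOn.sub ?_ ?_))
    · exact ContinuousOn.clog (by fun_prop) (fun r hr => h3 r hr q (by simp))
    · exact ContinuousOn.clog (by fun_prop) (fun r hr => h3 r hr p (by simp))
  · intro r hr
    rw [Complex.exp_sub, Complex.exp_add, Complex.exp_sub, h, h,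
      Complex.exp_log (div_ne_zero (hq' _) (hq' _)), Complex.exp_log (div_ne_zero (hp' _) (hp' _))]
    have := hp' r; have := hp' s; have := hq' r; have := hq' s
    field_simp

theorem lk_D_exists {p q : ℂ} (hpq : p ≠ q) : ∃ D w : ℝ → ℂ, Continuous D ∧ Continuous w ∧
    (∀ s, w s ≠ p) ∧ (∀ s, w s ≠ q) ∧ (∀ s, Complex.exp (D s) = (q - w s) / (p - w s)) ∧
    Filter.Tendsto D Filter.atTop (nhds 0) ∧
    Filter.Tendsto D Filter.atBot (nhds (2 * Real.pi * Complex.I)) ∧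
    Filter.Tendsto (fun s => ‖w s‖) Filter.atTop Filter.atTop ∧
    Filter.Tendsto (fun s => ‖w s‖) Filter.atBot Filter.atTop := by
  let w : ℝ → ℂ := fun s => (p + q) / 2 + (s / 2 : ℝ) * (Complex.I * (q - p))
  have hd : q - p ≠ 0 := sub_ne_zero.2 hpq.symm
  have e1 : ∀ s, q - w s = (q - p) / 2 * (1 - s * Complex.I) := fun s => by
    simp only [w]; push_cast; ring
  have e2 : ∀ s, p - w s = -((q - p) / 2 * (1 + s * Complex.I)) := fun s => by
    simp only [w]; push_cast; ring
  have n1 : ∀ s : ℝ, (1 - s * Complex.I) ≠ 0 := fun s h => by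
    have := congrArg Complex.re h; simp at this
  have n2 : ∀ s : ℝ, (1 + s * Complex.I) ≠ 0 := fun s h => by
    have := congrArg Complex.re h; simp at this
  have hd2 : (q - p) / 2 ≠ 0 := div_ne_zero hd two_ne_zero
  have hn : ∀ s, |s| * (‖q - p‖ / 2) - ‖(p + q) / 2‖ ≤ ‖w s‖ := fun s => by
    have : ‖((s / 2 : ℝ) : ℂ) * (Complex.I * (q - p))‖ ≤ ‖w s‖ + ‖(p + q) / 2‖ := by
      have := norm_sub_le (w s) ((p + q) / 2)
      simpa only [w, add_sub_cancel_left] using this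
    rw [norm_mul, norm_mul, Complex.norm_I, Complex.norm_real, Real.norm_eq_abs, abs_div,
      abs_two, one_mul] at this
    linarith
  refine ⟨fun s => (Real.pi - 2 * Real.arctan s : ℝ) * Complex.I, w, by fun_prop, by fun_prop,
    fun s h => ?_, fun s h => ?_, fun s => ?_, ?_, ?_, ?_, ?_⟩
  · have := e2 s
    rw [h, sub_self] at this
    exact neg_ne_zero.2 (mul_ne_zero hd2 (n2 s)) this.symm
  · have := e1 s
    rw [h, sub_self] at this
    exact (mul_ne_zero hd2 (n1 s)) this.symm
  · rw [e1, e2]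
    have hc := (Real.cos_arctan_pos s).ne'
    have hs : Real.sin (Real.arctan s) = s * Real.cos (Real.arctan s) := by
      have := Real.tan_arctan s
      rw [Real.tan_eq_sin_div_cos] at this
      field_simp at this
      linarith
    set θ := Real.arctan s
    have hc' : (Real.cos θ : ℂ) ≠ 0 := by exact_mod_cast hc
    have E1 : Complex.exp (θ * Complex.I) = Real.cos θ * (1 + s * Complex.I) := by
      rw [Complex.exp_mul_I, ← Complex.ofReal_cos, ← Complex.ofReal_sin, hs]; push_cast; ring
    have E2 : Complex.exp (-θ * Complex.I) = Real.cos θ * (1 - s * Complex.I) := by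
      rw [Complex.exp_mul_I, Complex.cos_neg, Complex.sin_neg, ← Complex.ofReal_cos,
        ← Complex.ofReal_sin, hs]; push_cast; ring
    have : ((Real.pi - 2 * θ : ℝ) : ℂ) * Complex.I = Real.pi * Complex.I + -θ * Complex.I
      - θ * Complex.I := by push_cast; ring
    show Complex.exp (((Real.pi - 2 * θ : ℝ) : ℂ) * Complex.I) = _
    rw [this, Complex.exp_sub, Complex.exp_add, Complex.exp_pi_mul_I, E1, E2]
    have := n1 s; have := n2 s
    field_simp
  · have h1 := (Real.tendsto_arctan_atTop.mono_right nhdsWithin_le_nhds)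
    have h2 : Filter.Tendsto (fun s => (Real.pi - 2 * Real.arctan s : ℝ)) Filter.atTop
      (nhds (Real.pi - 2 * (Real.pi / 2))) := (h1.const_mul 2).const_sub _
    have h3 := ((Complex.continuous_ofReal.tendsto _).comp h2).mul_const Complex.I
    have e : ((Real.pi - 2 * (Real.pi / 2) : ℝ) : ℂ) * Complex.I = 0 := by push_cast; ring
    rw [e] at h3
    exact h3
  · have h1 := (Real.tendsto_arctan_atBot.mono_right nhdsWithin_le_nhds)
    have h2 : Filter.Tendsto (fun s => (Real.pi - 2 * Real.arctan s : ℝ)) Filter.atBot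
      (nhds (Real.pi - 2 * (-(Real.pi / 2)))) := (h1.const_mul 2).const_sub _
    have h3 := ((Complex.continuous_ofReal.tendsto _).comp h2).mul_const Complex.I
    have e : ((Real.pi - 2 * (-(Real.pi / 2)) : ℝ) : ℂ) * Complex.I = 2 * Real.pi * Complex.I := by
      push_cast; ring
    rw [e] at h3
    exact h3
  · refine Filter.tendsto_atTop_mono hn ?_
    apply Filter.tendsto_atTop_add_const_right
    exact Filter.tendsto_abs_atTop_atTop.atTop_mul_const (by positivity)
  · refine Filter.tendsto_atTop_mono hn ?_
    apply Filter.tendsto_atTop_add_const_right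
    exact Filter.tendsto_abs_atBot_atTop.atTop_mul_const (by positivity)

theorem lk_inc_tendsto {g : ℝ → ℂ} (hg : Continuous g) {w : ℝ → ℂ} {l : Filter ℝ}
    (hw : Filter.Tendsto (fun s => ‖w s‖) l Filter.atTop) :
    (∀ᶠ s in l, ∀ t ∈ Icc (0:ℝ) 1, g t ≠ w s) ∧
    Filter.Tendsto (fun s => lkInc g (w s)) l (nhds 0) := by
  obtain ⟨M, hM⟩ := (isCompact_Icc.image_of_continuousOn (f := fun t => ‖g t‖) (s := Icc (0:ℝ) 1)
    (by fun_prop)).bddAbove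
  have hM' : ∀ t ∈ Icc (0:ℝ) 1, ‖g t‖ ≤ M := fun t ht => hM (mem_image_of_mem _ ht)
  have hev := hw.eventually (Filter.eventually_gt_atTop M)
  have hz : ∀ z : ℂ, Filter.Tendsto (fun s => Complex.log (1 - z / w s)) l (nhds 0) := by
    intro z
    have h1 : Filter.Tendsto (fun s => z / w s) l (nhds 0) := by
      rw [tendsto_zero_iff_norm_tendsto_zero]
      simp only [norm_div]
      exact hw.const_div_atTop _
    have h2 : Filter.Tendsto (fun s => 1 - z / w s) l (nhds (1 - 0)) := h1.const_sub 1
    rw [sub_zero] at h2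
    have := (Complex.one_mem_slitPlane |> continuousAt_clog).tendsto.comp h2
    rwa [Complex.log_one] at this
  constructor
  · filter_upwards [hev] with s hs t ht he
    have := hM' t ht
    rw [he] at this
    linarith
  · have : (fun s => Complex.log (1 - g 1 / w s) - Complex.log (1 - g 0 / w s)) =ᶠ[l]
        (fun s => lkInc g (w s)) := by
      filter_upwards [hev] with s hs
      rw [lk_inc_far hg (fun t ht => (hM' t ht).trans_lt hs)]
    refine Filter.Tendsto.congr' this ?_
    simpa using (hz (g 1)).sub (hz (g 0))

/-- An embedded system of arcs with end points in the finite set `V`. -/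
structure LkSys {Z : Type*} [TopologicalSpace Z] (V : Finset Z) {E : Type*}
    (γ : E → ℝ → Z) : Prop where
  cont : ∀ e, Continuous (γ e)
  h0 : ∀ e, γ e 0 ∈ V
  h1 : ∀ e, γ e 1 ∈ V
  off : ∀ e, ∀ t ∈ Ioo (0:ℝ) 1, γ e t ∉ V
  inj : ∀ e e', ∀ t ∈ Ioo (0:ℝ) 1, ∀ t' ∈ Ioo (0:ℝ) 1, γ e t = γ e' t' → e = e' ∧ t = t'

theorem lk_Icc_cases {t : ℝ} (h : t ∈ Icc (0:ℝ) 1) : t = 0 ∨ t = 1 ∨ t ∈ Ioo (0:ℝ) 1 := by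
  rcases eq_or_lt_of_le h.1 with h0 | h0
  · exact Or.inl h0.symm
  · rcases eq_or_lt_of_le h.2 with h1 | h1
    · exact Or.inr (Or.inl h1)
    · exact Or.inr (Or.inr ⟨h0, h1⟩)

/-- vanishing winding numbers force the zero cycle -/
theorem lk_wind_zero {V : Finset ℂ} {E : Type*} [Fintype E] [DecidableEq E] {γ : E → ℝ → ℂ}
    (S : LkSys V γ) (hloop : ∀ e, γ e 0 ≠ γ e 1) (c : E → ℂ)
    (hc : ∀ l : ℂ → ℂ, ∑ e, c e * (l (γ e 1) - l (γ e 0)) = 0)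
    (hw0 : ∀ a, (∀ e, ∀ t ∈ Icc (0:ℝ) 1, γ e t ≠ a) → ∑ e, c e * lkInc (γ e) a = 0) (e : E) :
    c e = 0 := by
  classical
  obtain ⟨D, w, hD, hw, hp, hq, hexp, hD1, hD2, hw1, hw2⟩ := lk_D_exists (hloop e)
  let on : ℝ → Prop := fun s => ∃ t ∈ Icc (0:ℝ) 1, γ e t = w s
  let A : ℝ → ℂ := fun s => c e * (lkInc (γ e) (w s) - D s)
  let B : ℝ → ℂ := fun s => -(∑ e' ∈ Finset.univ.erase e, c e' * lkInc (γ e') (w s)) - c e * D s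
  let C : ℝ → ℂ := fun s => if on s then B s else A s
  have hcl : IsClosed (γ e '' Icc 0 1) := (isCompact_Icc.image (S.cont e)).isClosed
  have hcl2 : IsClosed (⋃ i ∈ Finset.univ.erase e, γ i '' Icc 0 1) :=
    isClosed_biUnion_finset fun e' _ => (isCompact_Icc.image (S.cont e')).isClosed
  have hDs := lk_D_shift hD hw hp hq hexp
  have hA : ∀ s, ¬ on s → ∀ᶠ r in nhds s, ¬ on r ∧ A r = A s := by
    intro s hs
    have h1 : w s ∉ γ e '' Icc 0 1 := hs
    have h2 : ∀ᶠ r in nhds s, w r ∉ γ e '' Icc 0 1 :=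
      hw.continuousAt.eventually (hcl.isOpen_compl.mem_nhds h1)
    have h3 := hw.continuousAt.eventually (lk_wind_shift {e} γ S.cont c (a := w s) (by
      intro e' he t ht h
      rw [Finset.mem_singleton.1 he] at h
      exact h1 ⟨t, ht, h⟩))
    filter_upwards [h2, h3, hDs s] with r h2 h3 h4
    refine ⟨h2, ?_⟩
    simp only [Finset.sum_singleton] at h3
    simp only [A]
    rw [mul_sub, h3, h4]
    ring
  have hB : ∀ s, on s → ∀ᶠ r in nhds s, (∀ e' ≠ e, ∀ t ∈ Icc (0:ℝ) 1, γ e' t ≠ w r) ∧ B r = B s := by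
    intro s hs
    have h1 : ∀ e' ≠ e, ∀ t ∈ Icc (0:ℝ) 1, γ e' t ≠ w s := by
      intro e' he' t' ht' h
      obtain ⟨t, ht, h'⟩ := hs
      rcases lk_Icc_cases ht with rfl | rfl | ht
      · exact hp s h'.symm
      · exact hq s h'.symm
      · have hV : w s ∉ V := by rw [← h']; exact S.off e t ht
        rcases lk_Icc_cases ht' with rfl | rfl | ht'
        · exact hV (h ▸ S.h0 e')
        · exact hV (h ▸ S.h1 e')
        · exact he' (S.inj e' e t' ht' t ht (h.trans h'.symm)).1
    have h1' : w s ∉ ⋃ i ∈ Finset.univ.erase e, γ i '' Icc 0 1 := by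
      simp only [Finset.mem_erase, Finset.mem_univ, and_true, mem_iUnion, mem_image, not_exists,
        not_and]
      exact fun e' he' t ht => h1 e' he' t ht
    have h2 : ∀ᶠ r in nhds s, w r ∉ ⋃ i ∈ Finset.univ.erase e, γ i '' Icc 0 1 :=
      hw.continuousAt.eventually (hcl2.isOpen_compl.mem_nhds h1')
    have h3 := hw.continuousAt.eventually (lk_wind_shift (Finset.univ.erase e) γ S.cont c
      (a := w s) (fun e' he' t ht => h1 e' (Finset.ne_of_mem_erase he') t ht))
    filter_upwards [h2, h3, hDs s] with r h2 h3 h4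
    constructor
    · simp only [Finset.mem_erase, Finset.mem_univ, and_true, mem_iUnion, mem_image, not_exists,
        not_and] at h2
      exact fun e' he' t ht => h2 e' he' t ht
    · simp only [B]
      rw [h3, h4]
      have h5 := hc (fun z => Complex.log ((z - w r) / (z - w s)))
      rw [← Finset.add_sum_erase _ _ (Finset.mem_univ e)] at h5
      linear_combination -h5
  have hAB : ∀ s, ¬ on s → (∀ e' ≠ e, ∀ t ∈ Icc (0:ℝ) 1, γ e' t ≠ w s) → A s = B s := by
    intro s hs h
    have := hw0 (w s) (fun e' t ht => by
      by_cases he : e' = e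
      · subst he; exact fun h => hs ⟨t, ht, h⟩
      · exact h e' he t ht)
    rw [← Finset.add_sum_erase _ _ (Finset.mem_univ e)] at this
    simp only [A, B]
    linear_combination this
  have hC : ∀ s, ∀ᶠ r in nhds s, C r = C s := by
    intro s
    by_cases hs : on s
    · filter_upwards [hB s hs] with r hr
      simp only [C, hs, if_true]
      by_cases hr' : on r
      · simp only [hr', if_true, hr.2]
      · simp only [hr', if_false, hAB r hr' hr.1, hr.2]
    · filter_upwards [hA s hs] with r hr
      simp only [C, hs, hr.1, if_false, hr.2]
  have hconst : ∀ s r, C s = C r := fun s r =>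
    lk_locconst isPreconnected_univ C (fun x _ => by
      obtain ⟨U, hU, h⟩ := (hC x).exists_mem
      exact ⟨U, hU, fun y hy => h y hy.1⟩) (mem_univ s) (mem_univ r)
  have lim1 : Filter.Tendsto C Filter.atTop (nhds (c e * (0 - 0))) := by
    obtain ⟨h1, h2⟩ := lk_inc_tendsto (S.cont e) hw1
    refine Filter.Tendsto.congr' ?_ ((h2.sub hD1).const_mul (c e))
    filter_upwards [h1] with s hs
    have : ¬ on s := by
      rintro ⟨t, ht, h⟩
      exact hs t ht h
    simp [C, this, A]
  have lim2 : Filter.Tendsto C Filter.atBot (nhds (c e * (0 - 2 * Real.pi * Complex.I))) := by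
    obtain ⟨h1, h2⟩ := lk_inc_tendsto (S.cont e) hw2
    refine Filter.Tendsto.congr' ?_ ((h2.sub hD2).const_mul (c e))
    filter_upwards [h1] with s hs
    have : ¬ on s := by
      rintro ⟨t, ht, h⟩
      exact hs t ht h
    simp [C, this, A]
  have hCc : C = fun _ => C 0 := funext fun s => hconst s 0
  rw [hCc] at lim1 lim2
  have l1 := tendsto_nhds_unique lim1 tendsto_const_nhds
  have l2 := tendsto_nhds_unique lim2 tendsto_const_nhds
  have : c e * (2 * Real.pi * Complex.I) = 0 := by linear_combination l1 - l2
  simpa [Complex.I_ne_zero, Real.pi_ne_zero] using this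


/-- combinatorial lemma: minimum degree two without short cycles forces four edges -/
theorem lk_four {E Z : Type*} [DecidableEq E] (en : E → Sym2 Z) (S : Finset E) (hne : S.Nonempty)
    (hloop : ∀ e, ¬ (en e).IsDiag) (hpar : Function.Injective en)
    (htri : ∀ e1 e2 e3 x y z, en e1 = s(x, y) → en e2 = s(y, z) → en e3 = s(z, x) → False)
    (hdeg : ∀ e ∈ S, ∀ v ∈ en e, ∃ e' ∈ S, e' ≠ e ∧ v ∈ en e') : 4 ≤ S.card := by
  obtain ⟨e0, h0⟩ := hne
  obtain ⟨u, v, h0e⟩ : ∃ u v, en e0 = s(u, v) := ⟨(en e0).out.1, (en e0).out.2, by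
    rw [Sym2.mk, Prod.mk.eta]; simp⟩
  have huv : u ≠ v := fun h => hloop e0 (by rw [h0e, h]; simp)
  obtain ⟨e1, h1, h10, hv1⟩ := hdeg e0 h0 v (by rw [h0e]; simp)
  obtain ⟨e2, h2, h20, hu2⟩ := hdeg e0 h0 u (by rw [h0e]; simp)
  obtain ⟨w, h1e⟩ := Sym2.mem_iff_exists.1 hv1
  have h12 : e1 ≠ e2 := by
    rintro rfl
    apply h10
    apply hpar
    rw [h0e]
    exact (Sym2.mem_and_mem_iff huv).1 ⟨hu2, hv1⟩
  have hwu : w ≠ u := by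
    rintro rfl
    exact h10 (hpar (by rw [h0e, h1e, Sym2.eq_swap]))
  have hwv : w ≠ v := by
    rintro rfl
    exact hloop e1 (by rw [h1e]; simp)
  obtain ⟨e3, h3, h31, hw3⟩ := hdeg e1 h1 w (by rw [h1e]; simp)
  have h30 : e3 ≠ e0 := by
    rintro rfl
    rw [h0e] at hw3
    simp [hwu, hwv] at hw3
  have h32 : e3 ≠ e2 := by
    rintro rfl
    have := (Sym2.mem_and_mem_iff hwu).1 ⟨hw3, hu2⟩
    exact htri e0 e1 e3 u v w h0e h1e this
  have hsub : ({e0, e1, e2, e3} : Finset E) ⊆ S := by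
    intro x hx
    simp only [Finset.mem_insert, Finset.mem_singleton] at hx
    rcases hx with rfl | rfl | rfl | rfl <;> assumption
  have hcard : ({e0, e1, e2, e3} : Finset E).card = 4 := by
    rw [Finset.card_insert_of_notMem, Finset.card_insert_of_notMem, Finset.card_insert_of_notMem,
      Finset.card_singleton]
    · simp [h32.symm]
    · simp [h12, h31.symm]
    · simp [h10.symm, h20.symm, h30.symm]
  rw [← hcard]
  exact Finset.card_le_card hsub

namespace LkSys

variable {V : Finset ℂ} {E : Type*} {γ : E → ℝ → ℂ}

theorem injOn (S : LkSys V γ) {e : E} (hl : γ e 0 ≠ γ e 1) : InjOn (γ e) (Icc 0 1) := by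
  intro t ht t' ht' h
  rcases lk_Icc_cases ht with rfl | rfl | ht <;> rcases lk_Icc_cases ht' with rfl | rfl | ht'
  · rfl
  · exact absurd h hl
  · exact absurd (h ▸ S.h0 e) (S.off e _ ht')
  · exact absurd h.symm hl
  · rfl
  · exact absurd (h ▸ S.h1 e) (S.off e _ ht')
  · exact absurd (h ▸ S.h0 e) (S.off e _ ht)
  · exact absurd (h ▸ S.h1 e) (S.off e _ ht)
  · exact (S.inj e e t ht t' ht' h).2

/-- union of vertices and some edges -/
def gr (V : Finset ℂ) (γ : E → ℝ → ℂ) (A : Finset E) : Set ℂ := ↑V ∪ ⋃ e ∈ A, γ e '' Icc 0 1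

theorem gr_compact (S : LkSys V γ) (A : Finset E) : IsCompact (gr V γ A) :=
  V.finite_toSet.isCompact.union (A.isCompact_biUnion fun e _ => isCompact_Icc.image (S.cont e))

theorem mem_gr {A : Finset E} {z : ℂ} : z ∈ gr V γ A ↔ z ∈ V ∨ ∃ e ∈ A, ∃ t ∈ Icc (0:ℝ) 1, γ e t = z := by
  simp [gr]

theorem mem_gr' (S : LkSys V γ) {A : Finset E} {z : ℂ} :
    z ∈ gr V γ A ↔ z ∈ V ∨ ∃ e ∈ A, ∃ t ∈ Ioo (0:ℝ) 1, γ e t = z := by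
  rw [mem_gr]
  constructor
  · rintro (h | ⟨e, he, t, ht, rfl⟩)
    · exact Or.inl h
    · rcases lk_Icc_cases ht with rfl | rfl | ht
      · exact Or.inl (S.h0 e)
      · exact Or.inl (S.h1 e)
      · exact Or.inr ⟨e, he, t, ht, rfl⟩
  · rintro (h | ⟨e, he, t, ht, rfl⟩)
    · exact Or.inl h
    · exact Or.inr ⟨e, he, t, Ioo_subset_Icc_self ht, rfl⟩

theorem gr_mono {A B : Finset E} (h : A ⊆ B) : gr V γ A ⊆ gr V γ B := by
  intro z hz
  rw [mem_gr] at hz ⊢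
  exact hz.imp_right fun ⟨e, he, r⟩ => ⟨e, h he, r⟩

theorem log_finite {f : ℂ → ℂ} {X : Set ℂ} (hX : X.Finite) (h0 : ∀ z ∈ X, f z ≠ 0) :
    LkHasLog f X := by
  have : DiscreteTopology X := hX.instDiscreteTopology
  exact ⟨fun z => Complex.log (f z), by
    rw [continuousOn_iff_continuous_domRestrict]; exact continuous_of_discreteTopology,
    fun z hz => Complex.exp_log (h0 z hz)⟩

/-- T3: a set of edges carrying no logarithm has at least four edges -/
theorem four_edges [DecidableEq E] (S : LkSys V γ) (hloop : ∀ e, γ e 0 ≠ γ e 1)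
    (hpar : Function.Injective fun e => s(γ e 0, γ e 1))
    (htri : ∀ e1 e2 e3 x y z, s(γ e1 0, γ e1 1) = s(x, y) → s(γ e2 0, γ e2 1) = s(y, z) →
      s(γ e3 0, γ e3 1) = s(z, x) → False)
    {f : ℂ → ℂ} (A : Finset E) (hf : ContinuousOn f (gr V γ A)) (hf0 : ∀ z ∈ gr V γ A, f z ≠ 0)
    (hA : ¬ LkHasLog f (gr V γ A)) : 4 ≤ A.card := by
  induction A using Finset.strongInduction with
  | H A ih =>
  by_cases hmin : ∃ e ∈ A, ¬ LkHasLog f (gr V γ (A.erase e))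
  · obtain ⟨e, he, hl⟩ := hmin
    have hsub := gr_mono (V := V) (γ := γ) (A.erase_subset e)
    exact (ih _ (A.erase_ssubset he) (hf.mono hsub) (fun z hz => hf0 z (hsub hz)) hl).trans
      (Finset.card_le_card (A.erase_subset e))
  push Not at hmin
  refine lk_four (fun e => s(γ e 0, γ e 1)) A ?_ (fun e => by simpa using hloop e) hpar htri ?_
  · rw [Finset.nonempty_iff_ne_empty]
    rintro rfl
    apply hA
    refine log_finite ?_ hf0
    simp [gr]
  · intro e he q hq
    by_contra hcon
    push Not at hcon
    apply hA
    obtain ⟨p, hp⟩ := Sym2.mem_iff_exists.1 hq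
    have hY : IsClosed ((↑(V.erase q) : Set ℂ) ∪ ⋃ i ∈ A.erase e, γ i '' Icc 0 1) :=
      ((V.erase q).finite_toSet.isCompact.union
        ((A.erase e).isCompact_biUnion fun e _ => isCompact_Icc.image (S.cont e))).isClosed
    have hsub : (↑(V.erase q) : Set ℂ) ∪ ⋃ i ∈ A.erase e, γ i '' Icc 0 1 ⊆
      gr V γ (A.erase e) := union_subset_union_left _ (by simp)
    have hesub : γ e '' Icc 0 1 ⊆ gr V γ A := by
      rintro _ ⟨t, ht, rfl⟩
      exact mem_gr.2 (Or.inr ⟨e, he, t, ht, rfl⟩)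
    have hlog := lk_glue_point hY (isCompact_Icc.image (S.cont e)).isClosed
      ((hmin e he).mono hsub) (lk_log_arc (S.cont e).continuousOn (S.injOn (hloop e))
        (hf.mono hesub) (fun z hz => hf0 z (hesub hz))) p ?_
    · refine hlog.mono ?_
      intro z hz
      have hqe : q ∈ γ e '' Icc 0 1 := by
        rw [Sym2.mem_iff] at hq
        rcases hq with rfl | rfl
        · exact ⟨0, by simp, rfl⟩
        · exact ⟨1, by simp, rfl⟩
      rw [mem_gr] at hz
      by_cases hzq : z = q
      · right; rw [hzq]; exact hqe
      rcases hz with hz | ⟨e', he', t, ht, rfl⟩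
      · left; left; simp [hzq, hz]
      · by_cases hee : e' = e
        · subst hee; right; exact ⟨t, ht, rfl⟩
        · left; right
          simp only [mem_iUnion]
          exact ⟨e', by simp [hee, he'], t, ht, rfl⟩
    · rintro z ⟨hz1, t, ht, rfl⟩
      have hzV : γ e t ∈ V → γ e t = p ∨ γ e t = q := by
        intro h
        have : γ e t ∈ s(γ e 0, γ e 1) := by
          rcases lk_Icc_cases ht with rfl | rfl | ht
          · simp
          · simp
          · exact absurd h (S.off e t ht)
        rw [hp] at this
        simpa [or_comm] using this
      rcases hz1 with hz1 | hz1
      · simp only [Finset.coe_erase, mem_sdiff, mem_singleton_iff, SetLike.mem_coe] at hz1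
        exact (hzV hz1.1).resolve_right hz1.2
      · simp only [mem_iUnion] at hz1
        obtain ⟨e', he', t', ht', h⟩ := hz1
        obtain ⟨hne, heA⟩ := Finset.mem_erase.1 he'
        have hq' := hcon e' heA hne
        have hV : γ e t ∈ V := by
          rcases lk_Icc_cases ht' with rfl | rfl | ht'
          · rw [← h]; exact S.h0 e'
          · rw [← h]; exact S.h1 e'
          · rcases lk_Icc_cases ht with rfl | rfl | ht
            · exact S.h0 e
            · exact S.h1 e
            · exact absurd (S.inj e' e t' ht' t ht h).1 hne
        refine (hzV hV).resolve_right fun hzq => hq' ?_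
        rw [← hzq, ← h]
        rcases lk_Icc_cases ht' with rfl | rfl | ht'
        · simp
        · simp
        · have hoffe := S.off e' t' ht'
          exact absurd (h ▸ hV) hoffe

/-- edges adjacent to a set -/
def adj (γ : E → ℝ → ℂ) (F : Set ℂ) (e : E) : Prop := ∃ t ∈ Ioo (0:ℝ) 1, γ e t ∈ closure F

open Classical in
theorem face_four [Fintype E] (S : LkSys V γ) (hloop : ∀ e, γ e 0 ≠ γ e 1)
    (hpar : Function.Injective fun e => s(γ e 0, γ e 1))
    (htri : ∀ e1 e2 e3 x y z, s(γ e1 0, γ e1 1) = s(x, y) → s(γ e2 0, γ e2 1) = s(y, z) →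
      s(γ e3 0, γ e3 1) = s(z, x) → False) {a b : ℂ} (ha : a ∉ gr V γ Finset.univ)
    (hb : b ∉ gr V γ Finset.univ) (hab : b ∉ connectedComponentIn (gr V γ Finset.univ)ᶜ a) :
    4 ≤ (Finset.univ.filter (adj γ (connectedComponentIn (gr V γ Finset.univ)ᶜ a))).card := by
  set F := connectedComponentIn (gr V γ Finset.univ)ᶜ a with hF
  set A := Finset.univ.filter (adj γ F)
  have hsub : gr V γ A ⊆ gr V γ Finset.univ := gr_mono (Finset.subset_univ _)
  have hza : ∀ z ∈ gr V γ A, z - a ≠ 0 := fun z hz h0 => ha (by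
    rw [← sub_eq_zero.1 h0]; exact hsub hz)
  have hzb : ∀ z ∈ gr V γ A, z - b ≠ 0 := fun z hz h0 => hb (by
    rw [← sub_eq_zero.1 h0]; exact hsub hz)
  refine S.four_edges hloop hpar htri (f := fun z => (z - a) * (z - b)⁻¹) A ?_ ?_ ?_
  · exact ContinuousOn.mul (by fun_prop) (ContinuousOn.inv₀ (by fun_prop) hzb)
  · exact fun z hz => mul_ne_zero (hza z hz) (inv_ne_zero (hzb z hz))
  · intro hlog
    have hW := lk_same_comp (S.gr_compact A) (fun h => ha (hsub h)) (fun h => hb (hsub h)) hlog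
    have hfr : frontier F ⊆ gr V γ A := by
      intro z hz
      have hzG := lk_comp_frontier (S.gr_compact _).isClosed a hz
      rw [S.mem_gr'] at hzG ⊢
      refine hzG.imp_right ?_
      rintro ⟨e, _, t, ht, rfl⟩
      exact ⟨e, by simp only [A, Finset.mem_filter, Finset.mem_univ, true_and]; exact ⟨t, ht, frontier_subset_closure hz⟩, t, ht, rfl⟩
    have haW : a ∈ (gr V γ A)ᶜ := fun h => ha (hsub h)
    have hpre : IsPreconnected (connectedComponentIn (gr V γ A)ᶜ a) :=
      isPreconnected_connectedComponentIn
    have hdis : ¬ (connectedComponentIn (gr V γ A)ᶜ a ∩ frontier F).Nonempty := by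
      rintro ⟨z, hz1, hz2⟩
      exact connectedComponentIn_subset _ _ hz1 (hfr hz2)
    have hFo : IsOpen F := (S.gr_compact _).isClosed.isOpen_compl.connectedComponentIn
    have hsubF := hpre (F) (closure F)ᶜ hFo isClosed_closure.isOpen_compl ?_
      ⟨a, mem_connectedComponentIn haW, mem_connectedComponentIn ha⟩ ?_
    · obtain ⟨z, _, hz1, hz2⟩ := hsubF
      exact hz2 (subset_closure hz1)
    · intro z hz
      by_cases hzF : z ∈ F
      · exact Or.inl hzF
      · right; intro hzc
        exact hdis ⟨z, hz, hzc, fun h => hzF (interior_subset h)⟩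
    · refine ⟨b, hW, fun hbc => hdis ⟨b, hW, hbc, fun h => hab (interior_subset h)⟩⟩

/-- T2: an edge touches at most two faces -/
theorem edge_two [Fintype E] [DecidableEq E] (S : LkSys V γ) (e : E) (hloop : γ e 0 ≠ γ e 1)
    {a b c : ℂ} (ha : a ∉ gr V γ Finset.univ) (hb : b ∉ gr V γ Finset.univ)
    (hc : c ∉ gr V γ Finset.univ)
    (hae : adj γ (connectedComponentIn (gr V γ Finset.univ)ᶜ a) e)
    (hbe : adj γ (connectedComponentIn (gr V γ Finset.univ)ᶜ b) e)
    (hce : adj γ (connectedComponentIn (gr V γ Finset.univ)ᶜ c) e)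
    (hab : b ∉ connectedComponentIn (gr V γ Finset.univ)ᶜ a)
    (hac : c ∉ connectedComponentIn (gr V γ Finset.univ)ᶜ a)
    (hbc : c ∉ connectedComponentIn (gr V γ Finset.univ)ᶜ b) : False := by
  set G := gr V γ Finset.univ with hG
  set Y := gr V γ (Finset.univ.erase e) with hY
  have hYc : IsClosed Y := (S.gr_compact _).isClosed
  have hYG : Y ⊆ G := gr_mono (Finset.erase_subset _ _)
  have hec : IsClosed (γ e '' Icc 0 1) := (isCompact_Icc.image (S.cont e)).isClosed
  have heY : γ e '' Ioo 0 1 ⊆ Yᶜ := by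
    rintro _ ⟨t, ht, rfl⟩ h
    rw [hY, S.mem_gr'] at h
    rcases h with h | ⟨e', he', t', ht', h⟩
    · exact S.off e t ht h
    · exact (Finset.ne_of_mem_erase he') (S.inj e' e t' ht' t ht h).1
  have heG : γ e '' Icc 0 1 ⊆ G := by
    rintro _ ⟨t, ht, rfl⟩
    exact mem_gr.2 (Or.inr ⟨e, Finset.mem_univ e, t, ht, rfl⟩)
  have hGY : G ⊆ Y ∪ γ e '' Icc 0 1 := by
    intro z hz
    rw [hG, mem_gr] at hz
    rcases hz with hz | ⟨e', _, t, ht, rfl⟩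
    · exact Or.inl (mem_gr.2 (Or.inl hz))
    · by_cases hee : e' = e
      · subst hee; exact Or.inr ⟨t, ht, rfl⟩
      · exact Or.inl (mem_gr.2 (Or.inr ⟨e', by simp [hee], t, ht, rfl⟩))
  have hcon : ∀ x, adj γ (connectedComponentIn Gᶜ x) e →
      IsPreconnected (connectedComponentIn Gᶜ x ∪ γ e '' Ioo 0 1) := by
    rintro x ⟨t, ht, hx⟩
    have h1 : IsPreconnected (insert (γ e t) (connectedComponentIn Gᶜ x)) :=
      isPreconnected_connectedComponentIn.subset_closure (subset_insert _ _)
        (insert_subset hx subset_closure)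
    have h2 : IsPreconnected (γ e '' Ioo 0 1) :=
      isPreconnected_Ioo.image _ (S.cont e).continuousOn
    have h3 := h1.union (γ e t) (mem_insert _ _) (mem_image_of_mem _ ht) h2
    convert h3 using 1
    ext z
    simp only [mem_union, mem_insert_iff]
    constructor
    · rintro (h | h)
      · exact Or.inl (Or.inr h)
      · exact Or.inr h
    · rintro ((rfl | h) | h)
      · exact Or.inr (mem_image_of_mem _ ht)
      · exact Or.inl h
      · exact Or.inr h
  have hlogY : ∀ x y, x ∉ G → y ∉ G → adj γ (connectedComponentIn Gᶜ x) e →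
      adj γ (connectedComponentIn Gᶜ y) e → LkHasLog (fun z => (z - x) * (z - y)⁻¹) Y := by
    intro x y hx hy hxe hye
    refine lk_log_of_conn hYc (((hcon x hxe).union (γ e (1/2)) (Or.inr ⟨1/2, by norm_num, rfl⟩)
      (Or.inr ⟨1/2, by norm_num, rfl⟩) (hcon y hye))) ?_
      (Or.inl (Or.inl (mem_connectedComponentIn hx))) (Or.inr (Or.inl (mem_connectedComponentIn hy)))
    have : ∀ x, connectedComponentIn Gᶜ x ⊆ Yᶜ := fun x =>
      (connectedComponentIn_subset _ _).trans (compl_subset_compl.2 hYG)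
    exact union_subset (union_subset (this x) heY) (union_subset (this y) heY)
  have hne : ∀ x, x ∉ G → ∀ z ∈ G, z - x ≠ 0 := fun x hx z hz h0 => hx (by
    rwa [← sub_eq_zero.1 h0])
  have hloge : ∀ x y, x ∉ G → y ∉ G → LkHasLog (fun z => (z - x) * (z - y)⁻¹) (γ e '' Icc 0 1) := by
    intro x y hx hy
    refine lk_log_arc (S.cont e).continuousOn (S.injOn hloop) ?_ ?_
    · exact ContinuousOn.mul (by fun_prop) (ContinuousOn.inv₀ (by fun_prop)
        fun z hz => hne y hy z (heG hz))
    · exact fun z hz => mul_ne_zero (hne x hx z (heG hz)) (inv_ne_zero (hne y hy z (heG hz)))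
  obtain ⟨g1, hg1, hg1e⟩ := hlogY a b ha hb hae hbe
  obtain ⟨g2, hg2, hg2e⟩ := hlogY a c ha hc hae hce
  obtain ⟨k1, hk1, hk1e⟩ := hloge a b ha hb
  obtain ⟨k2, hk2, hk2e⟩ := hloge a c ha hc
  have hpY : γ e 0 ∈ Y := mem_gr.2 (Or.inl (S.h0 e))
  have hqY : γ e 1 ∈ Y := mem_gr.2 (Or.inl (S.h1 e))
  have hpe : γ e 0 ∈ γ e '' Icc 0 1 := ⟨0, by simp, rfl⟩
  have hqe : γ e 1 ∈ γ e '' Icc 0 1 := ⟨1, by simp, rfl⟩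
  have hintr : ∀ z ∈ Y ∩ γ e '' Icc 0 1, z = γ e 0 ∨ z = γ e 1 := by
    rintro z ⟨hz, t, ht, rfl⟩
    rcases lk_Icc_cases ht with rfl | rfl | ht
    · exact Or.inl rfl
    · exact Or.inr rfl
    · exact absurd hz (heY ⟨t, ht, rfl⟩)
  -- jumps
  have hjump : ∀ g k : ℂ → ℂ, ∀ f : ℂ → ℂ, (∀ z ∈ Y, Complex.exp (g z) = f z) →
      (∀ z ∈ γ e '' Icc 0 1, Complex.exp (k z) = f z) →
      (∀ z ∈ Y ∩ γ e '' Icc 0 1, ∃ n : ℤ, g z = k z + n * (2 * Real.pi * Complex.I)) := by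
    intro g k f hg hk z hz
    exact Complex.exp_eq_exp_iff_exists_int.1 (by rw [hg z hz.1, hk z hz.2])
  obtain ⟨n1, hn1⟩ := hjump g1 k1 _ hg1e hk1e _ ⟨hpY, hpe⟩
  obtain ⟨m1, hm1⟩ := hjump g1 k1 _ hg1e hk1e _ ⟨hqY, hqe⟩
  obtain ⟨n2, hn2⟩ := hjump g2 k2 _ hg2e hk2e _ ⟨hpY, hpe⟩
  obtain ⟨m2, hm2⟩ := hjump g2 k2 _ hg2e hk2e _ ⟨hqY, hqe⟩
  have key : ∀ i j : ℤ, i * (m1 - n1) + j * (m2 - n2) = 0 → ¬ (i = 0 ∧ j = 0) → False := by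
    intro i j hij h0
    have hl : LkHasLog (fun z => ((z - a) * (z - b)⁻¹) ^ i * ((z - a) * (z - c)⁻¹) ^ j)
        (Y ∪ γ e '' Icc 0 1) := by
      refine lk_glue hYc hec (g := fun z => i * g1 z + j * g2 z)
        (h := fun z => i * k1 z + j * k2 z) ?_ ?_ ?_ ?_
        (((i * n1 + j * n2 : ℤ) : ℂ) * (2 * Real.pi * Complex.I)) ?_ ?_
      · exact (continuousOn_const.mul hg1).add (continuousOn_const.mul hg2)
      · intro z hz
        rw [Complex.exp_add, Complex.exp_int_mul, Complex.exp_int_mul, hg1e z hz, hg2e z hz]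
      · exact (continuousOn_const.mul hk1).add (continuousOn_const.mul hk2)
      · intro z hz
        rw [Complex.exp_add, Complex.exp_int_mul, Complex.exp_int_mul, hk1e z hz, hk2e z hz]
      · exact Complex.exp_int_mul_two_pi_mul_I _
      · intro z hz
        rcases hintr z hz with rfl | rfl
        · rw [hn1, hn2]; push_cast; ring
        · rw [hm1, hm2]
          have : (i : ℂ) * (m1 - n1) + j * (m2 - n2) = 0 := by exact_mod_cast hij
          push_cast
          linear_combination this * (2 * Real.pi * Complex.I)
    refine lk_sep3 (S.gr_compact Finset.univ) ha hb hc hab hac hbc (n := i + j) (k := -i) (l := -j)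
      (by ring) (by simpa using h0) ((hl.mono hGY).congr ?_)
    intro z hz
    have h1 := hne a ha z hz
    rw [zpow_add₀ h1, mul_zpow, mul_zpow, zpow_neg, zpow_neg, inv_zpow, inv_zpow]
    ring
  by_cases h1 : m1 - n1 = 0
  · exact key 1 0 (by rw [h1]; ring) (by simp)
  · exact key (m2 - n2) (-(m1 - n1)) (by ring) (by simp; intro _ h; exact h1 (by omega))

end LkSys


namespace LkSys

variable {V : Finset ℂ} {E : Type*} {γ : E → ℝ → ℂ}

/-- faces of the system -/
def Faces (V : Finset ℂ) (γ : E → ℝ → ℂ) [Fintype E] : Type :=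
  {F : Set ℂ // ∃ a, a ∉ gr V γ Finset.univ ∧ F = connectedComponentIn (gr V γ Finset.univ)ᶜ a}

theorem faces_ne {G : Set ℂ} {a b : ℂ} (_ : b ∉ G)
    (h : connectedComponentIn Gᶜ a ≠ connectedComponentIn Gᶜ b) :
    b ∉ connectedComponentIn Gᶜ a := fun h' => h (connectedComponentIn_eq h')

theorem faces_count [Fintype E] (S : LkSys V γ) (hloop : ∀ e, γ e 0 ≠ γ e 1)
    (hpar : Function.Injective fun e => s(γ e 0, γ e 1))
    (htri : ∀ e1 e2 e3 x y z, s(γ e1 0, γ e1 1) = s(x, y) → s(γ e2 0, γ e2 1) = s(y, z) →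
      s(γ e3 0, γ e3 1) = s(z, x) → False) (T : Finset (Faces V γ)) (hT : 1 < T.card) :
    T.card * 4 ≤ Fintype.card E * 2 := by
  classical
  rw [← Finset.card_univ]
  refine Finset.card_mul_le_card_mul (fun (F : Faces V γ) (e : E) => adj γ F.1 e) ?_ ?_
  · intro F hF
    obtain ⟨F', hF', hne⟩ := Finset.exists_mem_ne hT F
    obtain ⟨a, ha, hFa⟩ := F.2
    obtain ⟨b, hb, hFb⟩ := F'.2
    have := S.face_four hloop hpar htri ha hb (faces_ne hb (fun h => hne (Subtype.ext (by
      rw [hFa, hFb, h]))))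
    rw [← hFa] at this
    convert this using 2
    ext e'
    simp [Finset.mem_bipartiteAbove]
  · intro e _
    by_contra hcon
    push Not at hcon
    obtain ⟨F1, h1, F2, h2, F3, h3, h12, h13, h23⟩ := Finset.two_lt_card.1 hcon
    rw [Finset.mem_bipartiteBelow] at h1 h2 h3
    obtain ⟨a, ha, hFa⟩ := F1.2
    obtain ⟨b, hb, hFb⟩ := F2.2
    obtain ⟨c, hc, hFc⟩ := F3.2
    refine S.edge_two e (hloop e) ha hb hc (hFa ▸ h1.2) (hFb ▸ h2.2) (hFc ▸ h3.2)
      (faces_ne hb fun h => h12 (Subtype.ext ?_)) (faces_ne hc fun h => h13 (Subtype.ext ?_))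
      (faces_ne hc fun h => h23 (Subtype.ext ?_))
    · rw [hFa, hFb, h]
    · rw [hFa, hFc, h]
    · rw [hFb, hFc, h]

theorem wind_face [Fintype E] [DecidableEq E] (S : LkSys V γ) (c : E → ℂ)
    (hc : ∀ l : ℂ → ℂ, ∑ e, c e * (l (γ e 1) - l (γ e 0)) = 0) {a b : ℂ}
    (ha : a ∉ gr V γ Finset.univ)
    (hb : b ∈ connectedComponentIn (gr V γ Finset.univ)ᶜ a) :
    ∑ e, c e * lkInc (γ e) a = ∑ e, c e * lkInc (γ e) b := by
  refine lk_locconst (S := connectedComponentIn (gr V γ Finset.univ)ᶜ a)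
    isPreconnected_connectedComponentIn (fun x => ∑ e, c e * lkInc (γ e) x) ?_
    (mem_connectedComponentIn ha) hb
  intro x hx
  have hx' := connectedComponentIn_subset _ _ hx
  obtain ⟨U, hU, h⟩ := (lk_wind_const Finset.univ γ S.cont c hc (a := x) (fun e _ t ht h =>
    hx' (mem_gr.2 (Or.inr ⟨e, Finset.mem_univ e, t, ht, h⟩)))).exists_mem
  exact ⟨U, hU, fun y hy => h y hy.1⟩

theorem wind_zero' [Fintype E] [DecidableEq E] (S : LkSys V γ) (hloop : ∀ e, γ e 0 ≠ γ e 1) (c : E → ℂ)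
    (hc : ∀ l : ℂ → ℂ, ∑ e, c e * (l (γ e 1) - l (γ e 0)) = 0)
    (hw0 : ∀ a, a ∉ gr V γ Finset.univ → ∑ e, c e * lkInc (γ e) a = 0) : c = 0 := by
  funext e
  refine lk_wind_zero S hloop c hc ?_ e
  intro a ha
  have h1 := lk_wind_const Finset.univ γ S.cont c hc (a := a) (fun e _ => ha e)
  have hcl : IsClosed (⋃ e, γ e '' Icc 0 1) :=
    isClosed_iUnion_of_finite fun e' => (isCompact_Icc.image (S.cont e')).isClosed
  have h2 : ∀ᶠ b in nhds a, b ∉ ⋃ e, γ e '' Icc 0 1 := hcl.isOpen_compl.mem_nhds (by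
    simp only [mem_compl_iff, mem_iUnion, not_exists]
    rintro e ⟨t, ht, h⟩
    exact ha e t ht h)
  have h3 : ∀ᶠ b in nhdsWithin a {a}ᶜ, b ∉ ((↑V : Set ℂ) \ {a}) := by
    apply Filter.Eventually.filter_mono nhdsWithin_le_nhds
    exact (V.finite_toSet.subset sdiff_subset).isClosed.isOpen_compl.mem_nhds (by simp)
  have h4 : ∀ᶠ b in nhdsWithin a {a}ᶜ, b ∈ ({a}ᶜ : Set ℂ) := eventually_mem_nhdsWithin
  obtain ⟨b, h1, h2, h3, h4⟩ := ((h1.filter_mono nhdsWithin_le_nhds).and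
    ((h2.filter_mono nhdsWithin_le_nhds).and (h3.and h4))).exists
  rw [← h1]
  apply hw0
  rintro (hb | hb)
  · exact h3 ⟨hb, h4⟩
  · exact h2 (by simpa using hb)

/-- the planar bound -/
theorem planar [Fintype E] [DecidableEq E] [Nonempty E] (S : LkSys V γ) (hloop : ∀ e, γ e 0 ≠ γ e 1)
    (hpar : Function.Injective fun e => s(γ e 0, γ e 1))
    (htri : ∀ e1 e2 e3 x y z, s(γ e1 0, γ e1 1) = s(x, y) → s(γ e2 0, γ e2 1) = s(y, z) →
      s(γ e3 0, γ e3 1) = s(z, x) → False) (hcount : 2 * V.card ≤ Fintype.card E + 1) : False := by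
  classical
  obtain ⟨e0⟩ := ‹Nonempty E›
  have hV2 : 2 ≤ V.card := by
    rw [← Finset.card_pair (hloop e0)]
    apply Finset.card_le_card
    intro x hx
    simp only [Finset.mem_insert, Finset.mem_singleton] at hx
    rcases hx with rfl | rfl
    · exact S.h0 e0
    · exact S.h1 e0
  set v0 := γ e0 0 with hv0
  have hv0V : v0 ∈ V := S.h0 e0
  -- finiteness of faces
  have hfin : Finite (Faces V γ) := by
    by_contra hinf
    rw [not_finite_iff_infinite] at hinf
    obtain ⟨T, hT⟩ := Infinite.exists_subset_card_eq (Faces V γ) (Fintype.card E + 2)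
    have := S.faces_count hloop hpar htri T (by omega)
    omega
  have : Fintype (Faces V γ) := Fintype.ofFinite _
  have hF : Fintype.card (Faces V γ) ≤ 1 ∨ Fintype.card (Faces V γ) * 4 ≤ Fintype.card E * 2 := by
    rcases Nat.lt_or_ge 1 (Fintype.card (Faces V γ)) with h | h
    · exact Or.inr (S.faces_count hloop hpar htri Finset.univ h)
    · exact Or.inl h
  -- boundary map
  let W := {v // v ∈ V.erase v0}
  let ι : ℂ → ℂ → ℂ := fun x v => if x = v then 1 else 0
  let bd : (E → ℂ) →ₗ[ℂ] (W → ℂ) :=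
    { toFun := fun c v => ∑ e, c e * (ι (γ e 1) v.1 - ι (γ e 0) v.1)
      map_add' := fun c d => by
        ext v; simp only [Pi.add_apply, add_mul, Finset.sum_add_distrib]
      map_smul' := fun r c => by
        ext v; simp only [Pi.smul_apply, smul_eq_mul, RingHom.id_apply, Finset.mul_sum, mul_assoc] }
  have hcyc : ∀ c ∈ LinearMap.ker bd, ∀ l : ℂ → ℂ, ∑ e, c e * (l (γ e 1) - l (γ e 0)) = 0 := by
    intro c hcK l
    have hl : ∀ x ∈ V, l x - l v0 = ∑ v ∈ V.erase v0, (l v - l v0) * ι x v := by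
      intro x hx
      by_cases hx0 : x = v0
      · rw [hx0, sub_self]
        symm
        apply Finset.sum_eq_zero
        intro v hv
        simp [ι, (Finset.ne_of_mem_erase hv).symm]
      · rw [Finset.sum_eq_single x]
        · simp [ι]
        · intro b _ hb; simp [ι, hb.symm]
        · intro h; exact absurd (Finset.mem_erase.2 ⟨hx0, hx⟩) h
    have h1 : ∀ e, c e * (l (γ e 1) - l (γ e 0)) =
        ∑ v ∈ V.erase v0, (l v - l v0) * (c e * (ι (γ e 1) v - ι (γ e 0) v)) := by
      intro e
      have : l (γ e 1) - l (γ e 0) = (l (γ e 1) - l v0) - (l (γ e 0) - l v0) := by ring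
      rw [this, hl _ (S.h1 e), hl _ (S.h0 e), ← Finset.sum_sub_distrib, Finset.mul_sum]
      exact Finset.sum_congr rfl fun v _ => by ring
    rw [Finset.sum_congr rfl fun e _ => h1 e, Finset.sum_comm]
    apply Finset.sum_eq_zero
    intro v hv
    rw [← Finset.mul_sum]
    have := congrFun (LinearMap.mem_ker.1 hcK) ⟨v, hv⟩
    simp only [bd, LinearMap.coe_mk, AddHom.coe_mk, Pi.zero_apply] at this
    rw [this, mul_zero]
  choose rep hrep hrepF using fun F : Faces V γ => F.2
  let wm : LinearMap.ker bd →ₗ[ℂ] (Faces V γ → ℂ) :=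
    { toFun := fun c F => ∑ e, c.1 e * lkInc (γ e) (rep F)
      map_add' := fun c d => by
        ext v
        simp only [Submodule.coe_add, Pi.add_apply, add_mul, Finset.sum_add_distrib]
      map_smul' := fun r c => by
        ext v
        simp only [Submodule.coe_smul, Pi.smul_apply, smul_eq_mul, RingHom.id_apply,
          Finset.mul_sum, mul_assoc] }
  have hwinj : Function.Injective wm := by
    rw [← LinearMap.ker_eq_bot, LinearMap.ker_eq_bot']
    rintro ⟨c, hcK⟩ hc0
    apply Subtype.ext
    refine S.wind_zero' hloop c (hcyc c hcK) ?_
    intro a ha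
    let F : Faces V γ := ⟨_, a, ha, rfl⟩
    have h1 := congrFun hc0 F
    have h2 := S.wind_face c (hcyc c hcK) (hrep F) (b := a) (by
      rw [← hrepF F]; exact mem_connectedComponentIn ha)
    rw [← h2]
    exact h1
  have h1 := LinearMap.finrank_le_finrank_of_injective hwinj
  have h2 := LinearMap.finrank_range_add_finrank_ker bd
  have h3 := Submodule.finrank_le (LinearMap.range bd)
  rw [Module.finrank_fintype_fun_eq_card] at h1 h2 h3
  have h4 : Fintype.card W = V.card - 1 := by
    rw [← Finset.card_erase_of_mem hv0V]; exact Fintype.card_coe _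
  omega

end LkSys


/-! ### Eulerian orientations -/

theorem lk_ffinv {α : Type*} [Fintype α] (h : Even (Fintype.card α)) :
    ∃ m : Equiv.Perm α, (∀ x, m (m x) = x) ∧ ∀ x, m x ≠ x := by
  obtain ⟨n, hn⟩ := h
  have e : α ≃ Fin n × Bool := Fintype.equivOfCardEq (by simp [hn]; ring)
  refine ⟨e.trans ((Equiv.prodCongr (Equiv.refl _) Equiv.boolNot).trans e.symm), ?_, ?_⟩
  · have hb : ∀ y : Fin n × Bool, Prod.map id Equiv.boolNot (Prod.map id Equiv.boolNot y) = y := by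
      rintro ⟨a, b⟩
      cases b <;> rfl
    intro x
    simp [hb]
  · intro x hx
    have := congrArg e hx
    simp [Prod.ext_iff] at this

theorem lk_ffinv_fib {H Z : Type*} [Fintype H] [DecidableEq Z] (pos : H → Z)
    (heven : ∀ v, Even (Finset.univ.filter fun h => pos h = v).card) :
    ∃ M : Equiv.Perm H, (∀ x, M (M x) = x) ∧ (∀ x, M x ≠ x) ∧ ∀ x, pos (M x) = pos x := by
  have : ∀ v, ∃ m : Equiv.Perm {h // pos h = v}, (∀ x, m (m x) = x) ∧ ∀ x, m x ≠ x := fun v =>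
    lk_ffinv (by rw [Fintype.card_subtype]; exact heven v)
  choose m hm1 hm2 using this
  let f : H → H := fun h => (m (pos h) ⟨h, rfl⟩).1
  have hpos : ∀ h, pos (f h) = pos h := fun h => (m (pos h) ⟨h, rfl⟩).2
  have hgen : ∀ (v w) (h : v = w) (x : H) (hx : pos x = v),
      (m v ⟨x, hx⟩).1 = (m w ⟨x, hx.trans h⟩).1 := by
    rintro v _ rfl x hx; rfl
  have hff : ∀ h, f (f h) = h := by
    intro h
    have : f (f h) = (m (pos h) ⟨f h, hpos h⟩).1 := hgen _ _ (hpos h) (f h) rfl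
    rw [this]
    have := hm1 (pos h) ⟨h, rfl⟩
    exact congrArg Subtype.val this
  refine ⟨⟨f, f, hff, hff⟩, hff, fun x hx => hm2 (pos x) ⟨x, rfl⟩ (Subtype.ext hx), hpos⟩

theorem lk_euler {E Z : Type*} [Fintype E] [DecidableEq Z] (src tgt : E → Z)
    (heven : ∀ v, Even ((Finset.univ.filter fun e => src e = v).card +
      (Finset.univ.filter fun e => tgt e = v).card)) :
    ∃ (o : E → Bool) (σ : Equiv.Perm E), ∀ e,
      (if o e then src e else tgt e) = (if o (σ e) then tgt (σ e) else src (σ e)) := by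
  classical
  let pos : E × Bool → Z := fun h => if h.2 then tgt h.1 else src h.1
  have hev : ∀ v, Even (Finset.univ.filter fun h => pos h = v).card := by
    intro v
    convert heven v using 1
    rw [Finset.card_filter, Finset.card_filter, Finset.card_filter, ← Finset.univ_product_univ,
      Finset.sum_product, ← Finset.sum_add_distrib]
    refine Finset.sum_congr rfl fun e _ => ?_
    rw [Fintype.sum_bool]
    simp only [pos, if_true, Bool.false_eq_true, if_false]
    exact add_comm _ _
  obtain ⟨M, hMM, hMne, hMpos⟩ := lk_ffinv_fib pos hev
  let ι : Equiv.Perm (E × Bool) := Equiv.prodCongr (Equiv.refl _) Equiv.boolNot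
  have hιι : ∀ x, ι (ι x) = x := by
    rintro ⟨a, b⟩
    cases b <;> rfl
  have hιne : ∀ x, ι x ≠ x := fun x h => by simp [ι, Prod.ext_iff] at h
  let σ : Equiv.Perm (E × Bool) := M * ι
  have hσ : ∀ x, σ x = M (ι x) := fun x => rfl
  have hι1 : ι * σ * ι⁻¹ = σ⁻¹ := by
    ext x : 1
    rw [Equiv.Perm.eq_inv_iff_eq]
    have hinv : ι⁻¹ x = ι x := by rw [Equiv.Perm.inv_eq_iff_eq, hιι]
    simp only [Equiv.Perm.mul_apply, hσ, hinv, hιι, hMM]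
  have hconj : ∀ (k : ℤ) x, ι ((σ ^ k) x) = (σ ^ (-k)) (ι x) := by
    intro k x
    have : ι * σ ^ k * ι⁻¹ = σ ^ (-k) := by
      rw [← conj_zpow, hι1, inv_zpow, zpow_neg]
    rw [← this]; simp
  have hsame : ∀ h, ¬ σ.SameCycle h (ι h) := by
    rintro h ⟨k, hk⟩
    obtain ⟨j, hj | hj⟩ := Int.even_or_odd' k
    · apply hιne ((σ ^ j) h)
      rw [hconj, ← hk, ← Equiv.Perm.mul_apply, ← zpow_add, hj]
      congr 2; ring
    · apply hMne (ι ((σ ^ j) h))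
      have e1 : M (ι ((σ ^ j) h)) = (σ ^ (1 + j)) h := by
        rw [zpow_one_add, Equiv.Perm.mul_apply, hσ]
      have e2 : ι ((σ ^ j) h) = (σ ^ (-j + k)) h := by
        rw [hconj, ← hk, zpow_add, Equiv.Perm.mul_apply]
      rw [e1, e2, hj]
      congr 2; ring
  let Q := Quotient (Equiv.Perm.SameCycle.setoid σ)
  obtain ⟨q', hq'⟩ : ∃ q' : Q → ℕ, Function.Injective q' := by
    have : Fintype Q := Fintype.ofFinite _
    exact ⟨fun x => Fintype.equivFin Q x, fun x y h => (Fintype.equivFin Q).injective (Fin.ext h)⟩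
  let q : E × Bool → ℕ := fun h => q' (Quotient.mk _ h)
  have hq : ∀ h h', q h = q h' ↔ σ.SameCycle h h' := by
    intro h h'
    constructor
    · intro hh
      exact Quotient.exact (hq' hh)
    · intro hh
      exact congrArg q' (Quotient.sound hh)
  let col : E × Bool → Bool := fun h => decide (q h < q (ι h))
  have hcolι : ∀ h, col (ι h) = !col h := by
    intro h
    have : q h ≠ q (ι h) := fun hh => hsame h ((hq _ _).1 hh)
    simp only [col, hιι]
    rw [← decide_not, decide_eq_decide]
    omega
  have hcolσ : ∀ h, col (σ h) = col h := by
    intro h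
    have h1 : q (σ h) = q h := (hq _ _).2 (by simpa using Equiv.Perm.SameCycle.refl σ h)
    have h2 : q (ι (σ h)) = q (ι h) := (hq _ _).2 (by
      have := hconj 1 h
      rw [zpow_one] at this
      rw [this]
      simpa using Equiv.Perm.SameCycle.refl σ (ι h))
    simp only [col, h1, h2]
  have hcole : ∀ e, col (e, true) = !col (e, false) := fun e => hcolι (e, false)
  let o : E → Bool := fun e => !col (e, false)
  have ho : ∀ e, col (e, o e) = true := by
    intro e
    by_cases h : col (e, false) = true
    · simp [o, h]
    · simp only [Bool.not_eq_true] at h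
      simp [o, h, hcole]
  have ho' : ∀ h, col h = true → h.2 = o h.1 := by
    rintro ⟨e, b⟩ h
    cases b
    · simp [o, h]
    · simp only [hcole] at h
      simpa [o] using h
  let f : E → E := fun e => (σ (e, o e)).1
  have hf : ∀ e, σ (e, o e) = (f e, o (f e)) := by
    intro e
    apply Prod.ext
    · rfl
    · exact ho' _ (by rw [hcolσ, ho])
  have hinj : Function.Injective f := by
    intro e e' h
    have h2 : σ (e, o e) = σ (e', o e') := by rw [hf, hf, h]
    exact congrArg Prod.fst (σ.injective h2)
  refine ⟨o, Equiv.ofBijective f (Finite.injective_iff_bijective.1 hinj), fun e => ?_⟩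
  have h1 : pos (σ (e, o e)) = pos (ι (e, o e)) := by rw [hσ, hMpos]
  rw [hf] at h1
  simp only [Equiv.ofBijective_apply]
  simp only [pos, ι] at h1
  rw [h1]
  by_cases h : o e = true <;> simp [h]

/-! ### Removing a short cycle -/

section cut
variable {E Z : Type*} [Fintype E] [DecidableEq E] [DecidableEq Z] (src tgt : E → Z)

/-- edges with exactly one end in `A` -/
def lkCut (A : Finset Z) : Finset E := Finset.univ.filter fun e => ¬ (src e ∈ A ↔ tgt e ∈ A)

/-- edges inside `A` -/
def lkIns (A : Finset Z) : Finset E := Finset.univ.filter fun e => src e ∈ A ∧ tgt e ∈ A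

/-- number of ends of `e` at `v` -/
def lkHd (e : E) (v : Z) : ℕ := (if src e = v then 1 else 0) + (if tgt e = v then 1 else 0)

theorem lk_hd_of_eq {e : E} {x y : Z} (h : s(src e, tgt e) = s(x, y)) (v : Z) :
    lkHd src tgt e v = (if x = v then 1 else 0) + (if y = v then 1 else 0) := by
  rw [Sym2.eq_iff] at h
  unfold lkHd
  rcases h with ⟨rfl, rfl⟩ | ⟨rfl, rfl⟩
  · rfl
  · rw [add_comm]

theorem lk_cut_count (V A : Finset Z) (hA : A ⊆ V) (hdeg : ∀ v ∈ V, ∑ e, lkHd src tgt e v = 4) :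
    2 * (lkIns src tgt A).card + (lkCut src tgt A).card = 4 * A.card := by
  have h1 : ∑ v ∈ A, ∑ e, lkHd src tgt e v = 4 * A.card := by
    rw [Finset.sum_congr rfl fun v hv => hdeg v (hA hv)]
    simp [mul_comm]
  rw [← h1, Finset.sum_comm, lkIns, lkCut, Finset.card_filter, Finset.card_filter, Finset.mul_sum,
    ← Finset.sum_add_distrib]
  refine Finset.sum_congr rfl fun e _ => ?_
  simp only [lkHd, Finset.sum_add_distrib, Finset.sum_ite_eq]
  by_cases h1 : src e ∈ A <;> by_cases h2 : tgt e ∈ A <;> simp [h1, h2]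

theorem lk_cut_sub (A B : Finset Z) :
    (lkCut src tgt (A ∩ B)).card + (lkCut src tgt (A \ B)).card ≤
      2 * (lkCut src tgt B).card + (lkCut src tgt A).card := by
  simp only [lkCut, Finset.card_filter, Finset.mul_sum]
  rw [← Finset.sum_add_distrib, ← Finset.sum_add_distrib]
  refine Finset.sum_le_sum fun e _ => ?_
  by_cases h1 : src e ∈ A <;> by_cases h2 : tgt e ∈ A <;> by_cases h3 : src e ∈ B <;>
    by_cases h4 : tgt e ∈ B <;> simp [h1, h2, h3, h4]

/-- the main combinatorial reduction -/
theorem lk_reduce (V : Finset Z) (hV : V.Nonempty) (hs : ∀ e, src e ∈ V) (ht : ∀ e, tgt e ∈ V)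
    (hdeg : ∀ v ∈ V, ∑ e, lkHd src tgt e v = 4)
    (hconn : ∀ A ⊆ V, A.Nonempty → A ≠ V → (lkCut src tgt A).Nonempty)
    (hplan : ∀ A ⊆ V, (lkIns src tgt A).Nonempty → 2 * A.card ≤ (lkIns src tgt A).card + 1 →
      (∃ e ∈ lkIns src tgt A, src e = tgt e) ∨
      (∃ e ∈ lkIns src tgt A, ∃ e' ∈ lkIns src tgt A, e ≠ e' ∧
        s(src e, tgt e) = s(src e', tgt e')) ∨
      (∃ e1 ∈ lkIns src tgt A, ∃ e2 ∈ lkIns src tgt A, ∃ e3 ∈ lkIns src tgt A, ∃ x y z,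
        s(src e1, tgt e1) = s(x, y) ∧ s(src e2, tgt e2) = s(y, z) ∧ s(src e3, tgt e3) = s(z, x))) :
    ∃ (C : Finset E) (W : Finset Z), 1 ≤ C.card ∧ C.card ≤ 3 ∧ W ⊆ V ∧ W.card = C.card ∧
      (∀ v, ∑ e ∈ C, lkHd src tgt e v = if v ∈ W then 2 else 0) ∧
      ∀ A ⊆ V, A.Nonempty → A ≠ V → (lkCut src tgt A \ C).Nonempty := by
  classical
  have hcutV : lkCut src tgt V = ∅ := by simp [lkCut, hs, ht]
  obtain ⟨A, hA, hmin⟩ := Finset.exists_min_image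
    (V.powerset.filter fun A => A.Nonempty ∧ (lkCut src tgt A).card ≤ 2) Finset.card
    ⟨V, by simp [hV, hcutV]⟩
  simp only [Finset.mem_filter, Finset.mem_powerset] at hA hmin
  obtain ⟨hAV, hAne, hAcut⟩ := hA
  have hcount := lk_cut_count src tgt V A hAV hdeg
  have hApos : 0 < A.card := hAne.card_pos
  -- it suffices to find the cycle
  suffices h : ∃ (C : Finset E) (W : Finset Z), 1 ≤ C.card ∧ C.card ≤ 3 ∧ C ⊆ lkIns src tgt A ∧
      W ⊆ V ∧ W.card = C.card ∧ (∀ v, ∑ e ∈ C, lkHd src tgt e v = if v ∈ W then 2 else 0) by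
    obtain ⟨C, W, h1, h2, h3, h4, h5, h6⟩ := h
    refine ⟨C, W, h1, h2, h4, h5, h6, fun B hB hBne hBV => ?_⟩
    by_contra hcon
    rw [Finset.not_nonempty_iff_eq_empty, Finset.sdiff_eq_empty_iff_subset] at hcon
    obtain ⟨e, he⟩ := hconn B hB hBne hBV
    have heA := h3 (hcon he)
    simp only [lkIns, lkCut, Finset.mem_filter, Finset.mem_univ, true_and] at heA he
    have hBc := lk_cut_count src tgt V B hB hdeg
    have hBcard := (Finset.card_le_card hcon).trans h2
    have hsub := lk_cut_sub src tgt A B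
    have hn1 : (A ∩ B).Nonempty := by
      by_cases h : src e ∈ B
      · exact ⟨src e, by simp [h, heA]⟩
      · exact ⟨tgt e, by simp only [Finset.mem_inter]; tauto⟩
    have hn2 : (A \ B).Nonempty := by
      by_cases h : src e ∈ B
      · exact ⟨tgt e, by simp only [Finset.mem_sdiff]; tauto⟩
      · exact ⟨src e, by simp [h, heA]⟩
    have hadd := Finset.card_inter_add_card_sdiff A B
    have hp1 := hn1.card_pos
    have hp2 := hn2.card_pos
    have k1 : 2 < (lkCut src tgt (A ∩ B)).card := by
      by_contra hle
      have := hmin (A ∩ B) ⟨Finset.inter_subset_left.trans hAV, hn1, not_lt.1 hle⟩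
      omega
    have k2 : 2 < (lkCut src tgt (A \ B)).card := by
      by_contra hle
      have := hmin (A \ B) ⟨Finset.sdiff_subset.trans hAV, hn2, not_lt.1 hle⟩
      omega
    have c1 := lk_cut_count src tgt V (A ∩ B) (Finset.inter_subset_left.trans hAV) hdeg
    have c2 := lk_cut_count src tgt V (A \ B) (Finset.sdiff_subset.trans hAV) hdeg
    omega
  have hIne : (lkIns src tgt A).Nonempty := by
    rw [← Finset.card_pos]; omega
  by_cases hl : ∃ e ∈ lkIns src tgt A, src e = tgt e
  · obtain ⟨e, he, hl⟩ := hl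
    refine ⟨{e}, {src e}, by simp, by simp, by simpa using he, by simpa using hs e, by simp, ?_⟩
    intro v
    simp only [Finset.sum_singleton, lkHd, ← hl, Finset.mem_singleton]
    by_cases h : src e = v
    · simp [h]
    · simp [h, Ne.symm h]
  by_cases hp : ∃ e ∈ lkIns src tgt A, ∃ e' ∈ lkIns src tgt A, e ≠ e' ∧
        s(src e, tgt e) = s(src e', tgt e')
  · obtain ⟨e, he, e', he', hne, hp⟩ := hp
    have hst : src e ≠ tgt e := fun h => hl ⟨e, he, h⟩
    refine ⟨{e, e'}, {src e, tgt e}, by simp [hne], by simp [hne], ?_, ?_, ?_, ?_⟩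
    · intro x hx; simp only [Finset.mem_insert, Finset.mem_singleton] at hx
      rcases hx with rfl | rfl <;> assumption
    · intro x hx; simp only [Finset.mem_insert, Finset.mem_singleton] at hx
      rcases hx with rfl | rfl
      · exact hs _
      · exact ht _
    · rw [Finset.card_pair hst, Finset.card_pair hne]
    · intro v
      rw [Finset.sum_pair hne, lk_hd_of_eq src tgt rfl, lk_hd_of_eq src tgt hp.symm]
      simp only [Finset.mem_insert, Finset.mem_singleton]
      by_cases h1 : src e = v
      · subst h1; simp [hst.symm]
      · by_cases h2 : tgt e = v
        · subst h2; simp [hst]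
        · simp [h1, h2, Ne.symm h1, Ne.symm h2]
  obtain ⟨e1, h1, e2, h2, e3, h3, x, y, z, E1, E2, E3⟩ :=
    ((hplan A hAV hIne (by omega)).resolve_left hl).resolve_left hp
  have hnl : ∀ e ∈ lkIns src tgt A, ∀ p q, s(src e, tgt e) = s(p, q) → p ≠ q := by
    rintro e he p q h rfl
    apply hl
    rw [Sym2.eq_iff] at h
    refine ⟨e, he, ?_⟩
    rcases h with ⟨h1, h2⟩ | ⟨h1, h2⟩ <;> rw [h1, h2]
  have hxy := hnl e1 h1 x y E1
  have hyz := hnl e2 h2 y z E2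
  have hzx := hnl e3 h3 z x E3
  have h12 : e1 ≠ e2 := by
    rintro rfl
    rw [E1, Sym2.eq_iff] at E2
    rcases E2 with ⟨a, b⟩ | ⟨a, b⟩
    · exact hxy a
    · exact hzx a.symm
  have h13 : e1 ≠ e3 := by
    rintro rfl
    rw [E1, Sym2.eq_iff] at E3
    rcases E3 with ⟨a, b⟩ | ⟨a, b⟩
    · exact hzx a.symm
    · exact hyz b
  have h23 : e2 ≠ e3 := by
    rintro rfl
    rw [E2, Sym2.eq_iff] at E3
    rcases E3 with ⟨a, b⟩ | ⟨a, b⟩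
    · exact hyz a
    · exact hxy a.symm
  have hV' : ∀ e, ∀ p q, s(src e, tgt e) = s(p, q) → p ∈ V := by
    intro e p q h
    rw [Sym2.eq_iff] at h
    rcases h with ⟨h1, h2⟩ | ⟨h1, h2⟩
    · rw [← h1]; exact hs e
    · rw [← h2]; exact ht e
  have hC : ({e1, e2, e3} : Finset E).card = 3 := Finset.card_eq_three.2 ⟨_, _, _, h12, h13, h23, rfl⟩
  have hW : ({x, y, z} : Finset Z).card = 3 :=
    Finset.card_eq_three.2 ⟨_, _, _, hxy, hzx.symm, hyz, rfl⟩
  refine ⟨{e1, e2, e3}, {x, y, z}, by omega, by omega, ?_, ?_, by omega, ?_⟩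
  · intro p hp; simp only [Finset.mem_insert, Finset.mem_singleton] at hp
    rcases hp with rfl | rfl | rfl <;> assumption
  · intro p hp; simp only [Finset.mem_insert, Finset.mem_singleton] at hp
    rcases hp with rfl | rfl | rfl
    · exact hV' _ _ _ E1
    · exact hV' _ _ _ E2
    · exact hV' _ _ _ E3
  · intro v
    rw [Finset.sum_insert (by simp [h12, h13]), Finset.sum_pair h23, lk_hd_of_eq src tgt E1,
      lk_hd_of_eq src tgt E2, lk_hd_of_eq src tgt E3]
    simp only [Finset.mem_insert, Finset.mem_singleton]
    by_cases k1 : x = v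
    · subst k1; simp [hzx, hxy.symm]
    · by_cases k2 : y = v
      · subst k2; simp [hxy, hyz.symm]
      · by_cases k3 : z = v
        · subst k3; simp [hyz, hzx.symm]
        · simp [k1, k2, k3, Ne.symm k1, Ne.symm k2, Ne.symm k3]

end cut


set_option linter.unusedSectionVars false
/-! ### Rebuilding a link projection from an oriented arc system -/

section build
variable {D : Type} {Z : Type*} [TopologicalSpace Z]

/-- Run along the arcs in the order prescribed by the permutation. -/
def lkRun (γ : D → ℝ → Z) (σ : Equiv.Perm D) (d : D) (x : ℝ) : Z :=
  γ ((σ ^ ⌊x⌋) d) (Int.fract x)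

theorem lkRun_cont (γ : D → ℝ → Z) (σ : Equiv.Perm D) (hc : ∀ d, Continuous (γ d))
    (hσ : ∀ d, γ d 1 = γ (σ d) 0) (d : D) : Continuous (lkRun γ σ d) := by
  rw [continuous_iff_continuousAt]
  intro x
  set n := ⌊x⌋ with hn
  have hcont : Continuous fun y : ℝ =>
      if (n:ℝ) ≤ y then γ ((σ ^ n) d) (y - n) else γ ((σ ^ (n - 1)) d) (y - n + 1) := by
    refine Continuous.if_le ((hc _).comp (by fun_prop)) ((hc _).comp (by fun_prop))
      continuous_const continuous_id ?_
    intro y hy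
    have hy' : (n:ℝ) = y := hy
    rw [← hy', sub_self, zero_add, hσ, ← Equiv.Perm.mul_apply, ← zpow_one_add]
    congr 3; ring
  refine hcont.continuousAt.congr ?_
  have hmem : Ioo ((n:ℝ) - 1) (n + 1) ∈ nhds x := by
    apply Ioo_mem_nhds
    · have := Int.floor_le x; linarith
    · exact Int.lt_floor_add_one x
  filter_upwards [hmem] with y hy
  unfold lkRun
  by_cases h : (n:ℝ) ≤ y
  · have : ⌊y⌋ = n := Int.floor_eq_iff.2 ⟨h, hy.2⟩
    rw [if_pos h, Int.fract, this]
  · have : ⌊y⌋ = n - 1 := Int.floor_eq_iff.2 ⟨by push_cast; linarith [hy.1], by push_cast; linarith⟩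
    rw [if_neg h, Int.fract, this]
    push_cast
    congr 1; ring

variable [Finite D]

theorem lk_period_pos (σ : Equiv.Perm D) (d : D) : 0 < MulAction.period σ d :=
  MulAction.period_pos_of_orderOf_pos (orderOf_pos σ) d

theorem lk_zpow_eq (σ : Equiv.Perm D) (d : D) (a b : ℤ) :
    (σ ^ a) d = (σ ^ b) d ↔ (MulAction.period σ d : ℤ) ∣ a - b := by
  rw [← MulAction.zpow_smul_eq_iff_period_dvd, Equiv.Perm.smul_def]
  rw [sub_eq_neg_add, zpow_add, Equiv.Perm.mul_apply, zpow_neg, Equiv.Perm.inv_eq_iff_eq]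

theorem lkRun_periodic (γ : D → ℝ → Z) (σ : Equiv.Perm D) (d : D) :
    Function.Periodic (fun x => lkRun γ σ d (MulAction.period σ d * x)) (1:ℝ) := by
  intro x
  simp only [lkRun]
  rw [mul_add, mul_one, Int.fract_add_natCast, Int.floor_add_natCast]
  congr 1
  rw [lk_zpow_eq]
  simp

/-- The representative of a cycle. -/
def lkRep (σ : Equiv.Perm D) (q : Quotient (Equiv.Perm.SameCycle.setoid σ)) : D := q.out

/-- The parametrization of the arcs by the circles. -/
def lkPhi (σ : Equiv.Perm D) (x : Quotient (Equiv.Perm.SameCycle.setoid σ) × AddCircle (1:ℝ)) :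
    D × Ico (0:ℝ) 1 :=
  let y := (MulAction.period σ (lkRep σ x.1) : ℝ) * (AddCircle.equivIco 1 0 x.2 : ℝ)
  ⟨(σ ^ ⌊y⌋) (lkRep σ x.1), ⟨Int.fract y, Int.fract_nonneg y, Int.fract_lt_one y⟩⟩

theorem lkPhi_inj (σ : Equiv.Perm D) : Function.Injective (lkPhi σ) := by
  rintro ⟨q, t⟩ ⟨q', t'⟩ h
  have h1 := congrArg Prod.fst h
  have h2 := congrArg (fun z => (z.2 : ℝ)) h
  simp only [lkPhi] at h1 h2
  have hq : q = q' := by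
    rw [← Quotient.out_eq q, ← Quotient.out_eq q']
    apply Quotient.sound
    have := Equiv.Perm.SameCycle.refl σ ((σ ^ ⌊(MulAction.period σ (lkRep σ q) : ℝ) *
      (AddCircle.equivIco 1 0 t : ℝ)⌋) (lkRep σ q))
    nth_rewrite 2 [h1] at this
    rw [Equiv.Perm.sameCycle_zpow_left, Equiv.Perm.sameCycle_zpow_right] at this
    exact this
  subst hq
  rw [lk_zpow_eq] at h1
  set d := lkRep σ q
  set l := MulAction.period σ d with hl
  have hlpos : 0 < l := lk_period_pos σ d
  have hlpos' : (0:ℝ) < l := by exact_mod_cast hlpos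
  have hb : ∀ t : AddCircle (1:ℝ), 0 ≤ ⌊(l:ℝ) * (AddCircle.equivIco 1 0 t : ℝ)⌋ ∧
      ⌊(l:ℝ) * (AddCircle.equivIco 1 0 t : ℝ)⌋ < l := by
    intro t
    have ht0 := (AddCircle.equivIco 1 0 t).2
    have ht : 0 ≤ (AddCircle.equivIco 1 0 t : ℝ) ∧ (AddCircle.equivIco 1 0 t : ℝ) < 1 :=
      ⟨ht0.1, by have := ht0.2; linarith⟩
    constructor
    · exact Int.floor_nonneg.2 (mul_nonneg hlpos'.le ht.1)
    · rw [Int.floor_lt]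
      push_cast
      nlinarith [ht.2]
  have h3 : ⌊(l:ℝ) * (AddCircle.equivIco 1 0 t : ℝ)⌋ = ⌊(l:ℝ) * (AddCircle.equivIco 1 0 t' : ℝ)⌋ := by
    obtain ⟨a1, a2⟩ := hb t
    obtain ⟨b1, b2⟩ := hb t'
    have := Int.eq_zero_of_abs_lt_dvd h1 (by rw [abs_lt]; constructor <;> omega)
    omega
  have h4 : (l:ℝ) * (AddCircle.equivIco 1 0 t : ℝ) = (l:ℝ) * (AddCircle.equivIco 1 0 t' : ℝ) := by
    rw [← Int.floor_add_fract ((l:ℝ) * (AddCircle.equivIco 1 0 t : ℝ)), h2, h3, Int.floor_add_fract]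
  have h5 := mul_left_cancel₀ hlpos'.ne' h4
  have h6 : t = t' := (AddCircle.equivIco 1 0).injective (Subtype.ext h5)
  rw [h6]

theorem lkPhi_surj (σ : Equiv.Perm D) : Function.Surjective (lkPhi σ) := by
  rintro ⟨d', s, hs⟩
  let q : Quotient (Equiv.Perm.SameCycle.setoid σ) := Quotient.mk _ d'
  obtain ⟨k, hk⟩ : σ.SameCycle (lkRep σ q) d' := Quotient.exact (Quotient.out_eq q)
  set d := lkRep σ q with hd
  set l := MulAction.period σ d with hl
  have hlpos : 0 < l := lk_period_pos σ d
  have hlpos' : (0:ℝ) < l := by exact_mod_cast hlpos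
  have hk0 : 0 ≤ k % l := Int.emod_nonneg _ (by omega)
  have hk1 : k % l < l := Int.emod_lt_of_pos _ (by omega)
  have hk0' : (0:ℝ) ≤ ((k % l : ℤ) : ℝ) := by exact_mod_cast hk0
  have hk1' : ((k % l : ℤ) : ℝ) + 1 ≤ l := by exact_mod_cast hk1
  have hx : (((k % l : ℤ) : ℝ) + s) / l ∈ Ico (0:ℝ) (0 + 1) := by
    constructor
    · exact div_nonneg (add_nonneg hk0' hs.1) hlpos'.le
    · rw [zero_add, div_lt_one hlpos']
      linarith [hs.2]
  refine ⟨(q, (AddCircle.equivIco 1 0).symm ⟨_, hx⟩), ?_⟩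
  have hy0 : (AddCircle.equivIco (1:ℝ) 0 ((AddCircle.equivIco 1 0).symm ⟨_, hx⟩) : ℝ) =
    (((k % l : ℤ) : ℝ) + s) / l := by rw [Equiv.apply_symm_apply]
  have hy : (l:ℝ) * ((((k % l : ℤ) : ℝ) + s) / l) = ((k % l : ℤ) : ℝ) + s := by field_simp
  have hf : ⌊((k % l : ℤ) : ℝ) + s⌋ = k % l := by
    rw [Int.floor_eq_iff]; constructor <;> linarith [hs.1, hs.2]
  apply Prod.ext
  · change (σ ^ ⌊(l:ℝ) * (AddCircle.equivIco (1:ℝ) 0 _ : ℝ)⌋) d = d'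
    rw [hy0, hy, hf, ← hk, lk_zpow_eq, ← hl]
    exact ⟨-(k / l), by have := Int.emod_add_mul_ediv k l; linarith⟩
  · apply Subtype.ext
    change Int.fract ((l:ℝ) * (AddCircle.equivIco (1:ℝ) 0 _ : ℝ)) = s
    rw [hy0, hy, Int.fract, hf]; ring

theorem lkRun_phi (γ : D → ℝ → Z) (σ : Equiv.Perm D)
    (q : Quotient (Equiv.Perm.SameCycle.setoid σ)) (t : AddCircle (1:ℝ)) :
    (lkRun_periodic γ σ (lkRep σ q)).lift t = γ (lkPhi σ (q, t)).1 (lkPhi σ (q, t)).2 := by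
  have : t = ((AddCircle.equivIco 1 0 t : ℝ) : AddCircle (1:ℝ)) :=
    ((AddCircle.equivIco 1 0).symm_apply_apply t).symm
  conv_lhs => rw [this]
  exact Function.Periodic.lift_coe _ _

/-- The number of arcs starting at a point. -/
def lkOut (γ : D → ℝ → Z) (v : Z) : ℕ := Nat.card {d : D | γ d 0 = v}

theorem lk_fib {V : Finset Z} {γ : D → ℝ → Z} (S : LkSys V γ) (p : Z) :
    ({x : D × Ico (0:ℝ) 1 | γ x.1 x.2 = p}.Finite) ∧
    (p ∈ V → Nat.card {x : D × Ico (0:ℝ) 1 | γ x.1 x.2 = p} = lkOut γ p) ∧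
    (p ∉ V → Nat.card {x : D × Ico (0:ℝ) 1 | γ x.1 x.2 = p} ≤ 1 ∧ lkOut γ p = 0) := by
  have hio : ∀ s : Ico (0:ℝ) 1, (s:ℝ) = 0 ∨ (s:ℝ) ∈ Ioo (0:ℝ) 1 := by
    rintro ⟨s, h0, h1⟩
    rcases eq_or_lt_of_le h0 with h | h
    · exact Or.inl h.symm
    · exact Or.inr ⟨h, h1⟩
  have hV : p ∈ V → {x : D × Ico (0:ℝ) 1 | γ x.1 x.2 = p} =
      (fun d => ((d, ⟨0, le_refl _, one_pos⟩) : D × Ico (0:ℝ) 1)) '' {d : D | γ d 0 = p} := by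
    intro hp
    ext ⟨d, s⟩
    constructor
    · intro hx
      have hx : γ d s = p := hx
      rcases hio s with h | h
      · refine ⟨d, by rw [h] at hx; exact hx, ?_⟩
        exact Prod.ext rfl (Subtype.ext h.symm)
      · exact absurd (hx ▸ hp) (S.off d s h)
    · rintro ⟨d', hd', h⟩
      have h1 := congrArg Prod.fst h
      have h2 := congrArg (fun z => (z.2 : ℝ)) h
      simp only at h1 h2
      change γ d s = p
      rw [← h1, ← h2]; exact hd'
  have hnV : p ∉ V → {x : D × Ico (0:ℝ) 1 | γ x.1 x.2 = p}.Subsingleton := by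
    rintro hp ⟨d, s⟩ hx ⟨d', s'⟩ hx'
    have hx : γ d s = p := hx
    have hx' : γ d' s' = p := hx'
    rcases hio s with h | h
    · exact absurd (by rw [← hx, h]; exact S.h0 d) hp
    rcases hio s' with h' | h'
    · exact absurd (by rw [← hx', h']; exact S.h0 d') hp
    obtain ⟨e1, e2⟩ := S.inj d d' s h s' h' (hx.trans hx'.symm)
    exact Prod.ext e1 (Subtype.ext e2)
  refine ⟨?_, ?_, ?_⟩
  · by_cases hp : p ∈ V
    · rw [hV hp]; exact (Set.toFinite _).image _
    · exact (hnV hp).finite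
  · intro hp
    rw [hV hp, Nat.card_image_of_injective, lkOut]
    intro a b h
    exact congrArg Prod.fst h
  · intro hp
    constructor
    · rw [Nat.card_coe_set_eq]
      exact (Set.ncard_le_one (hnV hp).finite).2 fun a ha b hb => hnV hp ha hb
    · have : {d : D | γ d 0 = p} = ∅ := by
        rw [Set.eq_empty_iff_forall_notMem]
        intro d hd
        exact hp ((show γ d 0 = p from hd) ▸ S.h0 d)
      rw [lkOut, this]; simp

end build

theorem lk_build {D : Type} [Finite D] [Nonempty D] {V : Finset Sphere2} {γ : D → ℝ → Sphere2}
    (S : LkSys V γ) (σ : Equiv.Perm D) (hσ : ∀ d, γ d 1 = γ (σ d) 0)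
    (h2 : ∀ v, lkOut γ v ≤ 2) :
    ∃ L : LinkProjection, L.image = (⋃ d, γ d '' Icc 0 1) ∧
      L.crossings = {v | lkOut γ v = 2} := by
  classical
  have : Fintype D := Fintype.ofFinite D
  let Q := Quotient (Equiv.Perm.SameCycle.setoid σ)
  have hfQ : Finite Q := inferInstance
  have : Fintype Q := Fintype.ofFinite Q
  have hne : Nonempty Q := ⟨Quotient.mk _ (Classical.arbitrary D)⟩
  let eQ : Fin (Fintype.card Q) ≃ Q := (Fintype.equivFin Q).symm
  let f : Fin (Fintype.card Q) × Param → Sphere2 := fun x =>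
    (lkRun_periodic γ σ (lkRep σ (eQ x.1))).lift x.2
  have hfc : Continuous f := by
    rw [continuous_prod_of_discrete_left]
    intro i
    have : Continuous fun x => lkRun γ σ (lkRep σ (eQ i)) (MulAction.period σ (lkRep σ (eQ i)) * x) :=
      (lkRun_cont γ σ S.cont hσ _).comp (by fun_prop)
    exact continuous_coinduced_dom.2 this
  let Ψ : Fin (Fintype.card Q) × Param ≃ D × Ico (0:ℝ) 1 :=
    (Equiv.prodCongr eQ (Equiv.refl _)).trans
      (Equiv.ofBijective (lkPhi σ) ⟨lkPhi_inj σ, lkPhi_surj σ⟩)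
  have hfΨ : ∀ x, f x = γ (Ψ x).1 (Ψ x).2 := fun x => lkRun_phi γ σ (eQ x.1) x.2
  have hpre : ∀ p, f ⁻¹' {p} = Ψ ⁻¹' {x : D × Ico (0:ℝ) 1 | γ x.1 x.2 = p} := by
    intro p
    ext x
    change f x = p ↔ γ (Ψ x).1 (Ψ x).2 = p
    rw [hfΨ]
  have hcard : ∀ p, Nat.card (f ⁻¹' {p}) = Nat.card {x : D × Ico (0:ℝ) 1 | γ x.1 x.2 = p} := by
    intro p
    rw [hpre]
    exact Nat.card_preimage_of_injective Ψ.injective (by rw [Ψ.range_eq_univ]; exact subset_univ _)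
  have hcr : {p : Sphere2 | Nat.card (f ⁻¹' {p}) = 2} = {v | lkOut γ v = 2} := by
    ext p
    change Nat.card (f ⁻¹' {p}) = 2 ↔ lkOut γ p = 2
    rw [hcard]
    by_cases hp : p ∈ V
    · rw [(lk_fib S p).2.1 hp]
    · obtain ⟨a, b⟩ := (lk_fib S p).2.2 hp
      constructor <;> intro h <;> omega
  refine ⟨⟨Fintype.card Q, Fintype.card_pos, ⟨f, hfc⟩, ?_, ?_, ?_⟩, ?_, hcr⟩
  · intro p
    change (f ⁻¹' {p}).Finite
    rw [hpre]
    exact (lk_fib S p).1.preimage Ψ.injective.injOn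
  · intro p
    change Nat.card (f ⁻¹' {p}) ≤ 2
    rw [hcard]
    by_cases hp : p ∈ V
    · rw [(lk_fib S p).2.1 hp]; exact h2 p
    · have := ((lk_fib S p).2.2 hp).1
      omega
  · change {p : Sphere2 | Nat.card (f ⁻¹' {p}) = 2}.Finite
    rw [hcr]
    refine V.finite_toSet.subset ?_
    intro p hp
    by_contra hpV
    have h1 := ((lk_fib S p).2.2 hpV).2
    have h2 : lkOut γ p = 2 := hp
    omega
  · change range f = _
    ext p
    constructor
    · rintro ⟨x, rfl⟩
      rw [hfΨ]
      exact mem_iUnion.2 ⟨(Ψ x).1, _, ⟨(Ψ x).2.2.1, (Ψ x).2.2.2.le⟩, rfl⟩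
    · intro hp
      obtain ⟨d, t, ht, rfl⟩ := mem_iUnion.1 hp
      rcases eq_or_lt_of_le ht.2 with h | h
      · refine ⟨Ψ.symm (σ d, ⟨0, le_refl _, one_pos⟩), ?_⟩
        rw [hfΨ, Equiv.apply_symm_apply, h, hσ]
      · refine ⟨Ψ.symm (d, ⟨t, ht.1, h⟩), ?_⟩
        rw [hfΨ, Equiv.apply_symm_apply]


/-! ### The arc system of a connected link projection -/

theorem lk_exists_min {s : Set ℝ} (hf : s.Finite) (hne : s.Nonempty) :
    ∃ a ∈ s, ∀ b ∈ s, a ≤ b := by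
  obtain ⟨a, ha, h⟩ := hf.toFinset.exists_min_image id (by simpa using hne)
  exact ⟨a, by simpa using ha, fun b hb => h b (by simpa using hb)⟩

theorem lk_coe_injOn (a : ℝ) : InjOn (fun x : ℝ => (x : Param)) (Ioc a (a + 1)) := by
  intro x hx y hy h
  have h1 := AddCircle.coe_eq_coe_iff_of_mem_Ico (p := (1:ℝ)) (a := -(a+1)) (x := -x) (y := -y)
    ⟨by linarith [hx.2], by linarith [hx.1]⟩ ⟨by linarith [hy.2], by linarith [hy.1]⟩
  have h' : (x : Param) = y := h
  have h2 : ((-x : ℝ) : Param) = ((-y : ℝ) : Param) := by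
    rw [AddCircle.coe_neg, AddCircle.coe_neg, h']
  have := h1.1 h2
  linarith

theorem lk_off_inj (L : LinkProjection) {x y : Fin L.comps × Param} (h : L.f x = L.f y)
    (hx : L.f x ∉ L.crossings) : x = y := by
  have h1 := L.fibers_le_two (L.f x)
  have h2 : Nat.card (L.f ⁻¹' {L.f x} : Set (Fin L.comps × Param)) ≠ 2 := hx
  have hfin := (L.fibers_finite (L.f x))
  rw [Nat.card_coe_set_eq] at h1 h2
  exact (Set.ncard_le_one hfin).1 (by omega) x rfl y h.symm

theorem lk_P_finite (L : LinkProjection) : (L.f ⁻¹' L.crossings).Finite :=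
  Set.Finite.preimage' L.crossings_finite fun b _ => L.fibers_finite b

theorem lk_comp_hits (L : LinkProjection) (hconn : L.Connected) (hc : L.crossings.Nonempty)
    (i : Fin L.comps) : ∃ t : Param, L.f (i, t) ∈ L.crossings := by
  by_contra hcon
  push Not at hcon
  obtain ⟨p, hp⟩ := hc
  have hpc : Nat.card (L.f ⁻¹' {p} : Set (Fin L.comps × Param)) = 2 := hp
  obtain ⟨⟨j, u⟩, hju⟩ : (L.f ⁻¹' {p} : Set (Fin L.comps × Param)).Nonempty := by
    rw [Set.nonempty_iff_ne_empty]
    intro h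
    rw [h] at hpc
    simp at hpc
  have hju : L.f (j, u) = p := hju
  have hji : j ≠ i := by
    rintro rfl
    exact hcon u (hju ▸ hp)
  let A := L.f '' (({i} : Set (Fin L.comps)) ×ˢ univ)
  let B := L.f '' (({i}ᶜ : Set (Fin L.comps)) ×ˢ univ)
  have hA : IsClosed A := ((isClosed_discrete {i}).prod isClosed_univ).isCompact.image
    L.f.continuous |>.isClosed
  have hB : IsClosed B := ((isClosed_discrete ({i}ᶜ : Set (Fin L.comps))).prod
    isClosed_univ).isCompact.image L.f.continuous |>.isClosed
  have hpre := hconn.isPreconnected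
  rw [isPreconnected_closed_iff] at hpre
  have hcov : L.image ⊆ A ∪ B := by
    rintro x ⟨⟨a, b⟩, rfl⟩
    by_cases h : a = i
    · exact Or.inl ⟨(a, b), ⟨h, trivial⟩, rfl⟩
    · exact Or.inr ⟨(a, b), ⟨h, trivial⟩, rfl⟩
  obtain ⟨x, -, ⟨⟨a, b⟩, ⟨hab, -⟩, rfl⟩, ⟨c, d⟩, ⟨hcd, -⟩, hx⟩ := hpre A B hA hB hcov
    ⟨L.f (i, 0), ⟨_, rfl⟩, (i, 0), ⟨rfl, trivial⟩, rfl⟩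
    ⟨L.f (j, u), ⟨_, rfl⟩, (j, u), ⟨hji, trivial⟩, rfl⟩
  have hab : a = i := hab
  have hcd : c ≠ i := hcd
  subst hab
  have := lk_off_inj L hx.symm (hcon b)
  exact hcd (congrArg Prod.fst this).symm

theorem lk_arcs (L : LinkProjection) (hconn : L.Connected) (hc : L.crossings.Nonempty) :
    ∃ (E : Type) (_ : Fintype E) (V : Finset Sphere2) (γ : E → ℝ → Sphere2),
      (V : Set Sphere2) = L.crossings ∧ LkSys V γ ∧ L.image = (⋃ e, γ e '' Icc 0 1) ∧
      (∀ v ∈ V, Nat.card {e | γ e 0 = v} = 2) ∧ (∀ v ∈ V, Nat.card {e | γ e 1 = v} = 2) := by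
  classical
  let P : Set (Fin L.comps × Param) := L.f ⁻¹' L.crossings
  have hPf : P.Finite := lk_P_finite L
  have hT : ∀ p : P, ∃ τ ∈ {τ : ℝ | τ ∈ Ioc (0:ℝ) 1 ∧ (p.1.1, p.1.2 + (τ : Param)) ∈ P},
      ∀ b ∈ {τ : ℝ | τ ∈ Ioc (0:ℝ) 1 ∧ (p.1.1, p.1.2 + (τ : Param)) ∈ P}, τ ≤ b := by
    rintro ⟨⟨i, t⟩, hp⟩
    apply lk_exists_min
    · have : InjOn (fun τ : ℝ => (i, t + (τ : Param))) (Ioc (0:ℝ) 1) := by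
        intro x hx y hy h
        have h1 : t + (x : Param) = t + (y : Param) := congrArg Prod.snd h
        exact lk_coe_injOn 0 (by simpa using hx) (by simpa using hy) (add_left_cancel h1)
      refine Set.Finite.of_finite_image (f := fun τ : ℝ => (i, t + (τ : Param))) (hPf.subset ?_)
        (this.mono fun x hx => hx.1)
      rintro _ ⟨x, hx, rfl⟩
      exact hx.2
    · refine ⟨1, ⟨one_pos, le_rfl⟩, ?_⟩
      rw [AddCircle.coe_period, add_zero]
      exact hp
  choose τ hτ hmin using hT
  have hτ0 : ∀ p, 0 < τ p := fun p => (hτ p).1.1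
  have hτ1 : ∀ p, τ p ≤ 1 := fun p => (hτ p).1.2
  let nxt : P → P := fun p => ⟨_, (hτ p).2⟩
  -- key fact
  have key : ∀ (p p' : P) (a b : ℝ), p.1.1 = p'.1.1 → p.1.2 + (a : Param) = p'.1.2 + (b : Param) →
      0 ≤ a → a ≤ b → b - a < τ p' → p = p' ∧ a = b := by
    rintro ⟨⟨i, t⟩, hp⟩ ⟨⟨i', t'⟩, hp'⟩ a b hi h ha hab hb
    simp only at hi h
    subst hi
    have ht : t = t' + ((b - a : ℝ) : Param) := by
      rw [AddCircle.coe_sub, ← add_sub_assoc, ← h]; abel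
    have hab' : a = b := by
      by_contra hne
      have hlt : a < b := lt_of_le_of_ne hab hne
      have := hmin ⟨(i, t'), hp'⟩ (b - a) ⟨⟨by linarith, by linarith [hτ1 ⟨(i, t'), hp'⟩]⟩, by
        simp only
        rw [← ht]; exact hp⟩
      linarith
    subst hab'
    refine ⟨?_, rfl⟩
    apply Subtype.ext
    exact Prod.ext rfl (by simpa using ht)
  have hnxt : Function.Injective nxt := by
    intro p p' h
    have h1 : p.1.1 = p'.1.1 := congrArg (fun z => z.1.1) h
    have h2 : p.1.2 + (τ p : Param) = p'.1.2 + (τ p' : Param) := congrArg (fun z => z.1.2) h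
    rcases le_total (τ p) (τ p') with hle | hle
    · exact (key p p' _ _ h1 h2 (hτ0 p).le hle (by linarith [hτ0 p])).1
    · exact (key p' p _ _ h1.symm h2.symm (hτ0 p').le hle (by linarith [hτ0 p'])).1.symm
  have : Finite P := hPf
  let γ : P → ℝ → Sphere2 := fun p s => L.f (p.1.1, p.1.2 + ((s * τ p : ℝ) : Param))
  have hγ0 : ∀ p : P, γ p 0 = L.f p.1 := by
    intro p
    simp only [γ]
    rw [zero_mul, AddCircle.coe_zero, add_zero]
  have hγ1 : ∀ p : P, γ p 1 = L.f (nxt p).1 := by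
    intro p
    simp only [γ, nxt]
    rw [one_mul]
  have hVc : ∀ x, x ∈ L.crossings_finite.toFinset ↔ x ∈ L.crossings := fun x =>
    L.crossings_finite.mem_toFinset
  have hoff : ∀ e, ∀ t ∈ Ioo (0:ℝ) 1, γ e t ∉ L.crossings := by
    intro p s hs hcr
    have h0 : 0 < s * τ p := mul_pos hs.1 (hτ0 p)
    have h1 : s * τ p < τ p := by nlinarith [hs.2, hτ0 p]
    have := hmin p (s * τ p) ⟨⟨h0, by linarith [hτ1 p]⟩, hcr⟩
    linarith
  have hcard : ∀ v ∈ L.crossings, Nat.card {e : P | L.f e.1 = v} = 2 := by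
    intro v hv
    have hv2 : Nat.card (L.f ⁻¹' {v} : Set (Fin L.comps × Param)) = 2 := hv
    rw [← hv2]
    refine Nat.card_congr ⟨fun e => ⟨e.1.1, e.2⟩, fun x => ⟨⟨x.1, ?_⟩, x.2⟩, fun _ => rfl, fun _ => rfl⟩
    have hx2 : L.f x.1 = v := x.2
    change L.f x.1 ∈ L.crossings
    rw [hx2]; exact hv
  refine ⟨P, Fintype.ofFinite P, L.crossings_finite.toFinset, γ, ?_, ⟨?_, ?_, ?_, ?_, ?_⟩, ?_, ?_, ?_⟩
  · exact L.crossings_finite.coe_toFinset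
  · intro p
    have hcc : Continuous fun s : ℝ => ((s * τ p : ℝ) : Param) :=
      (AddCircle.continuous_mk' (1:ℝ)).comp (by fun_prop)
    exact L.f.continuous.comp (by fun_prop)
  · intro p; rw [hγ0, hVc]; exact p.2
  · intro p; rw [hγ1, hVc]; exact (nxt p).2
  · intro p s hs
    rw [hVc]
    exact hoff p s hs
  · intro p p' s hs s' hs' h
    have h1 := lk_off_inj L h (hoff p s hs)
    have hi : p.1.1 = p'.1.1 := (Prod.ext_iff.1 h1).1
    have ht : p.1.2 + ((s * τ p : ℝ) : Param) = p'.1.2 + ((s' * τ p' : ℝ) : Param) :=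
      (Prod.ext_iff.1 h1).2
    have b1 : 0 < s * τ p := mul_pos hs.1 (hτ0 p)
    have b2 : s * τ p < τ p := by nlinarith [hs.2, hτ0 p]
    have b1' : 0 < s' * τ p' := mul_pos hs'.1 (hτ0 p')
    have b2' : s' * τ p' < τ p' := by nlinarith [hs'.2, hτ0 p']
    have : p = p' ∧ s * τ p = s' * τ p' := by
      rcases le_total (s * τ p) (s' * τ p') with hle | hle
      · exact key p p' _ _ hi ht b1.le hle (by linarith)
      · obtain ⟨a, b⟩ := key p' p _ _ hi.symm ht.symm b1'.le hle (by linarith)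
        exact ⟨a.symm, b.symm⟩
    obtain ⟨rfl, h3⟩ := this
    exact ⟨rfl, mul_right_cancel₀ (hτ0 p).ne' h3⟩
  · apply Subset.antisymm
    · rintro _ ⟨⟨i, u⟩, rfl⟩
      obtain ⟨t0, ht0⟩ := lk_comp_hits L hconn hc i
      obtain ⟨a, ⟨ha, haP⟩, hamin⟩ : ∃ a ∈ {a : ℝ | a ∈ Ioc (0:ℝ) 1 ∧ (i, u - (a : Param)) ∈ P},
          ∀ b ∈ {a : ℝ | a ∈ Ioc (0:ℝ) 1 ∧ (i, u - (a : Param)) ∈ P}, a ≤ b := by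
        apply lk_exists_min
        · have : InjOn (fun τ : ℝ => (i, u - (τ : Param))) (Ioc (0:ℝ) 1) := by
            intro x hx y hy h
            have h1 : u - (x : Param) = u - (y : Param) := congrArg Prod.snd h
            exact lk_coe_injOn 0 (by simpa using hx) (by simpa using hy) (sub_right_injective h1)
          refine Set.Finite.of_finite_image (f := fun τ : ℝ => (i, u - (τ : Param))) (hPf.subset ?_)
            (this.mono fun x hx => hx.1)
          rintro _ ⟨x, hx, rfl⟩
          exact hx.2
        · have h1 := (AddCircle.equivIoc (1:ℝ) 0 (u - t0)).2
          have h2 : ((AddCircle.equivIoc (1:ℝ) 0 (u - t0) : ℝ) : Param) = u - t0 :=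
            (AddCircle.equivIoc (1:ℝ) 0).symm_apply_apply (u - t0)
          refine ⟨(AddCircle.equivIoc (1:ℝ) 0 (u - t0) : ℝ), ⟨h1.1, by have := h1.2; linarith⟩, ?_⟩
          rw [h2]
          have : u - (u - t0) = t0 := by abel
          rw [this]; exact ht0
      let p : P := ⟨_, haP⟩
      have hle : a ≤ τ p := by
        by_contra hlt
        push Not at hlt
        have h3 := (hτ p).2
        have := hamin (a - τ p) ⟨⟨by linarith, by linarith [ha.2, hτ0 p]⟩, by
          convert h3 using 2
          rw [AddCircle.coe_sub]
          simp only [p]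
          abel⟩
        linarith [hτ0 p]
      refine mem_iUnion.2 ⟨p, a / τ p, ⟨div_nonneg ha.1.le (hτ0 p).le, (div_le_one (hτ0 p)).2 hle⟩, ?_⟩
      simp only [γ]
      rw [div_mul_cancel₀ _ (hτ0 p).ne']
      simp [p]
    · intro x hx
      obtain ⟨p, s, -, rfl⟩ := mem_iUnion.1 hx
      exact ⟨_, rfl⟩
  · intro v hv
    simp only [hγ0]
    exact hcard v ((hVc v).1 hv)
  · intro v hv
    simp only [hγ1]
    rw [← hcard v ((hVc v).1 hv)]
    let e : P ≃ P := Equiv.ofBijective nxt (Finite.injective_iff_bijective.1 hnxt)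
    exact Nat.card_preimage_of_injective (f := nxt) (s := {e : P | L.f e.1 = v}) hnxt
      (fun x _ => e.surjective x)


/-! ### Connectivity of arc systems -/

theorem lk_conn_cut {Z : Type*} [TopologicalSpace Z] [T2Space Z] {D : Type} [Finite D]
    {V : Finset Z} {γ : D → ℝ → Z} (S : LkSys V γ)
    (hst : ∀ v ∈ V, ∃ d, γ d 0 = v) (hc : IsPreconnected (⋃ d, γ d '' Icc 0 1))
    (A : Finset Z) (hA : A ⊆ V) (hne : A.Nonempty) (hAV : A ≠ V) :
    ∃ d, ¬ (γ d 0 ∈ A ↔ γ d 1 ∈ A) := by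
  by_contra hcon
  push Not at hcon
  have hcl : ∀ p : D → Prop, IsClosed (⋃ d ∈ {d | p d}, γ d '' Icc 0 1) := fun p =>
    (Set.toFinite {d | p d}).isClosed_biUnion fun d _ =>
      (isCompact_Icc.image (S.cont d)).isClosed
  rw [isPreconnected_closed_iff] at hc
  have hcov : (⋃ d, γ d '' Icc 0 1) ⊆ (⋃ d ∈ {d | γ d 0 ∈ A}, γ d '' Icc 0 1) ∪
      (⋃ d ∈ {d | γ d 0 ∉ A}, γ d '' Icc 0 1) := by
    intro x hx
    obtain ⟨d, hd⟩ := mem_iUnion.1 hx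
    by_cases h : γ d 0 ∈ A
    · exact Or.inl (mem_biUnion (show d ∈ {d | γ d 0 ∈ A} from h) hd)
    · exact Or.inr (mem_biUnion (show d ∈ {d | γ d 0 ∉ A} from h) hd)
  have hz : (0:ℝ) ∈ Icc (0:ℝ) 1 := ⟨le_rfl, zero_le_one⟩
  obtain ⟨v, hv⟩ := hne
  obtain ⟨w, hwV, hwA⟩ : ∃ w ∈ V, w ∉ A := by
    by_contra h
    push Not at h
    exact hAV (Finset.Subset.antisymm hA h)
  obtain ⟨d1, hd1⟩ := hst v (hA hv)
  obtain ⟨d2, hd2⟩ := hst w hwV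
  obtain ⟨x, -, hx1, hx2⟩ := hc _ _ (hcl _) (hcl _) hcov
    ⟨v, mem_iUnion.2 ⟨d1, 0, hz, hd1⟩,
      mem_biUnion (show d1 ∈ {d | γ d 0 ∈ A} by change γ d1 0 ∈ A; rwa [hd1]) ⟨0, hz, hd1⟩⟩
    ⟨w, mem_iUnion.2 ⟨d2, 0, hz, hd2⟩,
      mem_biUnion (show d2 ∈ {d | γ d 0 ∉ A} by change γ d2 0 ∉ A; rwa [hd2]) ⟨0, hz, hd2⟩⟩
  simp only [mem_iUnion] at hx1 hx2
  obtain ⟨e, he, t, ht, rfl⟩ := hx1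
  obtain ⟨e', he', t', ht', hx⟩ := hx2
  have he : γ e 0 ∈ A := he
  have he' : γ e' 0 ∉ A := he'
  have h1 := (hcon e).1 he
  have h1' : γ e' 1 ∉ A := fun h => he' ((hcon e').2 h)
  rcases lk_Icc_cases ht with rfl | rfl | ht
  · rcases lk_Icc_cases ht' with rfl | rfl | ht'
    · exact he' (hx ▸ he)
    · exact h1' (hx ▸ he)
    · exact S.off _ _ ht' (hx ▸ S.h0 e)
  · rcases lk_Icc_cases ht' with rfl | rfl | ht'
    · exact he' (hx ▸ h1)
    · exact h1' (hx ▸ h1)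
    · exact S.off _ _ ht' (hx ▸ S.h1 e)
  · rcases lk_Icc_cases ht' with rfl | rfl | ht'
    · exact S.off _ _ ht (hx ▸ S.h0 e')
    · exact S.off _ _ ht (hx ▸ S.h1 e')
    · obtain ⟨h, -⟩ := S.inj _ _ _ ht' _ ht hx
      exact he' (h ▸ he)

theorem lk_cut_conn {Z : Type*} [TopologicalSpace Z] {D : Type}
    {V : Finset Z} {γ : D → ℝ → Z} (S : LkSys V γ)
    (hcut : ∀ A ⊆ V, A.Nonempty → A ≠ V → ∃ d, ¬ (γ d 0 ∈ A ↔ γ d 1 ∈ A)) :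
    IsPreconnected (⋃ d, γ d '' Icc 0 1) := by
  classical
  have hz : (0:ℝ) ∈ Icc (0:ℝ) 1 := ⟨le_rfl, zero_le_one⟩
  have ho : (1:ℝ) ∈ Icc (0:ℝ) 1 := ⟨zero_le_one, le_rfl⟩
  refine IsPreconnected.iUnion_of_reflTransGen
    (fun d => isPreconnected_Icc.image _ (S.cont d).continuousOn) ?_
  intro e0 e1
  set rel : D → D → Prop := fun i j => (γ i '' Icc 0 1 ∩ γ j '' Icc 0 1).Nonempty
  let A : Finset Z := V.filter fun v => ∃ e, Relation.ReflTransGen rel e0 e ∧ v ∈ γ e '' Icc 0 1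
  have hmem : ∀ v, v ∈ A ↔ v ∈ V ∧ ∃ e, Relation.ReflTransGen rel e0 e ∧ v ∈ γ e '' Icc 0 1 := by
    intro v; simp only [A, Finset.mem_filter]
  have hstep : ∀ v ∈ A, ∀ e, v ∈ γ e '' Icc 0 1 → Relation.ReflTransGen rel e0 e := by
    intro v hv e hve
    obtain ⟨-, e', he', hve'⟩ := (hmem v).1 hv
    exact he'.tail ⟨v, hve', hve⟩
  have hAV : A = V := by
    by_contra hne
    obtain ⟨d, hd⟩ := hcut A (Finset.filter_subset _ _)
      ⟨γ e0 0, (hmem _).2 ⟨S.h0 e0, e0, .refl, 0, hz, rfl⟩⟩ hne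
    apply hd
    constructor
    · intro h
      exact (hmem _).2 ⟨S.h1 d, d, hstep _ h d ⟨0, hz, rfl⟩, 1, ho, rfl⟩
    · intro h
      exact (hmem _).2 ⟨S.h0 d, d, hstep _ h d ⟨1, ho, rfl⟩, 0, hz, rfl⟩
  exact hstep (γ e1 0) (hAV ▸ S.h0 e1) e1 ⟨0, hz, rfl⟩

/-! ### Stereographic projection -/

theorem lk_stereo (N : Sphere2) : ∃ (φ : Sphere2 → ℂ) (ψ : ℂ → Sphere2),
    ContinuousOn φ {N}ᶜ ∧ Continuous ψ ∧ (∀ z, ψ z ≠ N) ∧ (∀ x, x ≠ N → ψ (φ x) = x) ∧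
    ∀ z, φ (ψ z) = z := by
  have : Fact (Module.finrank ℝ (EuclideanSpace ℝ (Fin 3)) = 2 + 1) := ⟨by simp⟩
  let s := stereographic' 2 N
  let r := Complex.orthonormalBasisOneI.repr
  have hs : s.source = {N}ᶜ := stereographic'_source N
  have ht : s.target = univ := stereographic'_target N
  refine ⟨fun x => r.symm (s x), fun z => s.symm (r z), ?_, ?_, ?_, ?_, ?_⟩
  · rw [← hs]
    exact r.symm.continuous.comp_continuousOn s.continuousOn
  · have := s.continuousOn_symm
    rw [ht] at this
    exact (continuousOn_univ.1 this).comp r.continuous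
  · intro z h
    have := s.map_target (x := r z) (by rw [ht]; trivial)
    rw [hs] at this
    exact this h
  · intro x hx
    simp only [LinearIsometryEquiv.apply_symm_apply]
    exact s.left_inv (by rw [hs]; exact hx)
  · intro z
    simp only
    rw [s.right_inv (by rw [ht]; trivial)]
    simp

/-! ### Arcs have empty interior -/

theorem lk_arc_interior {γ : ℝ → Sphere2} {u v : ℝ} (hγ : ContinuousOn γ (Icc u v))
    (hi : InjOn γ (Icc u v)) : interior (γ '' Icc u v) = ∅ := by
  by_contra hne
  obtain ⟨x, hx⟩ := Set.nonempty_iff_ne_empty.2 hne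
  have hxN : x ≠ -x := by
    intro h
    have h1 : (x : EuclideanSpace ℝ (Fin 3)) = -x := congrArg Subtype.val h
    have h2 : ‖(x : EuclideanSpace ℝ (Fin 3))‖ = 1 := by simp
    have h3 : (x : EuclideanSpace ℝ (Fin 3)) = 0 := by
      ext i
      have := congrArg (fun z => z i) h1
      simp at this
      simp
      linarith
    rw [h3] at h2
    simp at h2
  obtain ⟨φ, ψ, hφ, hψ, hψN, h1, h2⟩ := lk_stereo (-x)
  have hop : IsOpen (ψ ⁻¹' interior (γ '' Icc u v)) := isOpen_interior.preimage hψ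
  have hmem : φ x ∈ ψ ⁻¹' interior (γ '' Icc u v) := by
    rw [mem_preimage]
    rw [h1 x hxN]; exact hx
  obtain ⟨ε, hε, hball⟩ := Metric.isOpen_iff.1 hop _ hmem
  let c : ℝ → ℂ := fun θ => circleMap (φ x) (ε / 2) θ
  have hc : Continuous c := continuous_circleMap _ _
  have hcmem : ∀ θ, ψ (c θ) ∈ γ '' Icc u v := by
    intro θ
    have : c θ ∈ Metric.ball (φ x) ε := by
      have := circleMap_mem_sphere (φ x) (half_pos hε).le θ
      rw [Metric.mem_sphere] at this
      rw [Metric.mem_ball, this]; linarith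
    exact interior_subset (hball this)
  let g : γ '' Icc u v → ℝ := fun y => (Classical.choose y.2)
  have hg : ∀ y, g y ∈ Icc u v ∧ γ (g y) = y := fun y => Classical.choose_spec y.2
  have hgc : Continuous g := by
    have hcomp : IsCompact (Icc u v) := isCompact_Icc
    rw [continuous_iff_isClosed]
    intro F hF
    have : g ⁻¹' F = Subtype.val ⁻¹' (γ '' (Icc u v ∩ F)) := by
      ext y
      constructor
      · intro hy
        exact ⟨g y, ⟨(hg y).1, hy⟩, (hg y).2⟩
      · rintro ⟨t, ⟨ht, htF⟩, hty⟩
        have : g y = t := hi (hg y).1 ht ((hg y).2.trans hty.symm)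
        change g y ∈ F
        rwa [this]
    rw [this]
    exact (((hcomp.inter_right hF).image_of_continuousOn
      (hγ.mono inter_subset_left)).isClosed).preimage continuous_subtype_val
  let h : ℝ → ℝ := fun θ => g ⟨ψ (c θ), hcmem θ⟩
  have hh : Continuous h := hgc.comp ((hψ.comp hc).subtype_mk _)
  have hper : ∀ θ, h (θ + 2 * Real.pi) = h θ := by
    intro θ
    simp only [h, c]
    congr 2
    rw [periodic_circleMap]
  have hinj : ∀ θ θ', h θ = h θ' → c θ = c θ' := by
    intro θ θ' he
    have e1 := (hg ⟨ψ (c θ), hcmem θ⟩).2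
    have e2 := (hg ⟨ψ (c θ'), hcmem θ'⟩).2
    have he' : g ⟨ψ (c θ), hcmem θ⟩ = g ⟨ψ (c θ'), hcmem θ'⟩ := he
    rw [he'] at e1
    have e3 : ψ (c θ) = ψ (c θ') := e1.symm.trans e2
    rw [← h2 (c θ), e3, h2]
  obtain ⟨θ, hθ⟩ : ∃ θ, h θ - h (θ + Real.pi) = 0 := by
    have hk : Continuous fun θ => h θ - h (θ + Real.pi) := by fun_prop
    have hneg : h Real.pi - h (Real.pi + Real.pi) = -(h 0 - h (0 + Real.pi)) := by
      have := hper 0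
      rw [zero_add] at this ⊢
      rw [← two_mul, this]; ring
    rcases le_total 0 (h 0 - h (0 + Real.pi)) with hs | hs
    · obtain ⟨θ, hθ⟩ := mem_range_of_exists_le_of_exists_ge hk (c := 0)
        ⟨Real.pi, by rw [hneg]; linarith⟩ ⟨0, hs⟩
      exact ⟨θ, hθ⟩
    · obtain ⟨θ, hθ⟩ := mem_range_of_exists_le_of_exists_ge hk (c := 0)
        ⟨0, hs⟩ ⟨Real.pi, by rw [hneg]; linarith⟩
      exact ⟨θ, hθ⟩
  have := hinj _ _ (sub_eq_zero.1 hθ)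
  simp only [c, circleMap, add_right_inj] at this
  push_cast at this
  rw [add_mul, Complex.exp_add, Complex.exp_pi_mul_I] at this
  have hE := Complex.exp_ne_zero (θ * Complex.I)
  have hε' : ((ε:ℂ) / 2) ≠ 0 := by
    rw [div_ne_zero_iff]; exact ⟨by exact_mod_cast hε.ne', two_ne_zero⟩
  have h5 := mul_left_cancel₀ hε' this
  apply hE
  have : (2:ℂ) * Complex.exp (θ * Complex.I) = 0 := by linear_combination h5
  simp at this

theorem lk_interior_union {Z : Type*} [TopologicalSpace Z] {ι : Type*} (F : ι → Set Z)
    (hF : ∀ i, IsClosed (F i)) (hi : ∀ i, interior (F i) = ∅) (s : Finset ι) :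
    interior (⋃ i ∈ s, F i) = ∅ := by
  classical
  induction s using Finset.induction_on with
  | empty => simp
  | insert a s ha ih =>
    rw [Finset.set_biUnion_insert, interior_union_isClosed_of_interior_empty (hF a) ih, hi]

theorem lk_sys_interior {D : Type} [Finite D] {V : Finset Sphere2} {γ : D → ℝ → Sphere2}
    (S : LkSys V γ) : interior (⋃ d, γ d '' Icc 0 1) = ∅ := by
  classical
  have : Fintype D := Fintype.ofFinite D
  let F : D × Bool → Set Sphere2 := fun x =>
    if x.2 then γ x.1 '' Icc 0 (1/2) else γ x.1 '' Icc (1/2) 1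
  have hinj1 : ∀ d, InjOn (γ d) (Icc 0 (1/2)) := by
    intro d t ht t' ht' h
    rcases eq_or_lt_of_le ht.1 with h0 | h0 <;> rcases eq_or_lt_of_le ht'.1 with h0' | h0'
    · rw [← h0, ← h0']
    · exact absurd (by rw [← h, ← h0]; exact S.h0 d) (S.off d t' ⟨h0', by linarith [ht'.2]⟩)
    · exact absurd (by rw [h, ← h0']; exact S.h0 d) (S.off d t ⟨h0, by linarith [ht.2]⟩)
    · exact (S.inj d d t ⟨h0, by linarith [ht.2]⟩ t' ⟨h0', by linarith [ht'.2]⟩ h).2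
  have hinj2 : ∀ d, InjOn (γ d) (Icc (1/2) 1) := by
    intro d t ht t' ht' h
    rcases eq_or_lt_of_le ht.2 with h0 | h0 <;> rcases eq_or_lt_of_le ht'.2 with h0' | h0'
    · rw [h0, h0']
    · exact absurd (by rw [← h, h0]; exact S.h1 d) (S.off d t' ⟨by linarith [ht'.1], h0'⟩)
    · exact absurd (by rw [h, h0']; exact S.h1 d) (S.off d t ⟨by linarith [ht.1], h0⟩)
    · exact (S.inj d d t ⟨by linarith [ht.1], h0⟩ t' ⟨by linarith [ht'.1], h0'⟩ h).2
  have hU : (⋃ d, γ d '' Icc 0 1) = ⋃ x ∈ (Finset.univ : Finset (D × Bool)), F x := by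
    ext y
    simp only [mem_iUnion, Finset.mem_univ, exists_true_left]
    constructor
    · rintro ⟨d, t, ht, rfl⟩
      rcases le_total t (1/2) with h | h
      · exact ⟨(d, true), t, ⟨ht.1, h⟩, rfl⟩
      · exact ⟨(d, false), t, ⟨h, ht.2⟩, rfl⟩
    · rintro ⟨⟨d, b⟩, hy⟩
      cases b
      · obtain ⟨t, ht, rfl⟩ := hy
        exact ⟨d, t, ⟨by linarith [ht.1], ht.2⟩, rfl⟩
      · obtain ⟨t, ht, rfl⟩ := hy
        exact ⟨d, t, ⟨ht.1, by linarith [ht.2]⟩, rfl⟩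
  rw [hU]
  apply lk_interior_union
  · rintro ⟨d, b⟩
    cases b
    · exact (isCompact_Icc.image (S.cont d)).isClosed
    · exact (isCompact_Icc.image (S.cont d)).isClosed
  · rintro ⟨d, b⟩
    cases b
    · exact lk_arc_interior (S.cont d).continuousOn (hinj2 d)
    · exact lk_arc_interior (S.cont d).continuousOn (hinj1 d)


/-! ### The planar bound on the sphere -/

theorem lk_plan_sphere {E : Type} [Fintype E] [Nonempty E] {V : Finset Sphere2}
    {γ : E → ℝ → Sphere2} (S : LkSys V γ) (N : Sphere2) (hNV : N ∉ V)
    (hN : ∀ e, ∀ t ∈ Icc (0:ℝ) 1, γ e t ≠ N)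
    (hloop : ∀ e, γ e 0 ≠ γ e 1) (hpar : Function.Injective fun e => s(γ e 0, γ e 1))
    (htri : ∀ e1 e2 e3 x y z, s(γ e1 0, γ e1 1) = s(x,y) → s(γ e2 0, γ e2 1) = s(y,z) →
      s(γ e3 0, γ e3 1) = s(z,x) → False)
    (hcount : 2 * V.card ≤ Fintype.card E + 1) : False := by
  classical
  obtain ⟨φ, ψ, hφ, hψ, hψN, h1, h2⟩ := lk_stereo N
  have hinj : ∀ x y, x ≠ N → y ≠ N → φ x = φ y → x = y := by
    intro x y hx hy h
    rw [← h1 x hx, h, h1 y hy]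
  have hVN : ∀ v ∈ V, v ≠ N := fun v hv h => hNV (h ▸ hv)
  let γ' : E → ℝ → ℂ := fun e t => φ (γ e (lkClamp t))
  have hγ' : ∀ e t, t ∈ Icc (0:ℝ) 1 → γ' e t = φ (γ e t) := by
    intro e t ht
    simp only [γ', lkClamp_eq ht]
  have hz : (0:ℝ) ∈ Icc (0:ℝ) 1 := ⟨le_rfl, zero_le_one⟩
  have ho : (1:ℝ) ∈ Icc (0:ℝ) 1 := ⟨zero_le_one, le_rfl⟩
  have hs : ∀ e, γ' e 0 = φ (γ e 0) := fun e => hγ' e 0 hz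
  have ht : ∀ e, γ' e 1 = φ (γ e 1) := fun e => hγ' e 1 ho
  have S' : LkSys (V.image φ) γ' := by
    refine ⟨?_, ?_, ?_, ?_, ?_⟩
    · intro e
      exact hφ.comp_continuous ((S.cont e).comp lkClamp_cont) fun t => hN e _ (lkClamp_mem t)
    · intro e; rw [hs]; exact Finset.mem_image_of_mem _ (S.h0 e)
    · intro e; rw [ht]; exact Finset.mem_image_of_mem _ (S.h1 e)
    · intro e t htt hmem
      rw [hγ' e t (Ioo_subset_Icc_self htt)] at hmem
      obtain ⟨v, hv, hvt⟩ := Finset.mem_image.1 hmem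
      have := hinj _ _ (hVN v hv) (hN e t (Ioo_subset_Icc_self htt)) hvt
      exact S.off e t htt (this ▸ hv)
    · intro e e' t htt t' htt' h
      rw [hγ' e t (Ioo_subset_Icc_self htt), hγ' e' t' (Ioo_subset_Icc_self htt')] at h
      exact S.inj e e' t htt t' htt' (hinj _ _ (hN e t (Ioo_subset_Icc_self htt))
        (hN e' t' (Ioo_subset_Icc_self htt')) h)
  have hsψ : ∀ e, ψ (γ' e 0) = γ e 0 := fun e => by rw [hs, h1 _ (hN e 0 hz)]
  have htψ : ∀ e, ψ (γ' e 1) = γ e 1 := fun e => by rw [ht, h1 _ (hN e 1 ho)]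
  have hmap : ∀ e x y, s(γ' e 0, γ' e 1) = s(x, y) → s(γ e 0, γ e 1) = s(ψ x, ψ y) := by
    intro e x y h
    have := congrArg (Sym2.map ψ) h
    simpa [Sym2.map_mk, hsψ, htψ] using this
  refine S'.planar ?_ ?_ ?_ ?_
  · intro e h
    apply hloop e
    rw [← hsψ, ← htψ, h]
  · intro e e' h
    apply hpar
    have := hmap e _ _ h
    rw [hsψ, htψ] at this
    exact this
  · intro e1 e2 e3 x y z a b c
    exact htri e1 e2 e3 _ _ _ (hmap _ _ _ a) (hmap _ _ _ b) (hmap _ _ _ c)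
  · refine le_trans ?_ hcount
    exact Nat.mul_le_mul_left 2 Finset.card_image_le

theorem lk_hplan {E : Type} [Fintype E] [DecidableEq E] [DecidableEq Sphere2] {V : Finset Sphere2}
    {γ : E → ℝ → Sphere2} (S : LkSys V γ) (N : Sphere2) (hNV : N ∉ V)
    (hN : ∀ e, ∀ t ∈ Icc (0:ℝ) 1, γ e t ≠ N) (src tgt : E → Sphere2)
    (hsrc : ∀ e, src e = γ e 0) (htgt : ∀ e, tgt e = γ e 1) (A : Finset Sphere2) (hA : A ⊆ V)
    (hne : (lkIns src tgt A).Nonempty) (hcard : 2 * A.card ≤ (lkIns src tgt A).card + 1) :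
      (∃ e ∈ lkIns src tgt A, src e = tgt e) ∨
      (∃ e ∈ lkIns src tgt A, ∃ e' ∈ lkIns src tgt A, e ≠ e' ∧
        s(src e, tgt e) = s(src e', tgt e')) ∨
      (∃ e1 ∈ lkIns src tgt A, ∃ e2 ∈ lkIns src tgt A, ∃ e3 ∈ lkIns src tgt A, ∃ x y z,
        s(src e1, tgt e1) = s(x, y) ∧ s(src e2, tgt e2) = s(y, z) ∧
        s(src e3, tgt e3) = s(z, x)) := by
  by_contra hcon
  push Not at hcon
  obtain ⟨c1, c2, c3⟩ := hcon
  have : Nonempty {e // e ∈ lkIns src tgt A} := hne.to_subtype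
  have hins : ∀ e : {e // e ∈ lkIns src tgt A}, γ e.1 0 ∈ A ∧ γ e.1 1 ∈ A := by
    rintro ⟨e, he⟩
    simp only [lkIns, Finset.mem_filter, Finset.mem_univ, true_and, hsrc, htgt] at he
    exact he
  have S' : LkSys A fun e : {e // e ∈ lkIns src tgt A} => γ e.1 :=
    ⟨fun e => S.cont _, fun e => (hins e).1, fun e => (hins e).2,
      fun e t ht h => S.off _ t ht (hA h),
      fun e e' t ht t' ht' h => by
        obtain ⟨a, b⟩ := S.inj _ _ t ht t' ht' h
        exact ⟨Subtype.ext a, b⟩⟩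
  refine lk_plan_sphere S' N (fun h => hNV (hA h)) (fun e => hN _) ?_ ?_ ?_ ?_
  · intro e; simpa [hsrc, htgt] using c1 e.1 e.2
  · intro e e' h
    by_contra hne
    refine c2 e.1 e.2 e'.1 e'.2 (fun h => hne (Subtype.ext h)) ?_
    simpa only [hsrc, htgt] using h
  · intro e1 e2 e3 x y z a b c
    refine c3 e1.1 e1.2 e2.1 e2.2 e3.1 e3.2 x y z ?_ ?_ ?_
    · simpa only [hsrc, htgt] using a
    · simpa only [hsrc, htgt] using b
    · simpa only [hsrc, htgt] using c
  · rw [Fintype.card_coe]; exact hcard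

/-! ### The reduction step -/

theorem lk_step (L : LinkProjection) (hconn : L.Connected) (hc : 4 ≤ L.crossingNumber) :
    ∃ H : LinkProjection, H.Connected ∧ H.image ⊆ L.image ∧
      ∃ k, 1 ≤ k ∧ k ≤ 3 ∧ H.crossingNumber + k = L.crossingNumber := by
  classical
  have hcne : L.crossings.Nonempty := by
    rw [Set.nonempty_iff_ne_empty]
    intro h
    rw [LinkProjection.crossingNumber, h] at hc
    simp at hc
  obtain ⟨E, hE, V, γ, hV, S, him, hd0, hd1⟩ := lk_arcs L hconn hcne
  have hcn : L.crossingNumber = V.card := by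
    rw [LinkProjection.crossingNumber, ← hV, Nat.card_coe_set_eq, Set.ncard_coe_finset]
  have hVne : V.Nonempty := by
    rw [← Finset.card_pos]; omega
  have hz : (0:ℝ) ∈ Icc (0:ℝ) 1 := ⟨le_rfl, zero_le_one⟩
  have ho : (1:ℝ) ∈ Icc (0:ℝ) 1 := ⟨zero_le_one, le_rfl⟩
  set src : E → Sphere2 := fun e => γ e 0 with hsrc
  set tgt : E → Sphere2 := fun e => γ e 1 with htgt
  have hdeg : ∀ v ∈ V, ∑ e, lkHd src tgt e v = 4 := by
    intro v hv
    have a := hd0 v hv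
    have b := hd1 v hv
    have a' : (Finset.univ.filter fun e => γ e 0 = v).card = 2 := by
      rw [← a]; exact (Nat.subtype_card _ (by simp)).symm
    have b' : (Finset.univ.filter fun e => γ e 1 = v).card = 2 := by
      rw [← b]; exact (Nat.subtype_card _ (by simp)).symm
    simp only [lkHd, Finset.sum_add_distrib, ← Finset.card_filter]
    simp only [hsrc, htgt]
    omega
  have hst : ∀ v ∈ V, ∃ d, γ d 0 = v := by
    intro v hv
    by_contra hcon
    push Not at hcon
    have h0 : {e | γ e 0 = v} = ∅ := by
      rw [Set.eq_empty_iff_forall_notMem]; exact hcon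
    have := hd0 v hv
    rw [h0] at this
    simp at this
  have hpre : IsPreconnected (⋃ d, γ d '' Icc 0 1) := him ▸ hconn.isPreconnected
  have hcut : ∀ A ⊆ V, A.Nonempty → A ≠ V → (lkCut src tgt A).Nonempty := by
    intro A hA hne hAV
    obtain ⟨d, hd⟩ := lk_conn_cut S hst hpre A hA hne hAV
    exact ⟨d, by simpa [lkCut] using hd⟩
  obtain ⟨N, hN⟩ : ∃ N, N ∉ ⋃ d, γ d '' Icc 0 1 := by
    by_contra hcon
    push Not at hcon
    have h1 := lk_sys_interior S
    rw [Set.eq_univ_of_forall hcon, interior_univ] at h1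
    obtain ⟨v, hv⟩ := hVne
    have : v ∈ (univ : Set Sphere2) := trivial
    rw [h1] at this
    exact this
  have hNV : N ∉ V := by
    intro h
    obtain ⟨d, hd⟩ := hst N h
    exact hN (mem_iUnion.2 ⟨d, 0, hz, hd⟩)
  have hNe : ∀ e, ∀ t ∈ Icc (0:ℝ) 1, γ e t ≠ N := fun e t ht h => hN (mem_iUnion.2 ⟨e, t, ht, h⟩)
  obtain ⟨C, W, hC1, hC3, hWV, hWC, hCW, hCcut⟩ := lk_reduce src tgt V hVne S.h0 S.h1 hdeg hcut
    (fun A hA hne hcard => lk_hplan S N hNV hNe src tgt (fun _ => rfl) (fun _ => rfl) A hA hne hcard)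
  let E' := {e // e ∉ C}
  have hd' : ∀ v, ∑ e : E', lkHd src tgt e.1 v = if v ∈ V then (if v ∈ W then 2 else 4) else 0 := by
    intro v
    have h1 : ∑ e ∈ Cᶜ, lkHd src tgt e v = ∑ e : E', lkHd src tgt e.1 v :=
      Finset.sum_subtype Cᶜ (by simp) _
    have h2 := Finset.sum_add_sum_compl C fun e => lkHd src tgt e v
    have h3 := hCW v
    by_cases hv : v ∈ V
    · rw [hdeg v hv] at h2
      rw [if_pos hv]
      split_ifs at h3 ⊢ <;> omega
    · have h4 : ∑ e, lkHd src tgt e v = 0 := by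
        apply Finset.sum_eq_zero
        intro e _
        have a1 : src e ≠ v := fun h => hv (h ▸ S.h0 e)
        have a2 : tgt e ≠ v := fun h => hv (h ▸ S.h1 e)
        simp [lkHd, a1, a2]
      rw [if_neg hv]
      omega
  obtain ⟨o, σ, hσ⟩ := lk_euler (fun e : E' => src e.1) (fun e : E' => tgt e.1) (by
    intro v
    have h1 := hd' v
    simp only [lkHd, Finset.sum_add_distrib, ← Finset.card_filter] at h1
    rw [h1]
    split_ifs <;> decide)
  let γ' : E' → ℝ → Sphere2 := fun e t => if o e then γ e.1 (1 - t) else γ e.1 t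
  have hγ0 : ∀ e : E', γ' e 0 = if o e then tgt e.1 else src e.1 := by
    intro e; simp [γ', hsrc, htgt]
  have hγ1 : ∀ e : E', γ' e 1 = if o e then src e.1 else tgt e.1 := by
    intro e; simp [γ', hsrc, htgt]
  have himg : ∀ e : E', γ' e '' Icc 0 1 = γ e.1 '' Icc 0 1 := by
    intro e
    by_cases h : o e = true
    · ext y
      constructor
      · rintro ⟨t, ht, rfl⟩
        exact ⟨1 - t, ⟨by linarith [ht.2], by linarith [ht.1]⟩, by simp [γ', h]⟩
      · rintro ⟨t, ht, rfl⟩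
        exact ⟨1 - t, ⟨by linarith [ht.2], by linarith [ht.1]⟩, by simp [γ', h]⟩
    · simp [γ', h]
  have S' : LkSys V γ' := by
    refine ⟨?_, ?_, ?_, ?_, ?_⟩
    · intro e
      by_cases h : o e = true
      · simp only [γ', h, if_true]
        exact (S.cont _).comp (by fun_prop)
      · simp only [γ', h]
        exact S.cont _
    · intro e; rw [hγ0]; split_ifs
      · exact S.h1 _
      · exact S.h0 _
    · intro e; rw [hγ1]; split_ifs
      · exact S.h0 _
      · exact S.h1 _
    · intro e t ht
      simp only [γ']
      split_ifs
      · exact S.off _ _ ⟨by linarith [ht.2], by linarith [ht.1]⟩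
      · exact S.off _ _ ht
    · intro e e' t ht t' ht' h
      have ht1 : 1 - t ∈ Ioo (0:ℝ) 1 := ⟨by linarith [ht.2], by linarith [ht.1]⟩
      have ht1' : 1 - t' ∈ Ioo (0:ℝ) 1 := ⟨by linarith [ht'.2], by linarith [ht'.1]⟩
      have hee : e = e' := by
        simp only [γ'] at h
        apply Subtype.ext
        split_ifs at h
        · exact (S.inj _ _ _ ht1 _ ht1' h).1
        · exact (S.inj _ _ _ ht1 _ ht' h).1
        · exact (S.inj _ _ _ ht _ ht1' h).1
        · exact (S.inj _ _ _ ht _ ht' h).1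
      subst hee
      refine ⟨rfl, ?_⟩
      simp only [γ'] at h
      split_ifs at h
      · have := (S.inj _ _ _ ht1 _ ht1' h).2
        linarith
      · exact (S.inj _ _ _ ht _ ht' h).2
  have hσ' : ∀ d, γ' d 1 = γ' (σ d) 0 := by
    intro d
    rw [hγ1, hγ0, hσ]
  have hout : ∀ v, lkOut γ' v = if v ∈ V then (if v ∈ W then 1 else 2) else 0 := by
    intro v
    have e0 : lkOut γ' v = ∑ e : E', if γ' e 0 = v then 1 else 0 := by
      rw [← Finset.card_filter]
      exact Nat.subtype_card _ (by simp)
    have e1 : lkOut γ' v = ∑ e : E', if γ' e 1 = v then 1 else 0 := by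
      rw [e0]
      simp only [hσ']
      exact (Equiv.sum_comp σ fun e => if γ' e 0 = v then 1 else 0).symm
    have e2 : lkOut γ' v + lkOut γ' v = ∑ e : E', lkHd src tgt e.1 v := by
      nth_rewrite 1 [e0]
      rw [e1, ← Finset.sum_add_distrib]
      refine Finset.sum_congr rfl fun e _ => ?_
      rw [hγ0, hγ1, lkHd]
      by_cases h : o e = true
      · simp only [h, if_true]; exact add_comm _ _
      · simp only [h, if_false]; rfl
    rw [hd'] at e2
    split_ifs at e2 ⊢ <;> omega
  obtain ⟨v0, hv0, hv0W⟩ : ∃ v ∈ V, v ∉ W := by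
    by_contra hcon
    push Not at hcon
    have := Finset.card_le_card (show V ⊆ W from hcon)
    omega
  have hneE : Nonempty E' := by
    by_contra hcon
    rw [not_nonempty_iff] at hcon
    have := hd' v0
    rw [if_pos hv0, if_neg hv0W] at this
    simp at this
  obtain ⟨H, hHim, hHcr⟩ := lk_build S' σ hσ' (by
    intro v; rw [hout]; split_ifs <;> omega)
  refine ⟨H, ⟨?_, ?_⟩, ?_, C.card, hC1, hC3, ?_⟩
  · rw [hHim]
    exact ⟨γ' (Classical.arbitrary E') 0, mem_iUnion.2 ⟨_, 0, hz, rfl⟩⟩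
  · rw [hHim]
    apply lk_cut_conn S'
    intro A hA hne hAV
    obtain ⟨e, he⟩ := hCcut A hA hne hAV
    rw [Finset.mem_sdiff] at he
    refine ⟨⟨e, he.2⟩, ?_⟩
    have h1 : ¬ (src e ∈ A ↔ tgt e ∈ A) := by simpa [lkCut] using he.1
    rw [hγ0, hγ1]
    split_ifs <;> tauto
  · rw [hHim, him]
    intro x hx
    obtain ⟨e, he⟩ := mem_iUnion.1 hx
    rw [himg] at he
    exact mem_iUnion.2 ⟨e.1, he⟩
  · have : H.crossings = ((V \ W : Finset Sphere2) : Set Sphere2) := by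
      rw [hHcr]
      ext v
      change lkOut γ' v = 2 ↔ v ∈ ((V \ W : Finset Sphere2) : Set Sphere2)
      rw [hout, Finset.mem_coe, Finset.mem_sdiff]
      split_ifs with h1 h2 <;> simp [*]
    rw [LinkProjection.crossingNumber, this, Nat.card_coe_set_eq, Set.ncard_coe_finset,
      Finset.card_sdiff_of_subset hWV, hcn, hWC]
    have := Finset.card_le_card hWV
    omega


/-! ### Monotonicity -/

theorem lk_sphere_lc : LocallyConnectedSpace Sphere2 := by
  have : Fact (Module.finrank ℝ (EuclideanSpace ℝ (Fin 3)) = 2 + 1) := ⟨by simp⟩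
  exact ChartedSpace.locallyConnectedSpace (EuclideanSpace ℝ (Fin 2)) _

theorem lk_hair {g : ℝ → Sphere2} (hg : Continuous g) {p q : ℝ} (hinj : InjOn g (Icc p q))
    {Y : Set Sphere2} (hY : IsClosed Y) {N : Sphere2} (hN : N ∉ Y ∪ g '' Icc p q) {v : Sphere2}
    (hv : Y ∩ g '' Icc p q ⊆ {v}) {x : Sphere2} (hxY : x ∉ Y) (hxN : x ≠ N)
    {U T : Set Sphere2} (hU : ∀ u ∈ U, U = connectedComponentIn (Y ∪ g '' Icc p q)ᶜ u)
    (hUc : U ⊆ (Y ∪ g '' Icc p q)ᶜ)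
    (hT : T ⊆ (Y ∪ g '' Icc p q)ᶜ) (hxU : x ∈ closure U) (hxT : x ∈ closure T) :
    (U ∩ T).Nonempty := by
  obtain ⟨φ, ψ, hφ, hψ, hψN, h1, h2⟩ := lk_stereo N
  have hYN : Y ⊆ {N}ᶜ := fun y hy h => hN (Or.inl (by rw [← (show y = N from h)]; exact hy))
  have hgN : g '' Icc p q ⊆ {N}ᶜ := fun y hy h => hN (Or.inr (by rw [← (show y = N from h)]; exact hy))
  have hinjφ : InjOn φ {N}ᶜ := by
    intro a ha b hb h
    rw [← h1 a ha, h, h1 b hb]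
  have hYc : IsCompact (φ '' Y) := hY.isCompact.image_of_continuousOn (hφ.mono hYN)
  have hgc : IsCompact (φ '' (g '' Icc p q)) :=
    (isCompact_Icc.image hg).image_of_continuousOn (hφ.mono hgN)
  have hmem : ∀ A ⊆ ({N}ᶜ : Set Sphere2), ∀ a, a ≠ N → (φ a ∈ φ '' A ↔ a ∈ A) := by
    intro A hA a ha
    constructor
    · rintro ⟨b, hb, hab⟩
      rw [← hinjφ (hA hb) ha hab]; exact hb
    · exact fun h => ⟨a, h, rfl⟩
  have hxY' : φ x ∈ (φ '' Y)ᶜ := fun h => hxY ((hmem Y hYN x hxN).1 h)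
  obtain ⟨ε, hε, hball⟩ := Metric.isOpen_iff.1 hYc.isClosed.isOpen_compl _ hxY'
  have hO : IsOpen ({N}ᶜ ∩ φ ⁻¹' Metric.ball (φ x) ε) :=
    hφ.isOpen_inter_preimage isOpen_compl_singleton Metric.isOpen_ball
  have hxO : x ∈ {N}ᶜ ∩ φ ⁻¹' Metric.ball (φ x) ε := ⟨hxN, Metric.mem_ball_self hε⟩
  obtain ⟨u, ⟨huN, huB⟩, hu⟩ := mem_closure_iff.1 hxU _ hO hxO
  obtain ⟨w, ⟨hwN, hwB⟩, hw⟩ := mem_closure_iff.1 hxT _ hO hxO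
  have hnot : ∀ a, a ≠ N → a ∈ (Y ∪ g '' Icc p q)ᶜ → φ a ∉ φ '' Y ∪ φ '' (g '' Icc p q) := by
    rintro a ha hac (h | h)
    · exact hac (Or.inl ((hmem Y hYN a ha).1 h))
    · exact hac (Or.inr ((hmem _ hgN a ha).1 h))
  have hu' := hnot u huN (hUc hu)
  have hw' := hnot w hwN (hT hw)
  have l1 : LkHasLog (fun z => (z - φ u) * (z - φ w)⁻¹) (φ '' Y) :=
    lk_log_of_conn hYc.isClosed (convex_ball (φ x) ε).isPreconnected hball huB hwB
  have l2 : LkHasLog (fun z => (z - φ u) * (z - φ w)⁻¹) ((fun t => φ (g t)) '' Icc p q) := by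
    have hne : ∀ a, φ a ∉ φ '' (g '' Icc p q) → ∀ z ∈ (fun t => φ (g t)) '' Icc p q, z - φ a ≠ 0 := by
      rintro a ha z ⟨t, ht, rfl⟩ h0
      exact ha ⟨g t, ⟨t, ht, rfl⟩, sub_eq_zero.1 h0⟩
    have n1 := hne u fun h => hu' (Or.inr h)
    have n2 := hne w fun h => hw' (Or.inr h)
    refine lk_log_arc ?_ ?_ ?_ ?_
    · exact hφ.comp hg.continuousOn fun t ht => hgN ⟨t, ht, rfl⟩
    · intro t ht t' ht' h
      exact hinj ht ht' (hinjφ (hgN ⟨t, ht, rfl⟩) (hgN ⟨t', ht', rfl⟩) h)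
    · exact (continuousOn_id.sub continuousOn_const).mul
        ((continuousOn_id.sub continuousOn_const).inv₀ n2)
    · intro z hz
      exact mul_ne_zero (n1 z hz) (inv_ne_zero (n2 z hz))
  have himg : (fun t => φ (g t)) '' Icc p q = φ '' (g '' Icc p q) := by
    rw [image_image]
  rw [himg] at l2
  have l3 := lk_glue_point hYc.isClosed hgc.isClosed l1 l2 (φ v) (by
    rintro _ ⟨⟨a, ha, rfl⟩, b, hb, hab⟩
    have : b = a := hinjφ (hgN hb) (hYN ha) hab
    rw [hv ⟨ha, this ▸ hb⟩]
    rfl)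
  have hcomp := lk_same_comp (hYc.union hgc) hu' hw' l3
  refine ⟨w, ?_, hw⟩
  rw [hU u hu]
  have hsub : ψ '' connectedComponentIn (φ '' Y ∪ φ '' (g '' Icc p q))ᶜ (φ u) ⊆
      connectedComponentIn (Y ∪ g '' Icc p q)ᶜ u := by
    apply IsPreconnected.subset_connectedComponentIn
    · exact isPreconnected_connectedComponentIn.image _ hψ.continuousOn
    · exact ⟨φ u, mem_connectedComponentIn hu', h1 u huN⟩
    · rintro _ ⟨z, hz, rfl⟩ hmem
      have hz' := connectedComponentIn_subset _ _ hz
      apply hz'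
      rcases hmem with h | h
      · exact Or.inl ⟨_, h, h2 z⟩
      · exact Or.inr ⟨_, h, h2 z⟩
  exact hsub ⟨φ w, hcomp, h1 w hwN⟩

theorem lk_spread_core {E : Type} [Finite E] {V : Finset Sphere2} {γ : E → ℝ → Sphere2}
    (S : LkSys V γ) {X : Set Sphere2} (hX : X = ⋃ e, γ e '' Icc 0 1) (e : E)
    {p q a b c : ℝ} {J : Set ℝ} (hJ : IsClosed J) (hJI : J ⊆ Icc 0 1) (hpq : Icc p q ⊆ Icc 0 1)
    (hdis : ∀ r ∈ Icc p q, r ∉ J) (hcov : Icc 0 1 ⊆ Icc p q ∪ Ioo a b ∪ J)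
    (hinj : InjOn (γ e) (Icc p q)) (hc : ∀ r ∈ Icc p q, r ∈ Ioo (0:ℝ) 1 ∨ r = c)
    {U T : Set Sphere2} (hU : ∀ u ∈ U, U = connectedComponentIn Xᶜ u) (hUne : U.Nonempty)
    (hUX : U ⊆ Xᶜ) (hTX : T ⊆ Xᶜ) (hUT : U ∩ T = ∅) {s : ℝ} (hs : s ∈ Icc p q)
    (hs' : s ∈ Ioo (0:ℝ) 1) (hsU : γ e s ∈ closure U) (hsT : γ e s ∈ closure T)
    (hab : ∀ r ∈ Ioo a b, γ e r ∉ closure U) : False := by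
  classical
  have := lk_sphere_lc
  have hXc : IsClosed X := by
    rw [hX]
    exact isClosed_iUnion_of_finite fun d => (isCompact_Icc.image (S.cont d)).isClosed
  let Y : Set Sphere2 := (⋃ d ∈ {d | d ≠ e}, γ d '' Icc 0 1) ∪ γ e '' J
  have hYc : IsClosed Y := by
    apply IsClosed.union
    · exact (Set.toFinite {d | d ≠ e}).isClosed_biUnion fun d _ =>
        (isCompact_Icc.image (S.cont d)).isClosed
    · exact ((isCompact_Icc.of_isClosed_subset hJ hJI).image (S.cont e)).isClosed
  have hYr : ∀ r ∈ Ioo (0:ℝ) 1, γ e r ∈ Y → r ∈ J := by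
    rintro r hr (h | ⟨r', hr', h⟩)
    · simp only [mem_iUnion] at h
      obtain ⟨d, hd, t, ht, h⟩ := h
      rcases lk_Icc_cases ht with rfl | rfl | ht
      · exact absurd (h ▸ S.h0 d) (S.off e r hr)
      · exact absurd (h ▸ S.h1 d) (S.off e r hr)
      · exact absurd (S.inj _ _ _ ht _ hr h).1 hd
    · rcases lk_Icc_cases (hJI hr') with rfl | rfl | ht
      · exact absurd (h ▸ S.h0 e) (S.off e r hr)
      · exact absurd (h ▸ S.h1 e) (S.off e r hr)
      · rw [← (S.inj _ _ _ ht _ hr h).2]; exact hr'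
  have hX'X : Y ∪ γ e '' Icc p q ⊆ X := by
    rw [hX]
    rintro y ((h | ⟨r, hr, rfl⟩) | ⟨r, hr, rfl⟩)
    · simp only [mem_iUnion] at h
      obtain ⟨d, -, h⟩ := h
      exact mem_iUnion.2 ⟨d, h⟩
    · exact mem_iUnion.2 ⟨e, r, hJI hr, rfl⟩
    · exact mem_iUnion.2 ⟨e, r, hpq hr, rfl⟩
  have hXX' : X ⊆ (Y ∪ γ e '' Icc p q) ∪ γ e '' Ioo a b := by
    rw [hX]
    intro y hy
    obtain ⟨d, t, ht, rfl⟩ := mem_iUnion.1 hy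
    by_cases hd : d = e
    · subst hd
      rcases hcov ht with (h | h) | h
      · exact Or.inl (Or.inr ⟨t, h, rfl⟩)
      · exact Or.inr ⟨t, h, rfl⟩
      · exact Or.inl (Or.inl (Or.inr ⟨t, h, rfl⟩))
    · exact Or.inl (Or.inl (Or.inl (mem_biUnion (show d ∈ {d | d ≠ e} from hd) ⟨t, ht, rfl⟩)))
  obtain ⟨N, hN⟩ := hUne
  have hNX : N ∉ X := hUX hN
  have hUo : IsOpen U := by
    rw [hU N hN]; exact hXc.isOpen_compl.connectedComponentIn
  have hU' : ∀ u ∈ U, U = connectedComponentIn (Y ∪ γ e '' Icc p q)ᶜ u := by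
    intro u hu
    apply Subset.antisymm
    · rw [hU u hu]
      exact connectedComponentIn_mono _ (compl_subset_compl.2 hX'X)
    · refine isPreconnected_connectedComponentIn.subset_of_closure_inter_subset hUo
        ⟨u, mem_connectedComponentIn (fun h => hUX hu (hX'X h)), hu⟩ ?_
      rintro y ⟨hy1, hy2⟩
      by_contra hyU
      have hyf : y ∈ frontier U := ⟨hy1, by rwa [hUo.interior_eq]⟩
      have hyX : y ∈ X := by
        rw [hU u hu] at hyf
        exact lk_comp_frontier hXc u hyf
      rcases hXX' hyX with h | ⟨r, hr, rfl⟩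
      · exact connectedComponentIn_subset _ _ hy2 h
      · exact hab r hr hy1
  have := lk_hair (S.cont e) hinj hYc (N := N) (fun h => hNX (hX'X h)) (v := γ e c) (x := γ e s)
    (U := U) (T := T) ?_ ?_ ?_ hU' ?_ ?_ hsU hsT
  · rw [hUT] at this
    exact not_nonempty_empty this
  · rintro _ ⟨hy, r, hr, rfl⟩
    rcases hc r hr with h | h
    · exact absurd (hYr r h hy) (hdis r hr)
    · rw [h]; rfl
  · intro h
    exact hdis s hs (hYr s hs' h)
  · intro h
    exact hNX (h ▸ hX'X (Or.inr ⟨s, hs, rfl⟩))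
  · exact fun y hy h => hUX hy (hX'X h)
  · exact fun y hy h => hTX hy (hX'X h)

theorem lk_spread {E : Type} [Finite E] {V : Finset Sphere2} {γ : E → ℝ → Sphere2}
    (S : LkSys V γ) {X : Set Sphere2} (hX : X = ⋃ e, γ e '' Icc 0 1) (e : E)
    {U T : Set Sphere2} (hU : ∀ u ∈ U, U = connectedComponentIn Xᶜ u) (hUne : U.Nonempty)
    (hUX : U ⊆ Xᶜ) (hTX : T ⊆ Xᶜ) (hUT : U ∩ T = ∅) {s : ℝ}
    (hs' : s ∈ Ioo (0:ℝ) 1) (hsU : γ e s ∈ closure U) (hsT : γ e s ∈ closure T) :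
    γ e 0 ∈ closure U := by
  have hall : ∀ t ∈ Ioo (0:ℝ) 1, γ e t ∈ closure U := by
    intro t ht
    by_contra hcon
    have hop : IsOpen (Ioo (0:ℝ) 1 ∩ γ e ⁻¹' (closure U)ᶜ) :=
      isOpen_Ioo.inter (isClosed_closure.isOpen_compl.preimage (S.cont e))
    obtain ⟨ε, hε, hball⟩ := Metric.isOpen_iff.1 hop t ⟨ht, hcon⟩
    have hnb : ∀ r, |r - t| < ε → r ∈ Ioo (0:ℝ) 1 ∧ γ e r ∉ closure U := by
      intro r hr
      have := hball (show r ∈ Metric.ball t ε by rwa [Metric.mem_ball, Real.dist_eq])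
      exact this
    have ha := (hnb (t - ε/2) (by rw [abs_lt]; constructor <;> linarith)).1
    have hb := (hnb (t + ε/2) (by rw [abs_lt]; constructor <;> linarith)).1
    have hab : ∀ r ∈ Ioo (t - ε/2) (t + ε/2), γ e r ∉ closure U := fun r hr =>
      (hnb r (by rw [abs_lt]; constructor <;> linarith [hr.1, hr.2])).2
    have hsd : ¬ |s - t| < ε := fun h => (hnb s h).2 hsU
    rcases le_total s t with hst | hst
    · refine lk_spread_core S hX e (p := 0) (q := t - ε/2) (a := t - ε/2) (b := t + ε/2) (c := 0)
        (J := Icc (t + ε/2) 1) isClosed_Icc ?_ ?_ ?_ ?_ ?_ ?_ hU hUne hUX hTX hUT (s := s) ?_ hs'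
        hsU hsT hab
      · exact fun r hr => ⟨by linarith [hr.1, hb.1], hr.2⟩
      · exact fun r hr => ⟨hr.1, by linarith [hr.2, ha.2]⟩
      · intro r hr hr'
        linarith [hr.2, hr'.1]
      · intro r hr
        rcases le_or_gt r (t - ε/2) with h | h
        · exact Or.inl (Or.inl ⟨hr.1, h⟩)
        · rcases lt_or_ge r (t + ε/2) with h' | h'
          · exact Or.inl (Or.inr ⟨h, h'⟩)
          · exact Or.inr ⟨h', hr.2⟩
      · intro r hr r' hr' h
        rcases eq_or_lt_of_le hr.1 with h0 | h0 <;> rcases eq_or_lt_of_le hr'.1 with h0' | h0'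
        · rw [← h0, ← h0']
        · exact absurd (by rw [← h, ← h0]; exact S.h0 e)
            (S.off e r' ⟨h0', by linarith [hr'.2, ha.2]⟩)
        · exact absurd (by rw [h, ← h0']; exact S.h0 e) (S.off e r ⟨h0, by linarith [hr.2, ha.2]⟩)
        · exact (S.inj e e r ⟨h0, by linarith [hr.2, ha.2]⟩ r' ⟨h0', by linarith [hr'.2, ha.2]⟩ h).2
      · intro r hr
        rcases eq_or_lt_of_le hr.1 with h0 | h0
        · exact Or.inr h0.symm
        · exact Or.inl ⟨h0, by linarith [hr.2, ha.2]⟩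
      · refine ⟨hs'.1.le, ?_⟩
        rw [abs_of_nonpos (by linarith)] at hsd
        linarith
    · refine lk_spread_core S hX e (p := t + ε/2) (q := 1) (a := t - ε/2) (b := t + ε/2) (c := 1)
        (J := Icc 0 (t - ε/2)) isClosed_Icc ?_ ?_ ?_ ?_ ?_ ?_ hU hUne hUX hTX hUT (s := s) ?_ hs'
        hsU hsT hab
      · exact fun r hr => ⟨hr.1, by linarith [hr.2, ha.2]⟩
      · exact fun r hr => ⟨by linarith [hr.1, hb.1], hr.2⟩
      · intro r hr hr'
        linarith [hr.1, hr'.2]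
      · intro r hr
        rcases le_or_gt r (t - ε/2) with h | h
        · exact Or.inr ⟨hr.1, h⟩
        · rcases lt_or_ge r (t + ε/2) with h' | h'
          · exact Or.inl (Or.inr ⟨h, h'⟩)
          · exact Or.inl (Or.inl ⟨h', hr.2⟩)
      · intro r hr r' hr' h
        rcases eq_or_lt_of_le hr.2 with h0 | h0 <;> rcases eq_or_lt_of_le hr'.2 with h0' | h0'
        · rw [h0, h0']
        · exact absurd (by rw [← h, h0]; exact S.h1 e)
            (S.off e r' ⟨by linarith [hr'.1, hb.1], h0'⟩)
        · exact absurd (by rw [h, h0']; exact S.h1 e) (S.off e r ⟨by linarith [hr.1, hb.1], h0⟩)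
        · exact (S.inj e e r ⟨by linarith [hr.1, hb.1], h0⟩ r' ⟨by linarith [hr'.1, hb.1], h0'⟩ h).2
      · intro r hr
        rcases eq_or_lt_of_le hr.2 with h0 | h0
        · exact Or.inr h0
        · exact Or.inl ⟨by linarith [hr.1, hb.1], h0⟩
      · refine ⟨?_, hs'.2.le⟩
        rw [abs_of_nonneg (by linarith)] at hsd
        linarith
  have h0 : (0:ℝ) ∈ closure (Ioo (0:ℝ) 1) := by
    rw [closure_Ioo zero_ne_one]; exact ⟨le_rfl, zero_le_one⟩
  have hcl : IsClosed (γ e ⁻¹' closure U) := isClosed_closure.preimage (S.cont e)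
  exact closure_minimal (fun t ht => hall t ht) hcl h0

theorem lk_region_props (L : LinkProjection) {U : Set Sphere2} (hU : L.IsRegion U) :
    (∀ u ∈ U, U = connectedComponentIn L.imageᶜ u) ∧ U.Nonempty ∧ U ⊆ L.imageᶜ ∧ IsOpen U ∧
      frontier U ⊆ L.image := by
  have := lk_sphere_lc
  obtain ⟨x, hx, rfl⟩ := hU
  have hcl : IsClosed L.image := (isCompact_range L.f.continuous).isClosed
  exact ⟨fun u hu => connectedComponentIn_eq hu, ⟨x, mem_connectedComponentIn hx⟩,
    connectedComponentIn_subset _ _, hcl.isOpen_compl.connectedComponentIn,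
    lk_comp_frontier hcl x⟩

theorem lk_disj (H : LinkProjection) (hconn : H.Connected) (hc : H.crossings.Nonempty)
    {U T : Set Sphere2} (hU : H.IsRegion U) (hT : H.IsRegion T) (hne : U ≠ T)
    (hind : H.IndepPair U T) : closure U ∩ closure T = ∅ := by
  obtain ⟨E, hE, V, γ, hV, S, him, -, -⟩ := lk_arcs H hconn hc
  obtain ⟨u1, u2, u3, u4, u5⟩ := lk_region_props H hU
  obtain ⟨t1, t2, t3, t4, t5⟩ := lk_region_props H hT
  have hdis : U ∩ T = ∅ := by
    rw [Set.eq_empty_iff_forall_notMem]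
    rintro x ⟨hx, hx'⟩
    exact hne ((u1 x hx).trans (t1 x hx').symm)
  rw [Set.eq_empty_iff_forall_notMem]
  rintro x ⟨hxU, hxT⟩
  have hxU' : x ∉ U := by
    intro h
    obtain ⟨y, hy, hy'⟩ := mem_closure_iff.1 hxT U u4 h
    have : y ∈ U ∩ T := ⟨hy, hy'⟩
    rw [hdis] at this; exact this
  have hxT' : x ∉ T := by
    intro h
    obtain ⟨y, hy, hy'⟩ := mem_closure_iff.1 hxU T t4 h
    have : y ∈ U ∩ T := ⟨hy', hy⟩
    rw [hdis] at this; exact this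
  have fr : ∀ y ∈ H.crossings, y ∈ closure U → y ∈ closure T → y ∈ H.image → False := by
    intro y hy a b hyi
    refine hind y hy ⟨⟨a, ?_⟩, b, ?_⟩
    · rw [u4.interior_eq]; exact fun h => u3 h hyi
    · rw [t4.interior_eq]; exact fun h => t3 h hyi
  have hxi : x ∈ H.image := u5 ⟨hxU, by rwa [u4.interior_eq]⟩
  have hxi' := hxi
  rw [him] at hxi'
  obtain ⟨e, s, hs, rfl⟩ := mem_iUnion.1 hxi'
  rcases lk_Icc_cases hs with rfl | rfl | hs
  · exact fr _ (by rw [← hV]; exact S.h0 e) hxU hxT hxi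
  · exact fr _ (by rw [← hV]; exact S.h1 e) hxU hxT hxi
  · refine fr (γ e 0) (by rw [← hV]; exact S.h0 e)
      (lk_spread S him e u1 u2 u3 t3 hdis hs hxU hxT)
      (lk_spread S him e t1 t2 t3 u3 (by rw [inter_comm]; exact hdis) hs hxT hxU) ?_
    rw [him]
    exact mem_iUnion.2 ⟨e, 0, ⟨le_rfl, zero_le_one⟩, rfl⟩

theorem lk_mono (L H : LinkProjection) (hL : L.Connected) (hLc : L.crossings.Nonempty)
    (hH : H.Connected) (hHc : H.crossings.Nonempty) (hsub : H.image ⊆ L.image) (m : ℕ)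
    (h : H.HasIndepRegions m) : L.HasIndepRegions m := by
  classical
  obtain ⟨S, ⟨hreg, hind⟩, hcard⟩ := h
  have hintr : interior L.image = ∅ := by
    obtain ⟨E, hE, V, γ, hV, S, him, -, -⟩ := lk_arcs L hL hLc
    rw [him]; exact lk_sys_interior S
  have hz : ∀ U : Set Sphere2, ∃ z, U ∈ S → z ∈ U ∧ z ∉ L.image := by
    intro U
    by_cases hU : U ∈ S
    · obtain ⟨u1, u2, u3, u4, u5⟩ := lk_region_props H (hreg U hU)
      by_contra hcon
      push Not at hcon
      have : U ⊆ interior L.image := interior_maximal (fun z hz => by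
        by_contra hz'
        exact hz' ((hcon z).2 hz)) u4
      rw [hintr] at this
      obtain ⟨y, hy⟩ := u2
      exact this hy
    · exact ⟨Classical.choice hH.nonempty.to_type, fun h => absurd h hU⟩
  choose z hz using hz
  let g : Set Sphere2 → Set Sphere2 := fun U => connectedComponentIn L.imageᶜ (z U)
  have hzg : ∀ U ∈ S, z U ∈ g U := fun U hU => mem_connectedComponentIn (hz U hU).2
  have hgU : ∀ U ∈ S, g U ⊆ U := by
    intro U hU
    have h1 := (lk_region_props H (hreg U hU)).1 (z U) (hz U hU).1
    conv_rhs => rw [h1]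
    exact connectedComponentIn_mono _ (compl_subset_compl.2 hsub)
  have hdis : ∀ U ∈ S, ∀ T ∈ S, U ≠ T → closure U ∩ closure T = ∅ := fun U hU T hT hne =>
    lk_disj H hH hHc (hreg U hU) (hreg T hT) hne (hind hU hT hne)
  refine ⟨S.image g, ⟨?_, ?_⟩, ?_⟩
  · intro R hR
    obtain ⟨U, hU, rfl⟩ := Finset.mem_image.1 hR
    exact ⟨z U, (hz U hU).2, rfl⟩
  · intro R hR R' hR' hne p hp hpp
    obtain ⟨U, hU, rfl⟩ := Finset.mem_image.1 hR
    obtain ⟨T, hT, rfl⟩ := Finset.mem_image.1 hR'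
    have hUT : U ≠ T := fun h => hne (by rw [h])
    have : p ∈ closure U ∩ closure T :=
      ⟨closure_mono (hgU U hU) hpp.1.1, closure_mono (hgU T hT) hpp.2.1⟩
    rw [hdis U hU T hT hUT] at this
    exact this
  · rw [Finset.card_image_of_injOn]
    · exact hcard
    · intro U hU T hT hg
      by_contra hne
      have h1 := hzg U hU
      have hg' : g U = g T := hg
      have : z U ∈ closure U ∩ closure T :=
        ⟨subset_closure (hgU U hU h1), subset_closure (hgU T hT (hg' ▸ h1))⟩
      rw [hdis U hU T hT hne] at this
      exact this

theorem lk_main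
    (n m : ℕ) (hn : 0 < n) (hm : 0 < m)
    (h : ∀ L : LinkProjection, L.Connected →
      (L.crossingNumber = n ∨ L.crossingNumber = n + 1 ∨ L.crossingNumber = n + 2) →
      L.HasIndepRegions m) :
    ∀ L : LinkProjection, L.Connected → n ≤ L.crossingNumber →
      L.HasIndepRegions m := by
  have hne : ∀ L : LinkProjection, 0 < L.crossingNumber → L.crossings.Nonempty := by
    intro L hL
    rw [Set.nonempty_iff_ne_empty]
    intro h
    rw [LinkProjection.crossingNumber, h] at hL
    simp at hL
  have key : ∀ c, ∀ L : LinkProjection, L.crossingNumber = c → L.Connected → n ≤ c →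
      L.HasIndepRegions m := by
    intro c
    induction c using Nat.strong_induction_on with
    | _ c ih =>
      intro L hLc hL hnc
      by_cases hsmall : c ≤ n + 2
      · exact h L hL (by omega)
      · obtain ⟨H, hH, hsub, k, hk1, hk3, hk⟩ := lk_step L hL (by omega)
        have := ih H.crossingNumber (by omega) H rfl hH (by omega)
        exact lk_mono L H hL (hne L (by omega)) hH (hne H (by omega)) hsub m this
  exact fun L hL hnL => key _ L rfl hL hnL

/-- **Lemma (induction on the crossing number).**
Let `n, m` be positive integers.  If all the connected link projections with
`n`, `n+1` or `n+2` crossings have `m` or more pairwise independent regions,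
then all the connected link projections with `n` or more crossings have `m` or
more pairwise independent regions. -/
theorem link_indep_regions_of_base_cases
    (n m : ℕ) (hn : 0 < n) (hm : 0 < m)
    (h : ∀ L : LinkProjection, L.Connected →
      (L.crossingNumber = n ∨ L.crossingNumber = n + 1 ∨ L.crossingNumber = n + 2) →
      L.HasIndepRegions m) :
    ∀ L : LinkProjection, L.Connected → n ≤ L.crossingNumber →
      L.HasIndepRegions m := by
  exact lk_main n m hn hm h
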